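/- There exist a real number r > 1, a constant c ≥ 1, and a functional E : C(F) → [0,∞] with the following properties: (1) comparability: c⁻¹·sup_{n≥0} 𝓡_n·D_n(f|_{V_n}) ≤ E(f) ≤ c·sup_{n≥0} 𝓡_n·D_n(f|_{V_n}) for every f ∈ C(F); (2) self-similarity: E(f) = r·Σ_{a∈A} E(f∘Ψ_a) for every f ∈ C(F), where f∘Ψ_a ∈ C(F) since Ψ_a(F) ⊆ F; (3) Markov property: E(min(max(f,0),1)) ≤ E(f) for every f ∈ C(F); (4) the set 𝓕 := {f ∈ C(F) : E(f) < ∞} is a linear subspace of C(F) that is dense in C(F) with respect to the sup norm, and on 𝓕 the functional E satisfies the parallelogram law E(f+g) + E(f−g) = 2E(f) + 2E(g); (5) strong locality: if f, g ∈ 𝓕 and f is constant on an open neighbourhood in F of the support of g, then E(f+g) = E(f) + E(g); (6) c⁻¹·rⁿ ≤ 𝓡_n ≤ c·rⁿ for all n ≥ 0. (Existence of a self-similar, strongly local, Markovian energy; Theorem 4.3 of the paper in the planar case.) -/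

import Mathlib

open Finset
open scoped Classical

namespace Carpet

/-- The contraction map `Ψ_{(a,b)}(x,y) = ((x+a)/L, (y+b)/L)`. -/
noncomputable def Psi (L : ℕ) (p : ℕ × ℕ) (x : ℝ × ℝ) : ℝ × ℝ :=
  ((x.1 + p.1) / L, (x.2 + p.2) / L)

/-- Words of length `n` over the alphabet `A`. -/
abbrev Word (A : Finset (ℕ × ℕ)) (n : ℕ) := Fin n → {p : ℕ × ℕ // p ∈ A}

/-- `Ψ_w = Ψ_{w₁} ∘ ⋯ ∘ Ψ_{w_n}`. -/
noncomputable def PsiW (L : ℕ) {A : Finset (ℕ × ℕ)} {n : ℕ} (w : Word A n) : ℝ × ℝ → ℝ × ℝ :=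
  (List.ofFn fun i => Psi L (w i).1).foldr (· ∘ ·) id

/-- The four corners of the unit square. -/
noncomputable def V0 : Finset (ℝ × ℝ) :=
  {((0 : ℝ), (0 : ℝ)), ((1 : ℝ), (0 : ℝ)), ((1 : ℝ), (1 : ℝ)), ((0 : ℝ), (1 : ℝ))}

/-- The level-`n` vertex set `V_n = ⋃_{w ∈ W_n} Ψ_w(V₀)`. -/
noncomputable def VN (L : ℕ) (A : Finset (ℕ × ℕ)) (n : ℕ) : Finset (ℝ × ℝ) :=
  (Finset.univ : Finset (Word A n)).biUnion fun w => V0.image (PsiW L w)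

/-- Euclidean distance in the plane. -/
noncomputable def eudist (x y : ℝ × ℝ) : ℝ :=
  Real.sqrt ((x.1 - y.1) ^ 2 + (x.2 - y.2) ^ 2)

/-- `n`-adjacency: `x = Ψ_w(p)`, `y = Ψ_w(q)` with `p, q ∈ V₀`, `|p - q| = 1`. -/
def Adj (L : ℕ) (A : Finset (ℕ × ℕ)) (n : ℕ) (x y : ℝ × ℝ) : Prop :=
  ∃ w : Word A n, ∃ p ∈ V0, ∃ q ∈ V0,
    eudist p q = 1 ∧ x = PsiW L w p ∧ y = PsiW L w q

/-- The natural graph energy `D_n(f) = Σ_{x ∼ y} (f x - f y)²`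
(summing over ordered pairs and halving). -/
noncomputable def Dform (L : ℕ) (A : Finset (ℕ × ℕ)) (n : ℕ) (f : ℝ × ℝ → ℝ) : ℝ :=
  (1 / 2) * ∑ x ∈ VN L A n, ∑ y ∈ VN L A n,
    (if Adj L A n x y then (f x - f y) ^ 2 else 0)

/-- The effective resistance between `S` and `T` in the level-`n` graph. -/
noncomputable def EffRes (L : ℕ) (A : Finset (ℕ × ℕ)) (n : ℕ) (S T : Set (ℝ × ℝ)) : ℝ :=
  (sInf {e : ℝ | ∃ f : ℝ × ℝ → ℝ,
      (∀ x ∈ S, f x = 1) ∧ (∀ x ∈ T, f x = 0) ∧ e = Dform L A n f})⁻¹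

/-- `𝓡_n`, the resistance between the corners `(0,0)` and `(1,0)`. -/
noncomputable def RR (L : ℕ) (A : Finset (ℕ × ℕ)) (n : ℕ) : ℝ :=
  EffRes L A n {((0 : ℝ), (0 : ℝ))} {((1 : ℝ), (0 : ℝ))}

/-- `𝓡̄_n`, the resistance between the left and right sides of the unit square. -/
noncomputable def RRbar (L : ℕ) (A : Finset (ℕ × ℕ)) (n : ℕ) : ℝ :=
  EffRes L A n
    ((VN L A n : Set (ℝ × ℝ)) ∩ ({(0 : ℝ)} ×ˢ Set.Icc (0 : ℝ) 1))
    ((VN L A n : Set (ℝ × ℝ)) ∩ ({(1 : ℝ)} ×ˢ Set.Icc (0 : ℝ) 1))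

/-- The standing assumptions on `(L, A)` defining a generalized Sierpiński carpet. -/
structure GoodCarpet (L : ℕ) (A : Finset (ℕ × ℕ)) : Prop where
  three_le : 3 ≤ L
  mem_lt : ∀ p ∈ A, p.1 < L ∧ p.2 < L
  symm_swap : ∀ a b : ℕ, (a, b) ∈ A → (b, a) ∈ A
  symm_reflect : ∀ a b : ℕ, (a, b) ∈ A → (L - 1 - a, b) ∈ A
  connected : IsConnected
    (⋃ p ∈ A, Set.Icc (((p.1 : ℝ) / L, (p.2 : ℝ) / L) : ℝ × ℝ)
      ((((p.1 : ℝ) + 1) / L, ((p.2 : ℝ) + 1) / L) : ℝ × ℝ))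
  flat_border : ∀ a b : ℕ, a < L → b < L →
    (a = 0 ∨ a = L - 1 ∨ b = 0 ∨ b = L - 1) → (a, b) ∈ A
  proper : ∃ a b : ℕ, a < L ∧ b < L ∧ (a, b) ∉ A

/-- The generalized Sierpiński carpet `F`. -/
def carpetF (L : ℕ) (A : Finset (ℕ × ℕ)) : Set (ℝ × ℝ) :=
  ⋂ n : ℕ, ⋃ w : Word A n, PsiW L w '' Set.Icc (((0 : ℝ), (0 : ℝ)) : ℝ × ℝ) ((1 : ℝ), (1 : ℝ))


section Proof

variable {L : ℕ} {A : Finset (ℕ × ℕ)}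


/-! ### Part 1: the integer model -/

/-- Shift of a function on the grid. -/
def sh (a b : ℤ) (f : ℤ → ℤ → ℝ) : ℤ → ℤ → ℝ := fun x y => f (a + x) (b + y)

/-- Energy of the unit cell. -/
def Q0 (f : ℤ → ℤ → ℝ) : ℝ :=
  (f 0 0 - f 1 0) ^ 2 + (f 1 0 - f 1 1) ^ 2 + (f 1 1 - f 0 1) ^ 2 + (f 0 1 - f 0 0) ^ 2

/-- Cell-sum energy at level `n`. -/
noncomputable def QQ (L : ℕ) (A : Finset (ℕ × ℕ)) : ℕ → (ℤ → ℤ → ℝ) → ℝ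
  | 0, f => Q0 f
  | n + 1, f => ∑ a ∈ A, QQ L A n (sh ((a.1 : ℤ) * (L : ℤ) ^ n) ((a.2 : ℤ) * (L : ℤ) ^ n) f)

/-- `(i,j)` is the lower left corner of a level-`n` cell. -/
def IsCell (L : ℕ) (A : Finset (ℕ × ℕ)) : ℕ → ℤ → ℤ → Prop
  | 0, i, j => i = 0 ∧ j = 0
  | n + 1, i, j => ∃ a ∈ A, ∃ i' j' : ℤ, IsCell L A n i' j' ∧
      i = (a.1 : ℤ) * (L : ℤ) ^ n + i' ∧ j = (a.2 : ℤ) * (L : ℤ) ^ n + j'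


lemma sh_sh (a b c d : ℤ) (f : ℤ → ℤ → ℝ) : sh c d (sh a b f) = sh (a + c) (b + d) f := by
  funext x y
  simp only [sh]
  congr 1 <;> ring

lemma sh_zero (f : ℤ → ℤ → ℝ) : sh 0 0 f = f := by
  funext x y
  simp [sh]

lemma Q0_nonneg (f : ℤ → ℤ → ℝ) : 0 ≤ Q0 f := by
  unfold Q0; positivity

lemma QQ_nonneg (n : ℕ) : ∀ f : ℤ → ℤ → ℝ, 0 ≤ QQ L A n f := by
  induction n with
  | zero => intro f; exact Q0_nonneg f
  | succ n ih => intro f; exact Finset.sum_nonneg fun a _ => ih _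

lemma QQ_succ (n : ℕ) (f : ℤ → ℤ → ℝ) : QQ L A (n + 1) f =
    ∑ a ∈ A, QQ L A n (sh ((a.1 : ℤ) * (L : ℤ) ^ n) ((a.2 : ℤ) * (L : ℤ) ^ n) f) := rfl

/-- General comparison principle. -/
lemma QQ_mono_gen {ι : Type*} (s : Finset ι) (c : ι → ℝ) (n : ℕ) :
    ∀ (g : ℤ → ℤ → ℝ) (F : ι → ℤ → ℤ → ℝ),
    (∀ i j, IsCell L A n i j → Q0 (sh i j g) ≤ ∑ b ∈ s, c b * Q0 (sh i j (F b))) →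
    QQ L A n g ≤ ∑ b ∈ s, c b * QQ L A n (F b) := by
  induction n with
  | zero =>
    intro g F h
    have := h 0 0 ⟨rfl, rfl⟩
    simp only [sh_zero] at this
    exact this
  | succ n ih =>
    intro g F h
    rw [QQ_succ]
    calc _ ≤ ∑ a ∈ A, ∑ b ∈ s, c b * QQ L A n (sh ((a.1 : ℤ) * (L : ℤ) ^ n)
            ((a.2 : ℤ) * (L : ℤ) ^ n) (F b)) := by
          apply Finset.sum_le_sum
          intro a ha
          apply ih
          intro i j hij
          have := h _ _ ⟨a, ha, i, j, hij, rfl, rfl⟩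
          simpa only [sh_sh] using this
      _ = _ := by
          rw [Finset.sum_comm]
          apply Finset.sum_congr rfl
          intro b _
          rw [QQ_succ, Finset.mul_sum]

lemma QQ_mono (n : ℕ) (c : ℝ) (g f : ℤ → ℤ → ℝ)
    (h : ∀ i j, IsCell L A n i j → Q0 (sh i j g) ≤ c * Q0 (sh i j f)) :
    QQ L A n g ≤ c * QQ L A n f := by
  have := QQ_mono_gen (L := L) (A := A) ({()} : Finset Unit) (fun _ => c) n g (fun _ => f)
    (by simpa using h)
  simpa using this

lemma QQ_mono_two (n : ℕ) (c d : ℝ) (g f f' : ℤ → ℤ → ℝ)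
    (h : ∀ i j, IsCell L A n i j → Q0 (sh i j g) ≤ c * Q0 (sh i j f) + d * Q0 (sh i j f')) :
    QQ L A n g ≤ c * QQ L A n f + d * QQ L A n f' := by
  have := QQ_mono_gen (L := L) (A := A) (Finset.univ : Finset Bool)
    (fun b => if b then c else d) n g (fun b => if b then f else f')
    (by simpa using h)
  simpa using this

lemma isCell_bounds (hA : ∀ p ∈ A, p.1 < L ∧ p.2 < L) (n : ℕ) : ∀ i j : ℤ, IsCell L A n i j →
    0 ≤ i ∧ i + 1 ≤ (L : ℤ) ^ n ∧ 0 ≤ j ∧ j + 1 ≤ (L : ℤ) ^ n := by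
  induction n with
  | zero => rintro i j ⟨rfl, rfl⟩; simp
  | succ n ih =>
    rintro i j ⟨a, ha, i', j', hc, rfl, rfl⟩
    obtain ⟨h1, h2, h3, h4⟩ := ih _ _ hc
    obtain ⟨ha1, ha2⟩ := hA a ha
    have e1 : ((a.1 : ℤ) + 1) * (L : ℤ) ^ n ≤ (L : ℤ) * (L : ℤ) ^ n := by
      gcongr; exact_mod_cast ha1
    have e2 : ((a.2 : ℤ) + 1) * (L : ℤ) ^ n ≤ (L : ℤ) * (L : ℤ) ^ n := by
      gcongr; exact_mod_cast ha2
    have e3 : 0 ≤ (a.1 : ℤ) * (L : ℤ) ^ n := by positivity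
    have e4 : 0 ≤ (a.2 : ℤ) * (L : ℤ) ^ n := by positivity
    rw [pow_succ']
    refine ⟨by linarith, by linarith, by linarith, by linarith⟩

lemma Q0_congr {f g : ℤ → ℤ → ℝ} (h00 : f 0 0 = g 0 0) (h10 : f 1 0 = g 1 0)
    (h01 : f 0 1 = g 0 1) (h11 : f 1 1 = g 1 1) : Q0 f = Q0 g := by
  simp only [Q0, h00, h10, h01, h11]

lemma QQ_congr (hA : ∀ p ∈ A, p.1 < L ∧ p.2 < L) (n : ℕ) (f g : ℤ → ℤ → ℝ)
    (h : ∀ x y : ℤ, 0 ≤ x → x ≤ (L : ℤ) ^ n → 0 ≤ y → y ≤ (L : ℤ) ^ n → f x y = g x y) :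
    QQ L A n f = QQ L A n g := by
  have key : ∀ i j, IsCell L A n i j → Q0 (sh i j f) = Q0 (sh i j g) := by
    intro i j hc
    obtain ⟨h1, h2, h3, h4⟩ := isCell_bounds hA n i j hc
    apply Q0_congr <;> apply h <;> omega
  apply le_antisymm
  · simpa using QQ_mono (L := L) (A := A) n 1 f g (fun i j hc => by rw [key i j hc, one_mul])
  · simpa using QQ_mono (L := L) (A := A) n 1 g f (fun i j hc => by rw [key i j hc, one_mul])

lemma QQ_add_le (n : ℕ) (f g : ℤ → ℤ → ℝ) :
    QQ L A n (fun x y => f x y + g x y) ≤ 2 * QQ L A n f + 2 * QQ L A n g := by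
  apply QQ_mono_two
  intro i j _
  simp only [Q0, sh]
  nlinarith [sq_nonneg ((f (i+0) (j+0) - f (i+1) (j+0)) - (g (i+0) (j+0) - g (i+1) (j+0))),
    sq_nonneg ((f (i+1) (j+0) - f (i+1) (j+1)) - (g (i+1) (j+0) - g (i+1) (j+1))),
    sq_nonneg ((f (i+1) (j+1) - f (i+0) (j+1)) - (g (i+1) (j+1) - g (i+0) (j+1))),
    sq_nonneg ((f (i+0) (j+1) - f (i+0) (j+0)) - (g (i+0) (j+1) - g (i+0) (j+0)))]

lemma QQ_affine (n : ℕ) (α β : ℝ) : ∀ (f : ℤ → ℤ → ℝ),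
    QQ L A n (fun x y => α * f x y + β) = α ^ 2 * QQ L A n f := by
  induction n with
  | zero => intro f; simp only [QQ, Q0]; ring
  | succ n ih =>
    intro f
    rw [QQ_succ, QQ_succ, Finset.mul_sum]
    exact Finset.sum_congr rfl fun a _ => ih _

lemma QQ_parallelogram (n : ℕ) : ∀ (f g : ℤ → ℤ → ℝ),
    QQ L A n (fun x y => f x y + g x y) + QQ L A n (fun x y => f x y - g x y) =
      2 * QQ L A n f + 2 * QQ L A n g := by
  induction n with
  | zero => intro f g; simp only [QQ, Q0]; ring
  | succ n ih =>
    intro f g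
    rw [QQ_succ, QQ_succ, QQ_succ, QQ_succ, Finset.mul_sum, Finset.mul_sum,
      ← Finset.sum_add_distrib, ← Finset.sum_add_distrib]
    exact Finset.sum_congr rfl fun a _ => ih _ _

/-- contraction principle -/
lemma QQ_contract (n : ℕ) (φ : ℝ → ℝ) (hφ : ∀ s t, |φ s - φ t| ≤ |s - t|) (f : ℤ → ℤ → ℝ) :
    QQ L A n (fun x y => φ (f x y)) ≤ QQ L A n f := by
  have := QQ_mono (L := L) (A := A) n 1 (fun x y => φ (f x y)) f (by
    intro i j _
    rw [one_mul]
    simp only [Q0, sh]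
    have h := fun s t => sq_le_sq.2 (hφ s t)
    exact add_le_add (add_le_add (add_le_add (h _ _) (h _ _)) (h _ _)) (h _ _))
  simpa using this

lemma QQ_swap (hs : ∀ a b : ℕ, (a, b) ∈ A → (b, a) ∈ A) (n : ℕ) : ∀ f : ℤ → ℤ → ℝ,
    QQ L A n (fun x y => f y x) = QQ L A n f := by
  induction n with
  | zero => intro f; simp only [QQ, Q0]; ring
  | succ n ih =>
    intro f
    rw [QQ_succ, QQ_succ]
    refine Finset.sum_nbij' Prod.swap Prod.swap (fun a ha => hs _ _ ha) (fun a ha => hs _ _ ha)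
      (fun a _ => rfl) (fun a _ => rfl) ?_
    intro a ha
    rw [← ih]
    rfl

lemma QQ_reflect (hA : ∀ p ∈ A, p.1 < L ∧ p.2 < L)
    (hr : ∀ a b : ℕ, (a, b) ∈ A → (L - 1 - a, b) ∈ A) (n : ℕ) : ∀ f : ℤ → ℤ → ℝ,
    QQ L A n (fun x y => f ((L : ℤ) ^ n - x) y) = QQ L A n f := by
  induction n with
  | zero => intro f; simp only [QQ, Q0]; simp; ring
  | succ n ih =>
    intro f
    rw [QQ_succ, QQ_succ]
    have inv : ∀ a ∈ A, ((L - 1 - (L - 1 - a.1), a.2) : ℕ × ℕ) = a := by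
      intro a ha
      have := (hA a ha).1
      ext
      · simp; omega
      · rfl
    refine Finset.sum_nbij' (fun a => (L - 1 - a.1, a.2)) (fun a => (L - 1 - a.1, a.2))
      (fun a ha => hr _ _ ha) (fun a ha => hr _ _ ha) inv inv ?_
    intro a ha
    rw [← ih]
    congr 1
    funext x y
    simp only [sh]
    congr 1
    have h1 := (hA a ha).1
    have : ((L - 1 - a.1 : ℕ) : ℤ) = (L : ℤ) - 1 - a.1 := by omega
    rw [this]; ring

lemma QQ_reflect2 (hA : ∀ p ∈ A, p.1 < L ∧ p.2 < L)
    (hs : ∀ a b : ℕ, (a, b) ∈ A → (b, a) ∈ A)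
    (hr : ∀ a b : ℕ, (a, b) ∈ A → (L - 1 - a, b) ∈ A) (n : ℕ) (f : ℤ → ℤ → ℝ) :
    QQ L A n (fun x y => f x ((L : ℤ) ^ n - y)) = QQ L A n f := by
  rw [← QQ_swap hs n f, ← QQ_reflect hA hr n (fun x y => f y x), ← QQ_swap hs]

lemma sum_sub_le (n : ℕ) (f : ℤ → ℤ → ℝ) (e : ℕ → ℕ × ℕ) (he : Function.Injective e)
    (hm : ∀ k < L, e k ∈ A) :
    ∑ k ∈ Finset.range L, QQ L A n (sh (((e k).1 : ℤ) * (L : ℤ) ^ n)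
      (((e k).2 : ℤ) * (L : ℤ) ^ n) f) ≤ QQ L A (n + 1) f := by
  rw [QQ_succ, ← Finset.sum_image (s := Finset.range L) (g := e) (f := fun a : ℕ × ℕ =>
    QQ L A n (sh ((a.1 : ℤ) * (L : ℤ) ^ n) ((a.2 : ℤ) * (L : ℤ) ^ n) f)) (by
      intro a _ b _ hab
      exact he hab)]
  apply Finset.sum_le_sum_of_subset_of_nonneg
  · intro a ha
    obtain ⟨k, hk, rfl⟩ := Finset.mem_image.1 ha
    exact hm k (Finset.mem_range.1 hk)
  · intro a _ _
    exact QQ_nonneg n _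

/-- row estimate: positivity of capacities -/
lemma row_estimate (h : GoodCarpet L A) (n : ℕ) : ∀ f : ℤ → ℤ → ℝ,
    (f 0 0 - f ((L : ℤ) ^ n) 0) ^ 2 ≤ (L : ℝ) ^ n * QQ L A n f := by
  induction n with
  | zero =>
    intro f
    simp only [QQ, Q0, pow_zero, one_mul]
    nlinarith [sq_nonneg (f 1 0 - f 1 1), sq_nonneg (f 1 1 - f 0 1), sq_nonneg (f 0 1 - f 0 0)]
  | succ n ih =>
    intro f
    have hL := h.three_le
    set N : ℤ := (L : ℤ) ^ n with hN
    have tel : f 0 0 - f ((L : ℤ) ^ (n + 1)) 0 =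
        ∑ k ∈ Finset.range L, (f ((k : ℤ) * N) 0 - f (((k + 1 : ℕ) : ℤ) * N) 0) := by
      rw [Finset.sum_range_sub' (fun k : ℕ => f ((k : ℤ) * N) 0)]
      simp [hN, pow_succ']
    have cs : (∑ k ∈ Finset.range L, (f ((k : ℤ) * N) 0 - f (((k + 1 : ℕ) : ℤ) * N) 0)) ^ 2 ≤
        (L : ℝ) * ∑ k ∈ Finset.range L, (f ((k : ℤ) * N) 0 - f (((k + 1 : ℕ) : ℤ) * N) 0) ^ 2 := by
      have := sq_sum_le_card_mul_sum_sq (s := Finset.range L)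
        (f := fun k : ℕ => (f ((k : ℤ) * N) 0 - f (((k + 1 : ℕ) : ℤ) * N) 0))
      simpa using this
    have step : ∀ k ∈ Finset.range L, (f ((k : ℤ) * N) 0 - f (((k + 1 : ℕ) : ℤ) * N) 0) ^ 2 ≤
        (L : ℝ) ^ n * QQ L A n (sh ((k : ℤ) * N) ((0 : ℕ) * N) f) := by
      intro k _
      have := ih (sh ((k : ℤ) * N) ((0 : ℕ) * N) f)
      simp only [sh] at this
      convert this using 3
      · simp
      · congr 1
        · push_cast; ring
        · simp
    have sub : ∑ k ∈ Finset.range L, QQ L A n (sh ((k : ℤ) * N) ((0 : ℕ) * N) f) ≤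
        QQ L A (n + 1) f := by
      apply sum_sub_le n f (fun k => (k, 0))
      · intro a b hab
        simpa using hab
      · intro k hk
        exact h.flat_border k 0 hk (by omega) (by simp)
    calc _ ≤ (L : ℝ) * ∑ k ∈ Finset.range L,
          (L : ℝ) ^ n * QQ L A n (sh ((k : ℤ) * N) ((0 : ℕ) * N) f) := by
          rw [tel]
          refine cs.trans ?_
          gcongr with k hk
          exact step k hk
      _ ≤ (L : ℝ) * ((L : ℝ) ^ n * QQ L A (n + 1) f) := by
          rw [← Finset.mul_sum]
          gcongr
      _ = _ := by ring


/-! ### Part 2: side-to-side conductance and extension operator -/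

/-- admissible functions for the side-to-side problem -/
def Adm (N : ℤ) (h : ℤ → ℤ → ℝ) : Prop :=
  (∀ j, 0 ≤ j → j ≤ N → h 0 j = 0) ∧ (∀ j, 0 ≤ j → j ≤ N → h N j = 1)

/-- normalised admissible functions -/
def Good (N : ℤ) (h : ℤ → ℤ → ℝ) : Prop :=
  Adm N h ∧ (∀ x, h x 0 = h x N) ∧ (∀ x y, 0 ≤ h x y ∧ h x y ≤ 1)

/-- side-to-side conductance -/
noncomputable def sig (L : ℕ) (A : Finset (ℕ × ℕ)) (n : ℕ) : ℝ :=
  sInf {e : ℝ | ∃ h, Adm ((L : ℤ) ^ n) h ∧ e = QQ L A n h}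

lemma Lpow_pos (hL : 0 < L) (n : ℕ) : (0 : ℤ) < (L : ℤ) ^ n := by positivity

lemma sig_le (n : ℕ) (h : ℤ → ℤ → ℝ) (hh : Adm ((L : ℤ) ^ n) h) : sig L A n ≤ QQ L A n h := by
  apply csInf_le
  · refine ⟨0, ?_⟩
    rintro e ⟨g, _, rfl⟩
    exact QQ_nonneg n g
  · exact ⟨h, hh, rfl⟩

lemma le_sig (hL : 0 < L) (n : ℕ) (x : ℝ)
    (hx : ∀ h, Adm ((L : ℤ) ^ n) h → x ≤ QQ L A n h) : x ≤ sig L A n := by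
  apply le_csInf
  · refine ⟨_, fun x _ => if x = 0 then 0 else 1, ⟨?_, ?_⟩, rfl⟩
    · intro j _ _; simp
    · intro j _ _
      have := Lpow_pos hL n
      simp [this.ne']
  · rintro e ⟨g, hg, rfl⟩
    exact hx g hg

lemma sig_pos (h : GoodCarpet L A) (n : ℕ) : 0 < sig L A n := by
  have hL : 0 < L := by have := h.three_le; omega
  have hp : (0 : ℝ) < (L : ℝ) ^ n := by positivity
  refine lt_of_lt_of_le (inv_pos.2 hp) (le_sig hL n _ ?_)
  intro g hg
  have h1 := row_estimate h n g
  have hN := Lpow_pos hL n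
  rw [hg.1 0 le_rfl hN.le, hg.2 0 le_rfl hN.le] at h1
  rw [inv_le_iff_one_le_mul₀ hp]
  linarith

lemma sig_lower (n : ℕ) (g : ℤ → ℤ → ℝ) (α β : ℝ)
    (h0 : ∀ j, 0 ≤ j → j ≤ (L : ℤ) ^ n → g 0 j = α)
    (h1 : ∀ j, 0 ≤ j → j ≤ (L : ℤ) ^ n → g ((L : ℤ) ^ n) j = β) :
    (β - α) ^ 2 * sig L A n ≤ QQ L A n g := by
  by_cases hab : β - α = 0
  · rw [hab]; simpa using QQ_nonneg n g
  · have := sig_le (L := L) (A := A) n (fun x y => (β - α)⁻¹ * g x y + -((β - α)⁻¹ * α)) ⟨by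
      intro j a b
      simp only [h0 j a b]; ring, by
      intro j a b
      simp only [h1 j a b]
      field_simp
      ring⟩
    rw [QQ_affine] at this
    have hp : 0 < (β - α) ^ 2 := by positivity
    calc _ ≤ (β - α) ^ 2 * ((β - α)⁻¹ ^ 2 * QQ L A n g) := by gcongr
      _ = _ := by field_simp

lemma clamp_contract (s t : ℝ) : |min (max s 0) 1 - min (max t 0) 1| ≤ |s - t| := by
  refine (abs_min_sub_min_le_max _ _ _ _).trans ?_
  simp only [sub_self, abs_zero]
  refine max_le ?_ (abs_nonneg _)
  refine (abs_max_sub_max_le_max _ _ _ _).trans ?_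
  simp

lemma good_of_adm (h : GoodCarpet L A) (n : ℕ) (g : ℤ → ℤ → ℝ) (hg : Adm ((L : ℤ) ^ n) g) :
    ∃ g', Good ((L : ℤ) ^ n) g' ∧ QQ L A n g' ≤ QQ L A n g := by
  set N : ℤ := (L : ℤ) ^ n with hN
  set k : ℤ → ℤ → ℝ := fun x y => min (max (g x y) 0) 1 with hk
  have kb : ∀ x y, 0 ≤ k x y ∧ k x y ≤ 1 := by
    intro x y
    simp [hk]
  have hkQ : QQ L A n k ≤ QQ L A n g := QQ_contract n _ clamp_contract g
  have hk2 : QQ L A n (fun x y => k x (N - y)) = QQ L A n k :=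
    QQ_reflect2 h.mem_lt h.symm_swap h.symm_reflect n k
  refine ⟨fun x y => (1 / 2) * (k x y + k x (N - y)) + 0, ⟨⟨?_, ?_⟩, ?_, ?_⟩, ?_⟩
  · intro j h1 h2
    simp [hk, hg.1 j h1 h2, hg.1 (N - j) (by omega) (by omega)]
  · intro j h1 h2
    simp [hk, hg.2 j h1 h2, hg.2 (N - j) (by omega) (by omega)]
    norm_num
  · intro x
    simp; ring
  · intro x y
    have := kb x y
    have := kb x (N - y)
    constructor <;> linarith
  · rw [QQ_affine n (1/2) 0 (fun x y => k x y + k x (N - y))]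
    have := QQ_add_le (L := L) (A := A) n k (fun x y => k x (N - y))
    rw [hk2] at this
    linarith

lemma le_sig_good (h : GoodCarpet L A) (n : ℕ) (x : ℝ)
    (hx : ∀ g, Good ((L : ℤ) ^ n) g → x ≤ QQ L A n g) : x ≤ sig L A n := by
  apply le_sig (by have := h.three_le; omega)
  intro g hg
  obtain ⟨g', h1, h2⟩ := good_of_adm h n g hg
  exact (hx g' h1).trans h2

lemma exists_good (h : GoodCarpet L A) (n : ℕ) :
    ∃ g, Good ((L : ℤ) ^ n) g ∧ QQ L A n g ≤ 2 * sig L A n := by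
  by_contra! hc
  have := le_sig_good h n (2 * sig L A n) (fun g hg => (hc g hg).le)
  have := sig_pos h n
  linarith

/-- bilinear interpolation -/
def bil (f : ℤ → ℤ → ℝ) (a b : ℤ) (X Y : ℝ) : ℝ :=
  (1 - X) * (1 - Y) * f a b + X * (1 - Y) * f (a + 1) b + (1 - X) * Y * f a (b + 1)
    + X * Y * f (a + 1) (b + 1)

/-- the extension operator -/
def Ext (N : ℤ) (h : ℤ → ℤ → ℝ) (f : ℤ → ℤ → ℝ) : ℤ → ℤ → ℝ := fun x y =>
  bil f (x / N) (y / N) (h (x % N) (y % N)) (h (y % N) (x % N))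

lemma divmod_lt {N : ℤ} (a s : ℤ) (h0 : 0 ≤ s) (h1 : s < N) :
    (a * N + s) / N = a ∧ (a * N + s) % N = s := by
  have hN : 0 < N := by omega
  constructor
  · rw [Int.add_comm, Int.add_mul_ediv_right _ _ hN.ne', Int.ediv_eq_zero_of_lt h0 h1, zero_add]
  · rw [Int.add_comm, Int.add_mul_emod_self_right, Int.emod_eq_of_lt h0 h1]

lemma divmod_eq {N : ℤ} (hN : 0 < N) (a : ℤ) :
    (a * N + N) / N = a + 1 ∧ (a * N + N) % N = 0 := by
  have : a * N + N = (a + 1) * N + 0 := by ring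
  rw [this]
  exact divmod_lt (a + 1) 0 le_rfl hN

lemma Ext_cell {N : ℤ} (hN : 0 < N) {h : ℤ → ℤ → ℝ} (hh : Good N h) (f : ℤ → ℤ → ℝ)
    (a b s t : ℤ) (hs0 : 0 ≤ s) (hs1 : s ≤ N) (ht0 : 0 ≤ t) (ht1 : t ≤ N) :
    Ext N h f (a * N + s) (b * N + t) = bil f a b (h s t) (h t s) := by
  obtain ⟨⟨hl, hr⟩, hper, _⟩ := hh
  unfold Ext
  rcases hs1.lt_or_eq with hs | rfl
  · obtain ⟨e1, e2⟩ := divmod_lt a s hs0 hs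
    rw [e1, e2]
    rcases ht1.lt_or_eq with ht | rfl
    · obtain ⟨e1, e2⟩ := divmod_lt b t ht0 ht
      rw [e1, e2]
    · obtain ⟨e1, e2⟩ := divmod_eq hN b
      rw [e1, e2, hl s hs0 hs.le, hr s hs0 hs.le, hper s]
      unfold bil
      ring
  · obtain ⟨e1, e2⟩ := divmod_eq hN a
    rw [e1, e2]
    rcases ht1.lt_or_eq with ht | rfl
    · obtain ⟨e1, e2⟩ := divmod_lt b t ht0 ht
      rw [e1, e2, hl t ht0 ht.le, hr t ht0 ht.le, hper t]
      unfold bil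
      ring
    · obtain ⟨e1, e2⟩ := divmod_eq hN b
      rw [e1, e2, hl 0 le_rfl hN.le, hr _ hN.le le_rfl]
      unfold bil
      ring

lemma Ext_shift {N : ℤ} (hN : 0 < N) (h f : ℤ → ℤ → ℝ) (a b : ℤ) :
    sh (a * N) (b * N) (Ext N h f) = Ext N h (sh a b f) := by
  funext x y
  have e1 : ∀ c z : ℤ, (c * N + z) / N = c + z / N := by
    intro c z
    rw [Int.add_comm, Int.add_mul_ediv_right _ _ hN.ne', add_comm]
  have e2 : ∀ c z : ℤ, (c * N + z) % N = z % N := by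
    intro c z
    rw [Int.add_comm, Int.add_mul_emod_self_right]
  simp only [sh, Ext, bil, e1, e2, add_assoc]

lemma bil_diff_sq (f : ℤ → ℤ → ℝ) (X Y X' Y' : ℝ) (hX : 0 ≤ X' ∧ X' ≤ 1) (hY : 0 ≤ Y ∧ Y ≤ 1) :
    (bil f 0 0 X Y - bil f 0 0 X' Y') ^ 2 ≤ 2 * Q0 f * ((X - X') ^ 2 + (Y - Y') ^ 2) := by
  have conv : ∀ (t u v : ℝ), 0 ≤ t → t ≤ 1 → ((1 - t) * u + t * v) ^ 2 ≤ u ^ 2 + v ^ 2 := by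
    intro t u v h0 h1
    have : ((1 - t) * u + t * v) ^ 2 ≤ (1 - t) * u ^ 2 + t * v ^ 2 := by
      nlinarith [mul_nonneg (mul_nonneg h0 (sub_nonneg.2 h1)) (sq_nonneg (u - v))]
    nlinarith [mul_nonneg h0 (sq_nonneg u), mul_nonneg (sub_nonneg.2 h1) (sq_nonneg v)]
  set p := (1 - Y) * (f 1 0 - f 0 0) + Y * (f 1 1 - f 0 1) with hp
  set q := (1 - X') * (f 0 1 - f 0 0) + X' * (f 1 1 - f 1 0) with hq
  have e : bil f 0 0 X Y - bil f 0 0 X' Y' = (X - X') * p + (Y - Y') * q := by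
    simp only [bil, hp, hq, zero_add]
    ring
  have hp2 : p ^ 2 ≤ Q0 f := by
    have := conv Y (f 1 0 - f 0 0) (f 1 1 - f 0 1) hY.1 hY.2
    have e1 : (f 1 0 - f 0 0) ^ 2 = (f 0 0 - f 1 0) ^ 2 := by ring
    unfold Q0
    linarith [sq_nonneg (f 1 0 - f 1 1), sq_nonneg (f 0 1 - f 0 0)]
  have hq2 : q ^ 2 ≤ Q0 f := by
    have := conv X' (f 0 1 - f 0 0) (f 1 1 - f 1 0) hX.1 hX.2
    have e1 : (f 1 1 - f 1 0) ^ 2 = (f 1 0 - f 1 1) ^ 2 := by ring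
    unfold Q0
    linarith [sq_nonneg (f 0 0 - f 1 0), sq_nonneg (f 1 1 - f 0 1)]
  rw [e]
  have h1 : ((X - X') * p + (Y - Y') * q) ^ 2 ≤ 2 * ((X - X') ^ 2 * p ^ 2 + (Y - Y') ^ 2 * q ^ 2) := by
    have e2 := sq_nonneg ((X - X') * p - (Y - Y') * q)
    have e3 : 2 * ((X - X') ^ 2 * p ^ 2 + (Y - Y') ^ 2 * q ^ 2) -
      ((X - X') * p + (Y - Y') * q) ^ 2 = ((X - X') * p - (Y - Y') * q) ^ 2 := by ring
    linarith
  have h2 : (X - X') ^ 2 * p ^ 2 ≤ (X - X') ^ 2 * Q0 f := by gcongr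
  have h3 : (Y - Y') ^ 2 * q ^ 2 ≤ (Y - Y') ^ 2 * Q0 f := by gcongr
  linarith

lemma Ext_energy (h : GoodCarpet L A) (k : ℕ) {g : ℤ → ℤ → ℝ} (hg : Good ((L : ℤ) ^ k) g)
    (m : ℕ) : ∀ f : ℤ → ℤ → ℝ,
    QQ L A (m + k) (Ext ((L : ℤ) ^ k) g f) ≤ 4 * QQ L A k g * QQ L A m f := by
  have hN := Lpow_pos (L := L) (by have := h.three_le; omega) k
  induction m with
  | zero =>
    intro f
    rw [zero_add]
    have hb := hg.2.2
    have key : QQ L A k (Ext ((L : ℤ) ^ k) g f) ≤ (2 * Q0 f) * QQ L A k g +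
        (2 * Q0 f) * QQ L A k (fun x y => g y x) := by
      apply QQ_mono_two
      intro i j hc
      obtain ⟨h1, h2, h3, h4⟩ := isCell_bounds h.mem_lt k i j hc
      have ev : ∀ s t : ℤ, 0 ≤ s → s ≤ 1 → 0 ≤ t → t ≤ 1 → sh i j (Ext ((L : ℤ) ^ k) g f) s t =
          bil f 0 0 (sh i j g s t) (sh i j (fun x y => g y x) s t) := by
        intro s t a1 a2 a3 a4
        have := Ext_cell hN hg f 0 0 (i + s) (j + t) (by omega) (by omega) (by omega) (by omega)
        simpa [sh] using this
      have hB := fun X Y X' Y' a b => bil_diff_sq f X Y X' Y' a b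
      unfold Q0 at *
      rw [ev 0 0, ev 1 0, ev 0 1, ev 1 1] <;> try norm_num
      have t1 := hB (sh i j g 0 0) (sh i j (fun x y => g y x) 0 0) (sh i j g 1 0)
        (sh i j (fun x y => g y x) 1 0) (hb _ _) (hb _ _)
      have t2 := hB (sh i j g 1 0) (sh i j (fun x y => g y x) 1 0) (sh i j g 1 1)
        (sh i j (fun x y => g y x) 1 1) (hb _ _) (hb _ _)
      have t3 := hB (sh i j g 1 1) (sh i j (fun x y => g y x) 1 1) (sh i j g 0 1)
        (sh i j (fun x y => g y x) 0 1) (hb _ _) (hb _ _)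
      have t4 := hB (sh i j g 0 1) (sh i j (fun x y => g y x) 0 1) (sh i j g 0 0)
        (sh i j (fun x y => g y x) 0 0) (hb _ _) (hb _ _)
      linarith
    rw [QQ_swap h.symm_swap k g] at key
    have : QQ L A 0 f = Q0 f := rfl
    rw [this]
    linarith
  | succ m ih =>
    intro f
    have e : m + 1 + k = (m + k) + 1 := by ring
    rw [e, QQ_succ, QQ_succ, Finset.mul_sum]
    apply Finset.sum_le_sum
    intro a _
    have := ih (sh ((a.1 : ℤ) * (L : ℤ) ^ m) ((a.2 : ℤ) * (L : ℤ) ^ m) f)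
    rw [← Ext_shift hN] at this
    rw [pow_add, ← mul_assoc, ← mul_assoc]
    exact this

/-- coordinates decomposition -/
lemma exists_divmod {N M : ℤ} (hN : 0 < N) (hM : 0 < M) (x : ℤ) (h0 : 0 ≤ x) (h1 : x ≤ M * N) :
    ∃ a s : ℤ, x = a * N + s ∧ 0 ≤ s ∧ s ≤ N ∧ 0 ≤ a ∧ a + 1 ≤ M := by
  rcases h1.lt_or_eq with h | h
  · refine ⟨x / N, x % N, ?_, Int.emod_nonneg _ hN.ne', (Int.emod_lt_of_pos _ hN).le,
      Int.ediv_nonneg h0 hN.le, ?_⟩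
    · rw [mul_comm]; exact (Int.mul_ediv_add_emod x N).symm
    · have := Int.ediv_lt_of_lt_mul hN h
      omega
  · refine ⟨M - 1, N, by rw [h]; ring, hN.le, le_rfl, by omega, by omega⟩

lemma Ext_adm (hL : 0 < L) (m k : ℕ) {g f : ℤ → ℤ → ℝ} (hg : Good ((L : ℤ) ^ k) g)
    (hf : Adm ((L : ℤ) ^ m) f) : Adm ((L : ℤ) ^ (m + k)) (Ext ((L : ℤ) ^ k) g f) := by
  have hN := Lpow_pos hL k
  have hM := Lpow_pos hL m
  rw [pow_add]
  constructor
  · intro y h0 h1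
    obtain ⟨b, t, rfl, ht0, ht1, hb0, hb1⟩ := exists_divmod hN hM y h0 h1
    have := Ext_cell hN hg f 0 b 0 t le_rfl hN.le ht0 ht1
    rw [zero_mul, add_zero] at this
    rw [this, hg.1.1 t ht0 ht1, bil, hf.1 b hb0 (by omega), hf.1 (b + 1) (by omega) hb1]
    ring
  · intro y h0 h1
    obtain ⟨b, t, rfl, ht0, ht1, hb0, hb1⟩ := exists_divmod hN hM y h0 h1
    have := Ext_cell hN hg f ((L : ℤ) ^ m - 1) b ((L : ℤ) ^ k) t hN.le le_rfl ht0 ht1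
    have e : ((L : ℤ) ^ m - 1) * (L : ℤ) ^ k + (L : ℤ) ^ k = (L : ℤ) ^ m * (L : ℤ) ^ k := by ring
    rw [e] at this
    rw [this, hg.1.2 t ht0 ht1, bil]
    simp only [sub_add_cancel]
    rw [hf.2 b hb0 (by omega), hf.2 (b + 1) (by omega) hb1]
    ring

lemma sig_submul (h : GoodCarpet L A) (m k : ℕ) :
    sig L A (m + k) ≤ 4 * sig L A m * sig L A k := by
  have hL : 0 < L := by have := h.three_le; omega
  have hm := sig_pos h m
  have h1 : ∀ g, Good ((L : ℤ) ^ k) g → ∀ f, Adm ((L : ℤ) ^ m) f →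
      sig L A (m + k) ≤ 4 * QQ L A k g * QQ L A m f := fun g hg f hf =>
    (sig_le _ _ (Ext_adm hL m k hg hf)).trans (Ext_energy h k hg m f)
  have h2 : ∀ g, Good ((L : ℤ) ^ k) g → sig L A (m + k) ≤ 4 * QQ L A k g * sig L A m := by
    intro g hg
    have hgp : 0 < QQ L A k g := (sig_pos h k).trans_le (sig_le _ _ hg.1)
    have := le_sig (A := A) hL m (sig L A (m + k) / (4 * QQ L A k g)) (fun f hf => by
      rw [div_le_iff₀ (by positivity)]
      linarith [h1 g hg f hf])
    rw [div_le_iff₀ (by positivity)] at this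
    linarith
  have := le_sig_good h k (sig L A (m + k) / (4 * sig L A m)) (fun g hg => by
    rw [div_le_iff₀ (by positivity)]
    linarith [h2 g hg])
  rw [div_le_iff₀ (by positivity)] at this
  linarith

lemma sig_decay (h : GoodCarpet L A) (n : ℕ) :
    sig L A (n + 1) ≤ (#A : ℝ) / (L : ℝ) ^ 2 * sig L A n := by
  have hL : 0 < L := by have := h.three_le; omega
  have hLr : (0 : ℝ) < L := by exact_mod_cast hL
  have hN := Lpow_pos hL n
  have hAne : (0 : ℝ) < #A := by
    have : (0, 0) ∈ A := h.flat_border 0 0 hL hL (by simp)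
    exact_mod_cast Finset.card_pos.2 ⟨_, this⟩
  have key : ∀ g, Good ((L : ℤ) ^ n) g → sig L A (n + 1) ≤ (#A : ℝ) / (L : ℝ) ^ 2 * QQ L A n g := by
    intro g hg
    have hadm : Adm ((L : ℤ) ^ 1) (fun x _ => (x : ℝ) / L) := by
      constructor
      · intro j _ _; simp
      · intro j _ _; simp [hLr.ne']
    have := sig_le (A := A) _ _ (Ext_adm hL 1 n hg hadm)
    rw [add_comm 1 n, QQ_succ] at this
    refine this.trans (le_of_eq ?_)
    have e : ∀ a ∈ A, QQ L A n (sh ((a.1 : ℤ) * (L : ℤ) ^ n) ((a.2 : ℤ) * (L : ℤ) ^ n)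
        (Ext ((L : ℤ) ^ n) g (fun x _ => (x : ℝ) / L))) = ((L : ℝ)⁻¹) ^ 2 * QQ L A n g := by
      intro a ha
      rw [← QQ_affine n (L : ℝ)⁻¹ ((a.1 : ℝ) / L)]
      apply QQ_congr h.mem_lt
      intro x y h1 h2 h3 h4
      unfold sh
      rw [Ext_cell hN hg _ _ _ _ _ h1 h2 h3 h4]
      simp only [bil]
      push_cast
      field_simp
      ring
    rw [Finset.sum_congr rfl e, Finset.sum_const, nsmul_eq_mul]
    field_simp
  have := le_sig_good h n (sig L A (n + 1) / ((#A : ℝ) / (L : ℝ) ^ 2)) (fun g hg => by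
    rw [div_le_iff₀ (by positivity)]
    linarith [key g hg])
  rw [div_le_iff₀ (by positivity)] at this
  linarith

/-- the decay rate is `< 1` -/
lemma rate_lt_one (h : GoodCarpet L A) : (#A : ℝ) / (L : ℝ) ^ 2 < 1 := by
  have hL : 0 < L := by have := h.three_le; omega
  have hLr : (0 : ℝ) < L := by exact_mod_cast hL
  rw [div_lt_one (by positivity)]
  obtain ⟨a, b, ha, hb, hab⟩ := h.proper
  have : A ⊂ (Finset.range L) ×ˢ (Finset.range L) := by
    rw [Finset.ssubset_iff_of_subset]
    · exact ⟨(a, b), by simp [ha, hb], hab⟩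
    · intro p hp
      simpa using h.mem_lt p hp
  have := Finset.card_lt_card this
  simp at this
  have : (#A : ℝ) < L * L := by exact_mod_cast this
  linarith [sq (L : ℝ)]

lemma sig_zero_le : sig L A 0 ≤ 2 := by
  have := sig_le (L := L) (A := A) 0 (fun x _ => (x : ℝ)) ⟨by simp, by simp⟩
  refine this.trans (le_of_eq ?_)
  simp [QQ, Q0]; norm_num


/-! ### Part 3: crossing paths in the grid -/

/-- nearest neighbours in `ℤ²` -/
def Nbr (p q : ℤ × ℤ) : Prop :=
  (p.1 = q.1 ∧ (p.2 = q.2 + 1 ∨ q.2 = p.2 + 1)) ∨ (p.2 = q.2 ∧ (p.1 = q.1 + 1 ∨ q.1 = p.1 + 1))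

/-- crossing counter for one step -/
noncomputable def Hc (p q : ℤ × ℤ) (x y : ℤ) : ZMod 2 :=
  if min p.1 q.1 = x ∧ p.1 ≠ q.1 ∧ p.2 ≤ y then 1 else 0

lemma Hc_vert {p q : ℤ × ℤ} (hpq : Nbr p q) (x y : ℤ) (hp : p ≠ (x, y + 1)) (hq : q ≠ (x, y + 1)) :
    Hc p q x y = Hc p q x (y + 1) := by
  obtain ⟨p1, p2⟩ := p
  obtain ⟨q1, q2⟩ := q
  simp only [Nbr, ne_eq, Prod.mk.injEq, Hc] at *
  split_ifs <;> first | rfl | (exfalso; omega)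

lemma Hc_horiz {p q : ℤ × ℤ} (hpq : Nbr p q) (x y : ℤ) (hp : p ≠ (x + 1, y)) (hq : q ≠ (x + 1, y)) :
    Hc p q x y + Hc p q (x + 1) y =
      (if q.1 = x + 1 ∧ q.2 ≤ y then 1 else 0) - (if p.1 = x + 1 ∧ p.2 ≤ y then 1 else 0) := by
  obtain ⟨p1, p2⟩ := p
  obtain ⟨q1, q2⟩ := q
  simp only [Nbr, ne_eq, Prod.mk.injEq, Hc] at *
  split_ifs <;> first | (exfalso; omega) | decide

lemma Hc_top {p q : ℤ × ℤ} (hpq : Nbr p q) (x y : ℤ) (hp : p.2 ≤ y) :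
    Hc p q x y = (if x < q.1 then 1 else 0) - (if x < p.1 then 1 else 0) := by
  obtain ⟨p1, p2⟩ := p
  obtain ⟨q1, q2⟩ := q
  simp only [Nbr, Hc] at *
  split_ifs <;> first | (exfalso; omega) | decide

/-- Crossing lemma, extended form. -/
lemma crossing_aux (N : ℤ) (P : ℕ → ℤ × ℤ) (l : ℕ) (hP : ∀ k < l, Nbr (P k) (P (k + 1)))
    (hP2 : ∀ k ≤ l, 0 ≤ (P k).2 ∧ (P k).2 ≤ N) (hP0 : (P 0).1 = 0) (hPl : (P l).1 = N + 1)
    (R : ℕ → ℤ × ℤ) (l' : ℕ) (hR : ∀ k < l', Nbr (R k) (R (k + 1)))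
    (hR1 : ∀ k ≤ l', 0 ≤ (R k).1 ∧ (R k).1 ≤ N) (hR0 : (R 0).2 = 0) (hRl : (R l').2 = N) :
    ∃ i ≤ l, ∃ j ≤ l', P i = R j := by
  by_contra! hne
  set c : ℤ → ℤ → ZMod 2 := fun x y => ∑ k ∈ Finset.range l, Hc (P k) (P (k + 1)) x y with hc
  have vert : ∀ x y, (∀ i ≤ l, P i ≠ (x, y + 1)) → c x y = c x (y + 1) := by
    intro x y h
    apply Finset.sum_congr rfl
    intro k hk
    have hk := Finset.mem_range.1 hk
    exact Hc_vert (hP k hk) x y (h k hk.le) (h (k + 1) hk)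
  have horiz : ∀ x y, 0 ≤ x → x + 1 ≤ N → (∀ i ≤ l, P i ≠ (x + 1, y)) → c x y = c (x + 1) y := by
    intro x y hx hx1 h
    have : c x y + c (x + 1) y = 0 := by
      rw [hc]
      simp only
      rw [← Finset.sum_add_distrib]
      rw [Finset.sum_congr rfl (g := fun k => (if (P (k + 1)).1 = x + 1 ∧ (P (k + 1)).2 ≤ y then
        (1 : ZMod 2) else 0) - (if (P k).1 = x + 1 ∧ (P k).2 ≤ y then 1 else 0)) ?_]
      · rw [Finset.sum_range_sub (fun k => (if (P k).1 = x + 1 ∧ (P k).2 ≤ y then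
          (1 : ZMod 2) else 0))]
        rw [if_neg (by omega), if_neg (by omega), sub_zero]
      · intro k hk
        have hk := Finset.mem_range.1 hk
        exact Hc_horiz (hP k hk) x y (h k hk.le) (h (k + 1) hk)
    have h2 : ∀ u v : ZMod 2, u + v = 0 → u = v := by decide
    exact h2 _ _ this
  have const : ∀ k ≤ l', c (R k).1 (R k).2 = c (R 0).1 (R 0).2 := by
    intro k
    induction k with
    | zero => intro _; rfl
    | succ k ih =>
      intro hk
      rw [← ih (by omega)]
      have hn := hR k (by omega)
      have b1 := hR1 k (by omega)
      have b2 := hR1 (k + 1) hk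
      have n1 := fun i hi => hne i hi k (by omega)
      have n2 := fun i hi => hne i hi (k + 1) hk
      revert hn b1 b2 n1 n2
      generalize R k = p
      generalize R (k + 1) = q
      obtain ⟨p1, p2⟩ := p
      obtain ⟨q1, q2⟩ := q
      intro hn b1 b2 n1 n2
      simp only [Nbr] at *
      rcases hn with ⟨rfl, rfl | rfl⟩ | ⟨rfl, rfl | rfl⟩
      · exact vert _ _ n1
      · exact (vert _ _ n2).symm
      · exact horiz _ _ (by omega) (by omega) n1
      · exact (horiz _ _ (by omega) (by omega) n2).symm
  have bot : c (R 0).1 (R 0).2 = 0 := by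
    apply Finset.sum_eq_zero
    intro k hk
    have hk := Finset.mem_range.1 hk
    have n1 := hne k hk.le 0 (by omega)
    have n2 := hne (k + 1) hk 0 (by omega)
    have b1 := hP2 k hk.le
    have b2 := hP2 (k + 1) hk
    have hn := hP k hk
    unfold Hc
    apply if_neg
    rintro ⟨h1, h2, h3⟩
    simp only [Nbr, ne_eq, Prod.ext_iff] at *
    omega
  have top : c (R l').1 (R l').2 = 1 := by
    rw [hc]
    simp only
    rw [Finset.sum_congr rfl (g := fun k => (if (R l').1 < (P (k + 1)).1 then
        (1 : ZMod 2) else 0) - (if (R l').1 < (P k).1 then 1 else 0)) ?_]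
    · rw [Finset.sum_range_sub (fun k => (if (R l').1 < (P k).1 then (1 : ZMod 2) else 0))]
      have := hR1 l' le_rfl
      rw [if_pos (by omega), if_neg (by omega), sub_zero]
    · intro k hk
      have hk := Finset.mem_range.1 hk
      apply Hc_top (hP k hk)
      rw [hRl]
      exact (hP2 k hk.le).2
  have := const l' le_rfl
  rw [bot, top] at this
  exact absurd this (by decide)

/-- A left-right crossing of `[0,N]²` -/
def Crossing (N : ℤ) (P : ℕ → ℤ × ℤ) (l : ℕ) : Prop :=
  (∀ k < l, Nbr (P k) (P (k + 1))) ∧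
  (∀ k ≤ l, (0 ≤ (P k).1 ∧ (P k).1 ≤ N) ∧ (0 ≤ (P k).2 ∧ (P k).2 ≤ N)) ∧
  (P 0).1 = 0 ∧ (P l).1 = N

lemma crossing_meet (N : ℤ) (P R : ℕ → ℤ × ℤ) (l l' : ℕ) (hP : Crossing N P l)
    (hR : Crossing N (fun k => (R k).swap) l') : ∃ i ≤ l, ∃ j ≤ l', P i = R j := by
  obtain ⟨p1, p2, p3, p4⟩ := hP
  obtain ⟨r1, r2, r3, r4⟩ := hR
  have := crossing_aux N (fun k => if k ≤ l then P k else (N + 1, (P l).2)) (l + 1) (by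
      intro k hk
      rcases Nat.lt_succ_iff_lt_or_eq.1 hk with h | rfl
      · simp only [h.le, if_true, Nat.succ_le_of_lt h]
        exact p1 k h
      · simp [Nbr, p4]) (by
      intro k hk
      by_cases h : k ≤ l
      · simp only [h, if_true]; exact (p2 k h).2
      · simp only [h, if_false]; exact (p2 l le_rfl).2) (by simpa using p3) (by simp) R l' (by
      intro k hk
      have := r1 k hk
      simp only [Nbr, Prod.fst_swap, Prod.snd_swap] at *
      omega) (fun k hk => (r2 k hk).2) r3 r4
  obtain ⟨i, hi, j, hj, e⟩ := this
  by_cases h : i ≤ l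
  · simp only [h, if_true] at e
    exact ⟨i, h, j, hj, e⟩
  · simp only [h, if_false] at e
    have := (r2 j hj).2.2
    rw [Prod.fst_swap.symm] at this
    simp only [Prod.snd_swap] at *
    rw [← e] at this
    simp at this

/-- Either there is a short path, or a separating function (extremal length duality). -/
lemma path_or_fn {α : Type*} (E : α → α → Prop) (hsym : ∀ p q, E p q → E q p) (f : α → ℝ)
    (S T : Set α) (δ : ℝ) (hδ : 0 ≤ δ) :
    (∃ (P : ℕ → α) (l : ℕ), P 0 ∈ S ∧ P l ∈ T ∧ (∀ k < l, E (P k) (P (k + 1))) ∧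
      ∑ k ∈ Finset.range l, |f (P k) - f (P (k + 1))| < δ) ∨
    ∃ g : α → ℝ, (∀ s ∈ S, g s = 0) ∧ (∀ t ∈ T, g t = δ) ∧
      ∀ p q, E p q → |g p - g q| ≤ |f p - f q| := by
  by_cases hc : ∃ (P : ℕ → α) (l : ℕ), P 0 ∈ S ∧ P l ∈ T ∧ (∀ k < l, E (P k) (P (k + 1))) ∧
      ∑ k ∈ Finset.range l, |f (P k) - f (P (k + 1))| < δ
  · exact Or.inl hc
  right
  push Not at hc
  set C : α → Set ℝ := fun x => insert δ {s | ∃ (P : ℕ → α) (l : ℕ), P 0 ∈ S ∧ P l = x ∧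
    (∀ k < l, E (P k) (P (k + 1))) ∧ s = ∑ k ∈ Finset.range l, |f (P k) - f (P (k + 1))|} with hC
  have nn : ∀ x, ∀ s ∈ C x, 0 ≤ s := by
    rintro x s (rfl | ⟨P, l, _, _, _, rfl⟩)
    · exact hδ
    · exact Finset.sum_nonneg fun _ _ => abs_nonneg _
  have bdd : ∀ x, BddBelow (C x) := fun x => ⟨0, fun s hs => nn x s hs⟩
  have ne : ∀ x, (C x).Nonempty := fun x => ⟨δ, Set.mem_insert _ _⟩
  have one : ∀ p q, E p q → sInf (C q) ≤ sInf (C p) + |f p - f q| := by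
    intro p q hpq
    rw [← sub_le_iff_le_add]
    apply le_csInf (ne p)
    rintro s (rfl | ⟨P, l, h0, h1, h2, rfl⟩)
    · have : sInf (C q) ≤ s := csInf_le (bdd q) (Set.mem_insert _ _)
      linarith [abs_nonneg (f p - f q)]
    · rw [sub_le_iff_le_add]
      apply csInf_le (bdd q)
      right
      refine ⟨fun k => if k ≤ l then P k else q, l + 1, by simpa using h0, by simp, ?_, ?_⟩
      · intro k hk
        rcases Nat.lt_succ_iff_lt_or_eq.1 hk with h | rfl
        · simp only [h.le, if_true, Nat.succ_le_of_lt h]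
          exact h2 k h
        · simpa [h1] using hpq
      · rw [Finset.sum_range_succ]
        congr 1
        · apply Finset.sum_congr rfl
          intro k hk
          have h := Finset.mem_range.1 hk
          simp only [h.le, if_true, Nat.succ_le_of_lt h]
        · simp [h1]
  refine ⟨fun x => sInf (C x), ?_, ?_, ?_⟩
  · intro s hs
    apply le_antisymm
    · apply csInf_le (bdd s)
      right
      exact ⟨fun _ => s, 0, hs, rfl, by simp, by simp⟩
    · exact le_csInf (ne s) (nn s)
  · intro t ht
    apply le_antisymm
    · exact csInf_le (bdd t) (Set.mem_insert _ _)
    · apply le_csInf (ne t)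
      rintro s (rfl | ⟨P, l, h0, h1, h2, rfl⟩)
      · exact le_rfl
      · exact hc P l h0 (h1 ▸ ht) h2
  · intro p q hpq
    have h1 := one p q hpq
    have h2 := one q p (hsym p q hpq)
    rw [abs_sub_comm (f q)] at h2
    rw [abs_le]
    constructor <;> linarith

lemma path_osc {α : Type*} (f : α → ℝ) (P : ℕ → α) (l i j : ℕ) (hi : i ≤ l) (hj : j ≤ l) :
    |f (P i) - f (P j)| ≤ ∑ k ∈ Finset.range l, |f (P k) - f (P (k + 1))| := by
  wlog hij : i ≤ j generalizing i j
  · rw [abs_sub_comm]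
    exact this j i hj hi (by omega)
  have := dist_le_Ico_sum_dist (fun k => f (P k)) hij
  simp only [Real.dist_eq] at this
  refine this.trans ?_
  apply Finset.sum_le_sum_of_subset_of_nonneg
  · intro k hk
    simp at hk ⊢
    omega
  · intro _ _ _
    exact abs_nonneg _





/-- edges of the cells selected by `C` -/
def EdgeOf (C : ℤ → ℤ → Prop) (p q : ℤ × ℤ) : Prop :=
  Nbr p q ∧ ∃ i j, C i j ∧ (i ≤ p.1 ∧ p.1 ≤ i + 1) ∧ (j ≤ p.2 ∧ p.2 ≤ j + 1) ∧
    (i ≤ q.1 ∧ q.1 ≤ i + 1) ∧ (j ≤ q.2 ∧ q.2 ≤ j + 1)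

lemma Nbr_symm {p q : ℤ × ℤ} (h : Nbr p q) : Nbr q p := by
  simp only [Nbr] at *; omega

lemma EdgeOf_symm (C : ℤ → ℤ → Prop) (p q : ℤ × ℤ) (h : EdgeOf C p q) : EdgeOf C q p := by
  obtain ⟨h1, i, j, h2, h3, h4, h5, h6⟩ := h
  exact ⟨Nbr_symm h1, i, j, h2, h5, h6, h3, h4⟩

lemma edge_Q0 {C : ℤ → ℤ → Prop} {i j : ℤ} (hC : C i j) (g f : ℤ × ℤ → ℝ)
    (hg : ∀ p q, EdgeOf C p q → |g p - g q| ≤ |f p - f q|) :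
    Q0 (sh i j (fun x y => g (x, y))) ≤ Q0 (sh i j (fun x y => f (x, y))) := by
  have key : ∀ p q : ℤ × ℤ, Nbr p q → (i ≤ p.1 ∧ p.1 ≤ i + 1) → (j ≤ p.2 ∧ p.2 ≤ j + 1) →
    (i ≤ q.1 ∧ q.1 ≤ i + 1) → (j ≤ q.2 ∧ q.2 ≤ j + 1) → (g p - g q) ^ 2 ≤ (f p - f q) ^ 2 := by
    intro p q h1 h2 h3 h4 h5
    exact sq_le_sq.2 (hg p q ⟨h1, i, j, hC, h2, h3, h4, h5⟩)
  simp only [Q0, sh]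
  refine add_le_add (add_le_add (add_le_add ?_ ?_) ?_) ?_ <;>
  · apply key
    · simp [Nbr]
    all_goals
      constructor <;> simp

lemma lr_path (h : GoodCarpet L A) (n : ℕ) (f : ℤ → ℤ → ℝ) (δ : ℝ) (hδ : 0 < δ)
    (hf : QQ L A n f < δ ^ 2 * sig L A n) :
    ∃ P l, Crossing ((L : ℤ) ^ n) P l ∧
      ∑ k ∈ Finset.range l, |f (P k).1 (P k).2 - f (P (k + 1)).1 (P (k + 1)).2| < δ := by
  have hL : 0 < L := by have := h.three_le; omega
  have hN := Lpow_pos hL n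
  rcases path_or_fn (EdgeOf (IsCell L A n)) (EdgeOf_symm _) (fun p => f p.1 p.2)
    {p | p.1 = 0 ∧ 0 ≤ p.2 ∧ p.2 ≤ (L : ℤ) ^ n} {p | p.1 = (L : ℤ) ^ n ∧ 0 ≤ p.2 ∧ p.2 ≤ (L : ℤ) ^ n}
    δ hδ.le with ⟨P, l, h1, h2, h3, h4⟩ | ⟨g, h1, h2, h3⟩
  · refine ⟨P, l, ⟨fun k hk => (h3 k hk).1, ?_, h1.1, h2.1⟩, h4⟩
    intro k hk
    rcases hk.lt_or_eq with hk | rfl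
    · obtain ⟨_, i, j, hc, h5⟩ := h3 k hk
      have := isCell_bounds h.mem_lt n i j hc
      omega
    · have := h2.1
      have := h2.2
      omega
  · exfalso
    have h4 := sig_lower (L := L) (A := A) n (fun x y => g (x, y)) 0 δ
      (fun j h5 h6 => h1 _ ⟨rfl, h5, h6⟩) (fun j h5 h6 => h2 _ ⟨rfl, h5, h6⟩)
    have h5 := QQ_mono (L := L) (A := A) n 1 (fun x y => g (x, y)) f (by
      intro i j hc
      rw [one_mul]
      exact edge_Q0 hc g (fun p => f p.1 p.2) h3)
    rw [sub_zero] at h4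
    linarith

lemma QQ_sum_le (n M : ℕ) (t : ℕ → ℤ → ℤ → ℝ) :
    QQ L A n (fun x y => ∑ b ∈ Finset.range M, t b x y) ≤
      ∑ b ∈ Finset.range M, (M : ℝ) * QQ L A n (t b) := by
  apply QQ_mono_gen
  intro i j _
  have key : ∀ x y x' y' : ℤ, ((∑ b ∈ Finset.range M, t b x y) - ∑ b ∈ Finset.range M, t b x' y') ^ 2
      ≤ (M : ℝ) * ∑ b ∈ Finset.range M, (t b x y - t b x' y') ^ 2 := by
    intro x y x' y'
    rw [← Finset.sum_sub_distrib]
    have := sq_sum_le_card_mul_sum_sq (s := Finset.range M) (f := fun b => t b x y - t b x' y')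
    simpa using this
  rw [← Finset.mul_sum]
  simp only [Q0, sh, Finset.sum_add_distrib, mul_add]
  exact add_le_add (add_le_add (add_le_add (key _ _ _ _) (key _ _ _ _)) (key _ _ _ _)) (key _ _ _ _)

lemma fold_tele (s : ℕ → ℝ) (M : ℕ) :
    ∑ b ∈ Finset.range M, (-1 : ℝ) ^ b * (if Even b then s b else s (b + 1)) =
      s 0 - (if Even M then s M else 0) ∧
    ∑ b ∈ Finset.range M, (-1 : ℝ) ^ b * (if Even b then s (b + 1) else s b) =
      (if Even M then 0 else s M) := by
  induction M with
  | zero => simp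
  | succ M ih =>
    rw [Finset.sum_range_succ, Finset.sum_range_succ, ih.1, ih.2]
    by_cases hM : Even M
    · have h1 : ¬ Even (M + 1) := by simpa [Nat.even_add_one] using hM
      rw [if_pos hM, if_neg h1, if_pos hM, if_neg h1, if_pos hM, if_pos hM, hM.neg_one_pow]
      constructor <;> ring
    · have h1 : Even (M + 1) := by simpa [Nat.even_add_one] using hM
      rw [if_neg hM, if_pos h1, if_neg hM, if_pos h1, if_neg hM, if_neg hM,
        (Nat.not_even_iff_odd.1 hM).neg_one_pow]
      constructor <;> ring

lemma fold_bound (h : GoodCarpet L A) (n : ℕ) (g : ℤ → ℤ → ℝ) (δ : ℝ)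
    (h0 : ∀ x, 0 ≤ x → x ≤ (L : ℤ) ^ n → g x 0 = 0)
    (h1 : ∀ x, 0 ≤ x → x ≤ (L : ℤ) ^ n → g x ((L : ℤ) * (L : ℤ) ^ n) = δ) :
    δ ^ 2 * sig L A n ≤ L * ∑ b ∈ Finset.range L, QQ L A n (sh 0 ((b : ℤ) * (L : ℤ) ^ n) g) := by
  set N : ℤ := (L : ℤ) ^ n with hN
  set t : ℕ → ℤ → ℤ → ℝ := fun b x y =>
    (-1 : ℝ) ^ b * g y ((b : ℤ) * N + (if Even b then x else N - x)) with ht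
  have ht' : ∀ b, QQ L A n (t b) = QQ L A n (sh 0 ((b : ℤ) * N) g) := by
    intro b
    have e1 : QQ L A n (t b) = QQ L A n (fun x y => g y ((b : ℤ) * N + (if Even b then x else N - x))) := by
      have := QQ_affine (L := L) (A := A) n ((-1) ^ b) 0
        (fun x y => g y ((b : ℤ) * N + (if Even b then x else N - x)))
      simp only [add_zero] at this
      have e2 : ((-1 : ℝ) ^ b) ^ 2 = 1 := by rw [← pow_mul, mul_comm, pow_mul]; norm_num
      rw [e2, one_mul] at this
      exact this
    rw [e1]
    by_cases hb : Even b
    · simp only [if_pos hb]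
      rw [← QQ_swap h.symm_swap n (sh 0 ((b : ℤ) * N) g)]
      simp [sh]
    · simp only [if_neg hb]
      rw [← QQ_swap h.symm_swap n (sh 0 ((b : ℤ) * N) g), ← QQ_reflect h.mem_lt h.symm_reflect]
      simp [sh, ← hN]
  have hG := QQ_sum_le (L := L) (A := A) n L t
  simp only [ht'] at hG
  rw [← Finset.mul_sum] at hG
  refine le_trans ?_ hG
  have t0 : ∀ y, 0 ≤ y → y ≤ N → ∑ b ∈ Finset.range L, t b 0 y = 0 - (if Even L then δ else 0) := by
    intro y hy0 hy1
    have := (fold_tele (fun b => g y ((b : ℤ) * N)) L).1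
    simp only [Nat.cast_zero, zero_mul, h0 y hy0 hy1, h1 y hy0 hy1] at this
    rw [← this]
    apply Finset.sum_congr rfl
    intro b _
    simp only [ht]
    split_ifs
    · simp
    · congr 2; push_cast; ring
  have t1 : ∀ y, 0 ≤ y → y ≤ N → ∑ b ∈ Finset.range L, t b N y = if Even L then 0 else δ := by
    intro y hy0 hy1
    have := (fold_tele (fun b => g y ((b : ℤ) * N)) L).2
    simp only [h1 y hy0 hy1] at this
    rw [← this]
    apply Finset.sum_congr rfl
    intro b _
    simp only [ht]
    split_ifs
    · congr 2; push_cast; ring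
    · simp
  have := sig_lower (L := L) (A := A) n (fun x y => ∑ b ∈ Finset.range L, t b x y) _ _ t0 t1
  refine le_trans (le_of_eq ?_) this
  split_ifs <;> ring

lemma strip_path (h : GoodCarpet L A) (n : ℕ) (f : ℤ → ℤ → ℝ) (δ : ℝ) (hδ : 0 < δ)
    (hf : L * QQ L A (n + 1) f < δ ^ 2 * sig L A n) :
    ∃ (P : ℕ → ℤ × ℤ) (l : ℕ), Crossing ((L : ℤ) ^ (n + 1)) (fun k => (P k).swap) l ∧ (∀ k ≤ l, (P k).1 ≤ (L : ℤ) ^ n) ∧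
      ∑ k ∈ Finset.range l, |f (P k).1 (P k).2 - f (P (k + 1)).1 (P (k + 1)).2| < δ := by
  have hL3 := h.three_le
  have hL : 0 < L := by omega
  have hN := Lpow_pos hL n
  set N : ℤ := (L : ℤ) ^ n with hNd
  have hLN : (L : ℤ) ^ (n + 1) = L * N := by rw [pow_succ, mul_comm]
  have hNle : N ≤ L * N := by nlinarith
  set C : ℤ → ℤ → Prop := fun i j => ∃ b < L, ∃ j', IsCell L A n i j' ∧ j = (b : ℤ) * N + j' with hC
  have Cb : ∀ i j, C i j → 0 ≤ i ∧ i + 1 ≤ N ∧ 0 ≤ j ∧ j + 1 ≤ L * N := by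
    rintro i j ⟨b, hb, j', hc, rfl⟩
    have := isCell_bounds h.mem_lt n i j' hc
    have h1 : (b : ℤ) + 1 ≤ L := by omega
    have h2 : ((b : ℤ) + 1) * N ≤ L * N := by nlinarith
    have h3 : 0 ≤ (b : ℤ) * N := by positivity
    refine ⟨this.1, this.2.1, by linarith, by linarith [this.2.2.2]⟩
  rcases path_or_fn (EdgeOf C) (EdgeOf_symm _) (fun p => f p.1 p.2)
    {p | p.2 = 0 ∧ 0 ≤ p.1 ∧ p.1 ≤ N} {p | p.2 = L * N ∧ 0 ≤ p.1 ∧ p.1 ≤ N}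
    δ hδ.le with ⟨P, l, h1, h2, h3, h4⟩ | ⟨g, h1, h2, h3⟩
  · have bd : ∀ k ≤ l, (0 ≤ (P k).1 ∧ (P k).1 ≤ N) ∧ 0 ≤ (P k).2 ∧ (P k).2 ≤ L * N := by
      intro k hk
      rcases hk.lt_or_eq with hk | rfl
      · obtain ⟨_, i, j, hc, h5⟩ := h3 k hk
        have := Cb i j hc
        omega
      · have := h2.1
        have := h2.2
        omega
    refine ⟨P, l, ⟨?_, ?_, h1.1, ?_⟩, fun k hk => (bd k hk).1.2, h4⟩
    · intro k hk
      have := (h3 k hk).1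
      simp only [Nbr, Prod.fst_swap, Prod.snd_swap] at *
      omega
    · intro k hk
      rw [hLN]
      have := bd k hk
      simp only [Prod.fst_swap, Prod.snd_swap]
      omega
    · rw [hLN]; exact h2.1
  · exfalso
    have h4 := fold_bound h n (fun x y => g (x, y)) δ
      (fun j h5 h6 => h1 _ ⟨rfl, h5, h6⟩) (fun j h5 h6 => h2 _ ⟨rfl, h5, h6⟩)
    have h5 : ∀ b ∈ Finset.range L, QQ L A n (sh 0 ((b : ℤ) * N) (fun x y => g (x, y))) ≤
        QQ L A n (sh 0 ((b : ℤ) * N) f) := by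
      intro b hb
      have := QQ_mono (L := L) (A := A) n 1 (sh 0 ((b : ℤ) * N) (fun x y => g (x, y)))
        (sh 0 ((b : ℤ) * N) f) (by
        intro i j hc
        rw [one_mul, sh_sh, sh_sh, zero_add]
        exact edge_Q0 (C := C) ⟨b, Finset.mem_range.1 hb, j, hc, rfl⟩ g (fun p => f p.1 p.2) h3)
      linarith
    have h6 := sum_sub_le (L := L) (A := A) n f (fun b => (0, b)) (fun a b hab => by simpa using hab)
      (fun k hk => h.flat_border 0 k hL hk (Or.inl rfl))
    simp only [Nat.cast_zero, zero_mul] at h6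
    have h7 := Finset.sum_le_sum h5
    have hLr : (0 : ℝ) < L := by exact_mod_cast hL
    have h8 := mul_le_mul_of_nonneg_left (h7.trans h6) hLr.le
    linarith





lemma Q0_edges (f : ℤ → ℤ → ℝ) (q : ℝ) (hq : 0 ≤ q) (hf : Q0 f ≤ q ^ 2) :
    |f 0 0 - f 1 0| ≤ q ∧ |f 1 0 - f 1 1| ≤ q ∧ |f 1 1 - f 0 1| ≤ q ∧ |f 0 1 - f 0 0| ≤ q := by
  unfold Q0 at hf
  have h1 := sq_nonneg (f 0 0 - f 1 0)
  have h2 := sq_nonneg (f 1 0 - f 1 1)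
  have h3 := sq_nonneg (f 1 1 - f 0 1)
  have h4 := sq_nonneg (f 0 1 - f 0 0)
  refine ⟨abs_le_of_sq_le_sq ?_ hq, abs_le_of_sq_le_sq ?_ hq, abs_le_of_sq_le_sq ?_ hq,
    abs_le_of_sq_le_sq ?_ hq⟩ <;> linarith

lemma sqrt_sig_pos (h : GoodCarpet L A) (n : ℕ) : 0 < √(sig L A n) := Real.sqrt_pos.2 (sig_pos h n)

lemma geo_bound (h : GoodCarpet L A) (K : ℕ → ℝ) (B : ℝ) (hB : 0 ≤ B) (hK0 : ∀ n, 0 ≤ K n)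
    (hK : ∀ n, K (n + 1) ≤ K n + B / √(sig L A n)) :
    ∃ C > 0, ∀ n, K n * √(sig L A n) ≤ C := by
  set θ : ℝ := √((#A : ℝ) / (L : ℝ) ^ 2) with hθ
  have hθ1 : θ < 1 := by
    rw [hθ, Real.sqrt_lt' one_pos]; simpa using rate_lt_one h
  have hθ0 : 0 ≤ θ := Real.sqrt_nonneg _
  have hdec : ∀ n, √(sig L A (n + 1)) ≤ θ * √(sig L A n) := by
    intro n
    rw [hθ, ← Real.sqrt_mul (by positivity)]
    exact Real.sqrt_le_sqrt (sig_decay h n)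
  have h1θ : 0 < 1 - θ := by linarith
  have hx0 : 0 ≤ K 0 * √(sig L A 0) := mul_nonneg (hK0 0) (Real.sqrt_nonneg _)
  have hBd : 0 ≤ B / (1 - θ) := by positivity
  refine ⟨K 0 * √(sig L A 0) + B / (1 - θ) + 1, by linarith, ?_⟩
  suffices ∀ n, K n * √(sig L A n) ≤ K 0 * √(sig L A 0) + B / (1 - θ) from
    fun n => (this n).trans (by linarith)
  intro n
  induction n with
  | zero => linarith
  | succ n ih =>
    have hs := sqrt_sig_pos h n
    have e : B / (1 - θ) * (1 - θ) = B := by field_simp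
    calc K (n + 1) * √(sig L A (n + 1)) ≤ (K n + B / √(sig L A n)) * (θ * √(sig L A n)) :=
          mul_le_mul (hK n) (hdec n) (Real.sqrt_nonneg _) (by have := hK0 n; positivity)
      _ = θ * (K n * √(sig L A n)) + θ * B := by field_simp
      _ ≤ θ * (K 0 * √(sig L A 0) + B / (1 - θ)) + θ * B := by gcongr
      _ ≤ K 0 * √(sig L A 0) + B / (1 - θ) := by nlinarith

/-- crossing constants -/
noncomputable def Kc (L : ℕ) (A : Finset (ℕ × ℕ)) : ℕ → ℝ
  | 0 => 1
  | n + 1 => Kc L A n + √L / √(sig L A n)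

lemma Kc_nonneg (n : ℕ) : 0 ≤ Kc L A n := by
  induction n with
  | zero => simp [Kc]
  | succ n ih => unfold Kc; positivity

lemma Crossing_zero_lt {N : ℤ} (hN : 0 < N) {P : ℕ → ℤ × ℤ} {l : ℕ} (hP : Crossing N P l) : 0 < l := by
  rcases Nat.eq_zero_or_pos l with rfl | h
  · have := hP.2.2.1; have := hP.2.2.2; omega
  · exact h

/-- cut a crossing at the first time it reaches a smaller height -/
lemma Crossing_cut {N M : ℤ} (hM : 0 < M) (hMN : M ≤ N) {P : ℕ → ℤ × ℤ} {l : ℕ} (hP : Crossing N P l)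
    (hb : ∀ k ≤ l, (P k).2 ≤ M) : ∃ l' ≤ l, Crossing M P l' := by
  obtain ⟨p1, p2, p3, p4⟩ := hP
  have hex : ∃ k, M ≤ (P k).1 := ⟨l, by omega⟩
  have hl : Nat.find hex ≤ l := Nat.find_min' hex (by omega)
  have hs := Nat.find_spec hex
  have hlt : ∀ k, k < Nat.find hex → (P k).1 < M := fun k hk => not_le.1 (Nat.find_min hex hk)
  have heq : (P (Nat.find hex)).1 = M := by
    rcases Nat.eq_zero_or_pos (Nat.find hex) with h0 | h0
    · rw [h0] at hs ⊢; omega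
    · obtain ⟨m, hm⟩ : ∃ m, Nat.find hex = m + 1 := ⟨_, (Nat.succ_pred_eq_of_pos h0).symm⟩
      have h1 := hlt m (by omega)
      have h2 := p1 m (by omega)
      rw [← hm] at h2
      unfold Nbr at h2
      omega
  refine ⟨Nat.find hex, hl, fun k hk => p1 k (by omega), ?_, p3, heq⟩
  intro k hk
  have h1 := p2 k (by omega)
  have h2 := hb k (by omega)
  refine ⟨⟨h1.1.1, ?_⟩, h1.2.1, h2⟩
  rcases hk.lt_or_eq with h3 | h3
  · exact (hlt k h3).le
  · rw [h3]; omega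

lemma QQ_sub_cell (n : ℕ) (f : ℤ → ℤ → ℝ) (a : ℕ × ℕ) (ha : a ∈ A) :
    QQ L A n (sh ((a.1 : ℤ) * (L : ℤ) ^ n) ((a.2 : ℤ) * (L : ℤ) ^ n) f) ≤ QQ L A (n + 1) f := by
  rw [QQ_succ]
  exact Finset.single_le_sum (f := fun a : ℕ × ℕ =>
    QQ L A n (sh ((a.1 : ℤ) * (L : ℤ) ^ n) ((a.2 : ℤ) * (L : ℤ) ^ n) f)) (fun _ _ => QQ_nonneg n _) ha

lemma cross_corner (h : GoodCarpet L A) (n : ℕ) : ∀ (f : ℤ → ℤ → ℝ) (q : ℝ), 0 < q →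
    QQ L A n f < q ^ 2 → ∀ P l, Crossing ((L : ℤ) ^ n) P l →
    ∃ k ≤ l, |f (P k).1 (P k).2 - f 0 0| ≤ Kc L A n * q := by
  have hL3 := h.three_le
  have hL : 0 < L := by omega
  induction n with
  | zero =>
    intro f q hq hf P l hP
    refine ⟨0, Nat.zero_le _, ?_⟩
    obtain ⟨p1, p2, p3, p4⟩ := hP
    have h0 := p2 0 (Nat.zero_le _)
    rw [pow_zero] at h0
    have h1 := Q0_edges f q hq.le hf.le
    rw [p3]
    have : (P 0).2 = 0 ∨ (P 0).2 = 1 := by omega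
    simp only [Kc, one_mul]
    rcases this with h2 | h2 <;> rw [h2]
    · simpa using hq.le
    · exact h1.2.2.2
  | succ n ih =>
    intro f q hq hf P l hP
    have hs := sqrt_sig_pos h n
    have hLr : (0 : ℝ) < L := by exact_mod_cast hL
    have hsL : 0 < √(L : ℝ) := Real.sqrt_pos.2 hLr
    obtain ⟨C, l', c1, c2, c3⟩ := strip_path h n f (√L / √(sig L A n) * q) (by positivity) (by
      have : (√(L : ℝ) / √(sig L A n) * q) ^ 2 * sig L A n = L * q ^ 2 := by
        rw [mul_pow, div_pow, Real.sq_sqrt hLr.le, Real.sq_sqrt (sig_pos h n).le]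
        have := sig_pos h n
        field_simp
      rw [this]
      exact mul_lt_mul_of_pos_left hf hLr)
    have hN := Lpow_pos hL n
    have hNN : (L : ℤ) ^ n ≤ (L : ℤ) ^ (n + 1) := by
      rw [pow_succ]; nlinarith
    obtain ⟨l'', hl'', c4⟩ := Crossing_cut hN hNN c1 (fun k hk => c2 k hk)
    have c5 := ih (fun x y => f y x) q hq (by
      rw [QQ_swap h.symm_swap]
      have := QQ_sub_cell (L := L) n f (0, 0) (h.flat_border 0 0 hL hL (Or.inl rfl))
      simp only [Nat.cast_zero, zero_mul, sh_zero] at this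
      linarith) _ l'' c4
    obtain ⟨k, hk, c6⟩ := c5
    obtain ⟨i, hi, j, hj, c7⟩ := crossing_meet _ P C l l' hP c1
    refine ⟨i, hi, ?_⟩
    have c8 := path_osc (fun p : ℤ × ℤ => f p.1 p.2) C l' j k hj (hk.trans hl'')
    simp only [Prod.fst_swap, Prod.snd_swap] at c6
    rw [c7]
    unfold Kc
    have c9 := abs_sub_le (f (C j).1 (C j).2) (f (C k).1 (C k).2) (f 0 0)
    linarith

lemma Crossing_reflect {N : ℤ} {P : ℕ → ℤ × ℤ} {l : ℕ} (hP : Crossing N P l) :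
    Crossing N (fun k => (N - (P (l - k)).1, (P (l - k)).2)) l := by
  obtain ⟨p1, p2, p3, p4⟩ := hP
  refine ⟨?_, ?_, by simp [p4], by simp [p3]⟩
  · intro k hk
    have := p1 (l - (k + 1)) (by omega)
    rw [show l - (k + 1) + 1 = l - k by omega] at this
    simp only [Nbr] at *
    omega
  · intro k hk
    have := p2 (l - k) (by omega)
    simp only
    omega

lemma corner (h : GoodCarpet L A) : ∃ C > 0, ∀ n (f : ℤ → ℤ → ℝ),
    (f 0 0 - f ((L : ℤ) ^ n) 0) ^ 2 * sig L A n ≤ C * QQ L A n f := by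
  obtain ⟨C0, hC0, hC⟩ := geo_bound h (Kc L A) (√L) (Real.sqrt_nonneg _) Kc_nonneg (fun n => le_rfl)
  refine ⟨(2 * C0 + 1) ^ 2, by positivity, fun n f => ?_⟩
  have hs := sqrt_sig_pos h n
  have key : ∀ q > 0, QQ L A n f < q ^ 2 →
      (f 0 0 - f ((L : ℤ) ^ n) 0) ^ 2 * sig L A n ≤ (2 * C0 + 1) ^ 2 * q ^ 2 := by
    intro q hq hf
    obtain ⟨P, l, p1, p2⟩ := lr_path h n f (q / √(sig L A n)) (by positivity) (by
      rw [div_pow, Real.sq_sqrt (sig_pos h n).le]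
      have := sig_pos h n
      field_simp
      exact hf)
    obtain ⟨k, hk, k1⟩ := cross_corner h n f q hq hf P l p1
    obtain ⟨j, hj, j1⟩ := cross_corner h n (fun x y => f ((L : ℤ) ^ n - x) y) q hq
      (by rw [QQ_reflect h.mem_lt h.symm_reflect]; exact hf) _ l (Crossing_reflect p1)
    simp only [sub_sub_cancel, sub_zero] at j1
    have o := path_osc (fun p : ℤ × ℤ => f p.1 p.2) P l k (l - j) hk (by omega)
    have t : |f 0 0 - f ((L : ℤ) ^ n) 0| ≤ Kc L A n * q + q / √(sig L A n) + Kc L A n * q := by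
      rw [abs_le] at *
      constructor <;> linarith
    have t2 : |f 0 0 - f ((L : ℤ) ^ n) 0| * √(sig L A n) ≤ (2 * C0 + 1) * q := by
      calc _ ≤ (Kc L A n * q + q / √(sig L A n) + Kc L A n * q) * √(sig L A n) := by gcongr
        _ = 2 * (Kc L A n * √(sig L A n)) * q + q := by field_simp; ring
        _ ≤ 2 * C0 * q + q := by have := hC n; gcongr
        _ = _ := by ring
    have t3 := pow_le_pow_left₀ (by positivity) t2 2
    rwa [mul_pow, mul_pow, sq_abs, Real.sq_sqrt (sig_pos h n).le] at t3
  by_contra! hlt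
  have hc : 0 < (2 * C0 + 1) ^ 2 := by positivity
  set X := (f 0 0 - f ((L : ℤ) ^ n) 0) ^ 2 * sig L A n
  have h1 : QQ L A n f < X / (2 * C0 + 1) ^ 2 := by rw [lt_div_iff₀ hc]; linarith
  obtain ⟨e, e1, e2⟩ := exists_between h1
  have he : 0 < e := (QQ_nonneg n f).trans_lt e1
  have h2 := key (√e) (Real.sqrt_pos.2 he) (by rw [Real.sq_sqrt he.le]; exact e1)
  rw [Real.sq_sqrt he.le] at h2
  rw [lt_div_iff₀ hc] at e2
  linarith

/-- all four corner differences -/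
lemma corner4 (h : GoodCarpet L A) {C : ℝ} (hC : ∀ n (f : ℤ → ℤ → ℝ),
    (f 0 0 - f ((L : ℤ) ^ n) 0) ^ 2 * sig L A n ≤ C * QQ L A n f) (n : ℕ) (f : ℤ → ℤ → ℝ) :
    Q0 (fun i j => f (i * (L : ℤ) ^ n) (j * (L : ℤ) ^ n)) * sig L A n ≤ 4 * C * QQ L A n f := by
  have h1 := hC n f
  have h2 := hC n (fun x y => f y x)
  rw [QQ_swap h.symm_swap] at h2
  have h3 := hC n (fun x y => f x ((L : ℤ) ^ n - y))
  rw [QQ_reflect2 h.mem_lt h.symm_swap h.symm_reflect] at h3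
  have h4 := hC n (fun x y => f ((L : ℤ) ^ n - y) x)
  rw [QQ_swap h.symm_swap n (fun x y => f ((L : ℤ) ^ n - x) y),
    QQ_reflect h.mem_lt h.symm_reflect] at h4
  simp only [sub_zero] at h3 h4
  simp only [Q0, zero_mul, one_mul]
  nlinarith

lemma weak_mono (h : GoodCarpet L A) : ∃ C > 0, ∀ m k (f : ℤ → ℤ → ℝ),
    QQ L A m (fun i j => f (i * (L : ℤ) ^ k) (j * (L : ℤ) ^ k)) * sig L A k ≤ C * QQ L A (m + k) f := by
  obtain ⟨C, hC0, hC⟩ := corner h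
  refine ⟨4 * C, by positivity, fun m k => ?_⟩
  induction m with
  | zero =>
    intro f
    rw [zero_add]
    exact corner4 h hC k f
  | succ m ih =>
    intro f
    rw [show m + 1 + k = (m + k) + 1 by ring, QQ_succ, QQ_succ, Finset.sum_mul, Finset.mul_sum]
    apply Finset.sum_le_sum
    intro a _
    refine le_trans (le_of_eq ?_) (ih _)
    congr 2
    funext x y
    simp only [sh]
    congr 1 <;> ring

lemma sig_supmul (h : GoodCarpet L A) : ∃ C > 0, ∀ m k, sig L A m * sig L A k ≤ C * sig L A (m + k) := by
  obtain ⟨C, hC0, hC⟩ := weak_mono h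
  have hL : 0 < L := by have := h.three_le; omega
  refine ⟨C, hC0, fun m k => ?_⟩
  rw [← div_le_iff₀' hC0]
  apply le_sig hL
  intro f hf
  rw [div_le_iff₀' hC0]
  refine le_trans ?_ (hC m k f)
  have hk := sig_pos h k
  gcongr
  apply sig_le
  have hN := Lpow_pos hL k
  have hp : (L : ℤ) ^ (m + k) = (L : ℤ) ^ m * (L : ℤ) ^ k := pow_add _ _ _
  constructor
  · intro j h0 h1
    simp only [zero_mul]
    apply hf.1
    · positivity
    · rw [hp]; gcongr
  · intro j h0 h1
    simp only
    rw [← hp]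
    apply hf.2
    · positivity
    · rw [hp]; gcongr

lemma sig_growth (h : GoodCarpet L A) : ∃ r > 1, ∃ c ≥ 1, ∀ n, c⁻¹ ≤ sig L A n * r ^ n ∧
    sig L A n * r ^ n ≤ c := by
  obtain ⟨C, hC0, hC⟩ := sig_supmul h
  have sp := sig_pos h
  set u : ℕ → ℝ := fun n => Real.log (4 * sig L A n) with hu
  set v : ℕ → ℝ := fun n => Real.log C - Real.log (sig L A n) with hv
  have hus : Subadditive u := by
    intro m n
    have h1 := sig_submul h m n
    have hm := sp m
    have hn := sp n
    have hmn := sp (m + n)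
    simp only [hu]
    rw [← Real.log_mul (by positivity) (by positivity)]
    apply Real.log_le_log (by positivity)
    nlinarith
  have hvs : Subadditive v := by
    intro m n
    have h1 := hC m n
    have hm := sp m
    have hn := sp n
    have hmn := sp (m + n)
    simp only [hv]
    have := Real.log_le_log (by positivity) h1
    rw [Real.log_mul (by positivity) (by positivity), Real.log_mul (by positivity) (by positivity)] at this
    linarith
  have huv : ∀ n, u n = Real.log 4 + Real.log C - v n := by
    intro n
    simp only [hu, hv]
    rw [Real.log_mul (by norm_num) (sp n).ne']
    ring
  set ρ : ℝ := (#A : ℝ) / (L : ℝ) ^ 2 with hρ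
  have hρ1 : ρ < 1 := rate_lt_one h
  have hρ0 : 0 < ρ := by
    have h1 := sig_decay h 0
    have h2 := sp 0
    have h3 := sp 1
    by_contra! hn
    have : ρ * sig L A 0 ≤ 0 := mul_nonpos_of_nonpos_of_nonneg hn h2.le
    simp only [zero_add] at h1
    linarith
  have hsn : ∀ n, sig L A n ≤ ρ ^ n * 2 := by
    intro n
    induction n with
    | zero => simpa using sig_zero_le
    | succ n ih =>
      calc _ ≤ ρ * sig L A n := sig_decay h n
        _ ≤ ρ * (ρ ^ n * 2) := by gcongr
        _ = _ := by ring
  have hun : ∀ n, u n ≤ Real.log 8 + n * Real.log ρ := by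
    intro n
    simp only [hu]
    have h1 : 4 * sig L A n ≤ 8 * ρ ^ n := by linarith [hsn n]
    have := Real.log_le_log (by linarith [sp n]) h1
    rwa [Real.log_mul (x := 8) (by norm_num) (by positivity), Real.log_pow] at this
  have hlogρ : Real.log ρ < 0 := Real.log_neg hρ0 hρ1
  -- boundedness
  have hbv : BddBelow (Set.range fun n => v n / n) := by
    have hl8 : 0 ≤ Real.log 8 := Real.log_nonneg (by norm_num)
    refine ⟨-(|Real.log 4 + Real.log C| + Real.log 8), ?_⟩
    rintro _ ⟨n, rfl⟩
    simp only
    rcases Nat.eq_zero_or_pos n with rfl | hn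
    · rw [Nat.cast_zero, div_zero, neg_nonpos]; positivity
    · have hn1 : (1 : ℝ) ≤ n := by exact_mod_cast hn
      rw [le_div_iff₀ (by positivity)]
      have h1 := hun n
      have h2 := huv n
      have h3 : (n : ℝ) * Real.log ρ ≤ 0 := mul_nonpos_of_nonneg_of_nonpos (by positivity) hlogρ.le
      have h4 := neg_abs_le (Real.log 4 + Real.log C)
      have h5 := abs_nonneg (Real.log 4 + Real.log C)
      nlinarith
  have hbu : BddBelow (Set.range fun n => u n / n) := by
    have hvn : ∀ n : ℕ, v n ≤ n * v 1 + |v 0| := by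
      intro n
      induction n with
      | zero => simp; exact le_abs_self _
      | succ n ih =>
        have := hvs n 1
        push_cast
        linarith
    refine ⟨-(|Real.log 4 + Real.log C| + |v 1| + |v 0|), ?_⟩
    rintro _ ⟨n, rfl⟩
    simp only
    rcases Nat.eq_zero_or_pos n with rfl | hn
    · rw [Nat.cast_zero, div_zero, neg_nonpos]; positivity
    · have hn1 : (1 : ℝ) ≤ n := by exact_mod_cast hn
      rw [le_div_iff₀ (by positivity)]
      have h1 := hvn n
      have h2 := huv n
      have h4 := neg_abs_le (Real.log 4 + Real.log C)
      have h5 := abs_nonneg (Real.log 4 + Real.log C)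
      have h6 := le_abs_self (v 1)
      have h7 := abs_nonneg (v 0)
      nlinarith
  have tu := hus.tendsto_lim hbu
  have tv := hvs.tendsto_lim hbv
  have hlim : hvs.lim = - hus.lim := by
    refine tendsto_nhds_unique tv ?_
    have h0 : Filter.Tendsto (fun n : ℕ => (Real.log 4 + Real.log C) / (n : ℝ)) Filter.atTop (nhds 0) :=
      tendsto_const_div_atTop_nhds_zero_nat _
    have := h0.sub tu
    rw [zero_sub] at this
    refine this.congr (fun n => ?_)
    rw [huv n]
    ring
  set lam := hus.lim with hlam
  have hlam0 : lam < 0 := by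
    have h0 : Filter.Tendsto (fun n : ℕ => Real.log 8 / (n : ℝ) + Real.log ρ) Filter.atTop
        (nhds (0 + Real.log ρ)) :=
      (tendsto_const_div_atTop_nhds_zero_nat _).add_const _
    rw [zero_add] at h0
    refine lt_of_le_of_lt (le_of_tendsto_of_tendsto tu h0 ?_) hlogρ
    filter_upwards [Filter.eventually_ge_atTop 1] with n hn
    have hn1 : (0 : ℝ) < n := by exact_mod_cast hn
    rw [div_le_iff₀ hn1]
    have := hun n
    have e : (Real.log 8 / n + Real.log ρ) * n = Real.log 8 + n * Real.log ρ := by field_simp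
    linarith
  have s0 := sp 0
  refine ⟨Real.exp (-lam), by rw [gt_iff_lt, Real.one_lt_exp_iff]; linarith,
    4 + C + 2 + (sig L A 0)⁻¹, ?_, fun n => ?_⟩
  · have : 0 < (sig L A 0)⁻¹ := by positivity
    linarith
  have hi : 0 < (sig L A 0)⁻¹ := by positivity
  rcases Nat.eq_zero_or_pos n with rfl | hn
  · simp only [pow_zero, mul_one]
    constructor
    · apply inv_le_of_inv_le₀ s0; linarith
    · linarith [sig_zero_le (L := L) (A := A)]
  · have hn1 : (0 : ℝ) < n := by exact_mod_cast hn
    have h1 := hus.lim_le_div hbu (n := n) (by omega)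
    have h2 := hvs.lim_le_div hbv (n := n) (by omega)
    rw [hlim, le_div_iff₀ hn1] at h2
    rw [← hlam, le_div_iff₀ hn1] at h1
    have e : sig L A n * Real.exp (-lam) ^ n = Real.exp (Real.log (sig L A n) - n * lam) := by
      rw [Real.exp_sub, Real.exp_log (sp n), ← Real.exp_nat_mul, mul_neg, Real.exp_neg, div_eq_mul_inv]
    rw [e]
    have h3 : u n = Real.log 4 + Real.log (sig L A n) := by
      simp only [hu]; rw [Real.log_mul (by norm_num) (sp n).ne']
    constructor
    · calc (4 + C + 2 + (sig L A 0)⁻¹)⁻¹ ≤ (4 : ℝ)⁻¹ := by gcongr; linarith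
        _ = Real.exp (- Real.log 4) := by rw [Real.exp_neg, Real.exp_log (by norm_num)]
        _ ≤ _ := by apply Real.exp_le_exp.2; linarith
    · calc _ ≤ Real.exp (Real.log C) := by apply Real.exp_le_exp.2; simp only [hv] at h2; linarith
        _ = C := Real.exp_log hC0
        _ ≤ _ := by linarith





lemma touch_closed (h : GoodCarpet L A) (S : Finset (ℕ × ℕ)) (hSA : S ⊆ A) (hS0 : (0, 0) ∈ S)
    (hS : ∀ a ∈ S, ∀ b ∈ A, a.1 ≤ b.1 + 1 → b.1 ≤ a.1 + 1 → a.2 ≤ b.2 + 1 → b.2 ≤ a.2 + 1 → b ∈ S) :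
    S = A := by
  have hL : (0 : ℝ) < L := by have := h.three_le; exact_mod_cast (by omega : 0 < L)
  by_contra hne
  obtain ⟨b0, hb0A, hb0S⟩ : ∃ b ∈ A, b ∉ S := by
    by_contra! hc
    exact hne (Finset.Subset.antisymm hSA hc)
  set I : ℕ × ℕ → Set (ℝ × ℝ) := fun p => Set.Icc (((p.1 : ℝ) / L, (p.2 : ℝ) / L) : ℝ × ℝ)
      ((((p.1 : ℝ) + 1) / L, ((p.2 : ℝ) + 1) / L) : ℝ × ℝ) with hI
  have hcl : ∀ T : Finset (ℕ × ℕ), IsClosed (⋃ p ∈ T, I p) := fun T =>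
    Set.Finite.isClosed_biUnion T.finite_toSet (fun p _ => isClosed_Icc)
  have hmem : ∀ p, (((p.1 : ℝ) / L, (p.2 : ℝ) / L) : ℝ × ℝ) ∈ I p := by
    intro p
    simp only [hI, Set.mem_Icc, le_refl, true_and, Prod.mk_le_mk]
    constructor <;> gcongr <;> linarith
  have := isPreconnected_closed_iff.1 h.connected.isPreconnected (⋃ p ∈ S, I p) (⋃ p ∈ A \ S, I p)
    (hcl _) (hcl _) (by
      intro x hx
      obtain ⟨p, hp, hxp⟩ := Set.mem_iUnion₂.1 hx
      by_cases hpS : p ∈ S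
      · left; exact Set.mem_iUnion₂.2 ⟨p, hpS, hxp⟩
      · right; exact Set.mem_iUnion₂.2 ⟨p, Finset.mem_sdiff.2 ⟨hp, hpS⟩, hxp⟩)
    ⟨_, Set.mem_iUnion₂.2 ⟨_, hSA hS0, hmem _⟩, Set.mem_iUnion₂.2 ⟨_, hS0, hmem _⟩⟩
    ⟨_, Set.mem_iUnion₂.2 ⟨_, hb0A, hmem _⟩,
      Set.mem_iUnion₂.2 ⟨_, Finset.mem_sdiff.2 ⟨hb0A, hb0S⟩, hmem _⟩⟩
  obtain ⟨x, _, hxS, hxT⟩ := this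
  obtain ⟨a, ha, hxa⟩ := Set.mem_iUnion₂.1 hxS
  obtain ⟨b, hb, hxb⟩ := Set.mem_iUnion₂.1 hxT
  rw [Finset.mem_sdiff] at hb
  apply hb.2
  have key : ∀ (s t : ℕ) (z : ℝ), (s : ℝ) / L ≤ z → z ≤ ((t : ℝ) + 1) / L → s ≤ t + 1 := by
    intro s t z h1 h2
    have h3 := h1.trans h2
    rw [div_le_div_iff_of_pos_right hL] at h3
    exact_mod_cast h3
  simp only [hI, Set.mem_Icc, Prod.le_def] at hxa hxb
  exact hS a ha b hb.1 (key _ _ _ hxa.1.1 hxb.2.1) (key _ _ _ hxb.1.1 hxa.2.1)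
    (key _ _ _ hxa.1.2 hxb.2.2) (key _ _ _ hxb.1.2 hxa.2.2)

lemma Q0_corner (f : ℤ → ℤ → ℝ) (q : ℝ) (hq : 0 ≤ q) (hf : Q0 f ≤ q ^ 2) (x y : ℤ)
    (hx : 0 ≤ x ∧ x ≤ 1) (hy : 0 ≤ y ∧ y ≤ 1) : |f x y - f 0 0| ≤ 2 * q := by
  obtain ⟨h1, h2, h3, h4⟩ := Q0_edges f q hq hf
  have hx' : x = 0 ∨ x = 1 := by omega
  have hy' : y = 0 ∨ y = 1 := by omega
  rw [abs_le] at *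
  rcases hx' with rfl | rfl <;> rcases hy' with rfl | rfl <;> constructor <;> linarith

lemma chain_bound (h : GoodCarpet L A) : ∃ M : ℝ, 0 ≤ M ∧ ∀ (g : ℤ → ℤ → ℝ) (δ : ℝ), 0 ≤ δ →
    (∀ a ∈ A, Q0 (sh (a.1 : ℤ) (a.2 : ℤ) g) ≤ δ ^ 2) → ∀ a ∈ A, |g a.1 a.2 - g 0 0| ≤ M * δ := by
  have hL : 0 < L := by have := h.three_le; omega
  set Pr : ℕ × ℕ → Prop := fun a => ∃ M : ℝ, 0 ≤ M ∧ ∀ (g : ℤ → ℤ → ℝ) (δ : ℝ), 0 ≤ δ →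
    (∀ a ∈ A, Q0 (sh (a.1 : ℤ) (a.2 : ℤ) g) ≤ δ ^ 2) → |g a.1 a.2 - g 0 0| ≤ M * δ with hPr
  have hall : A.filter Pr = A := by
    apply touch_closed h
    · exact Finset.filter_subset _ _
    · rw [Finset.mem_filter]
      refine ⟨h.flat_border 0 0 hL hL (Or.inl rfl), 0, le_rfl, ?_⟩
      intro g δ hδ hg
      simp
    · rintro a ha b hb h1 h2 h3 h4
      rw [Finset.mem_filter] at ha ⊢
      obtain ⟨haA, M, hM0, hM⟩ := ha
      refine ⟨hb, M + 4, by linarith, ?_⟩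
      intro g δ hδ hg
      have e1 := hM g δ hδ hg
      have e2 := Q0_corner _ δ hδ (hg a haA) (max (a.1 : ℤ) b.1 - a.1) (max (a.2 : ℤ) b.2 - a.2)
        (by omega) (by omega)
      have e3 := Q0_corner _ δ hδ (hg b hb) (max (a.1 : ℤ) b.1 - b.1) (max (a.2 : ℤ) b.2 - b.2)
        (by omega) (by omega)
      simp only [sh, add_sub_cancel, add_zero] at e2 e3
      rw [abs_le] at *
      constructor <;> linarith
  have hch : ∀ a : ℕ × ℕ, ∃ M : ℝ, 0 ≤ M ∧ (a ∈ A → ∀ (g : ℤ → ℤ → ℝ) (δ : ℝ), 0 ≤ δ →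
    (∀ a ∈ A, Q0 (sh (a.1 : ℤ) (a.2 : ℤ) g) ≤ δ ^ 2) → |g a.1 a.2 - g 0 0| ≤ M * δ) := by
    intro a
    by_cases ha : a ∈ A
    · rw [← hall, Finset.mem_filter] at ha
      obtain ⟨_, M, h1, h2⟩ := ha
      exact ⟨M, h1, fun _ => h2⟩
    · exact ⟨0, le_rfl, fun h => absurd h ha⟩
  choose M hM0 hM using hch
  refine ⟨∑ a ∈ A, M a, Finset.sum_nonneg fun a _ => hM0 a, ?_⟩
  intro g δ hδ hg a ha
  refine (hM a ha g δ hδ hg).trans ?_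
  gcongr
  exact Finset.single_le_sum (f := M) (fun a _ => hM0 a) ha

/-- level-`n` vertices -/
def IsVert (L : ℕ) (A : Finset (ℕ × ℕ)) (n : ℕ) (x y : ℤ) : Prop :=
  ∃ i j, IsCell L A n i j ∧ (i ≤ x ∧ x ≤ i + 1) ∧ (j ≤ y ∧ y ≤ j + 1)

lemma oscillation (h : GoodCarpet L A) : ∃ C > 0, ∀ n (f : ℤ → ℤ → ℝ) (x y : ℤ), IsVert L A n x y →
    (f x y - f 0 0) ^ 2 * sig L A n ≤ C * QQ L A n f := by
  obtain ⟨C, hC0, hC⟩ := corner h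
  obtain ⟨M, hM0, hM⟩ := chain_bound h
  set B : ℝ := M * √(4 * C) with hB
  have hB0 : 0 ≤ B := by positivity
  set K : ℕ → ℝ := fun n => Nat.rec 2 (fun n x => x + B / √(sig L A n)) n with hK
  have hKs : ∀ n, K (n + 1) = K n + B / √(sig L A n) := fun n => rfl
  have hK0 : ∀ n, 0 ≤ K n := by
    intro n
    induction n with
    | zero => simp [hK]
    | succ n ih => rw [hKs]; positivity
  obtain ⟨D, hD0, hD⟩ := geo_bound h K B hB0 hK0 (fun n => le_rfl)
  have main : ∀ n (f : ℤ → ℤ → ℝ) (q : ℝ), 0 ≤ q → QQ L A n f ≤ q ^ 2 → ∀ x y, IsVert L A n x y →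
      |f x y - f 0 0| ≤ K n * q := by
    intro n
    induction n with
    | zero =>
      rintro f q hq hf x y ⟨i, j, ⟨rfl, rfl⟩, h1, h2⟩
      exact Q0_corner f q hq hf x y (by omega) (by omega)
    | succ n ih =>
      rintro f q hq hf x y ⟨_, _, ⟨a, ha, i, j, hc, rfl, rfl⟩, h1, h2⟩
      have hs := sqrt_sig_pos h n
      have hs' := sig_pos h n
      have e1 := ih (sh ((a.1 : ℤ) * (L : ℤ) ^ n) ((a.2 : ℤ) * (L : ℤ) ^ n) f) q hq
        ((QQ_sub_cell n f a ha).trans hf) (x - (a.1 : ℤ) * (L : ℤ) ^ n) (y - (a.2 : ℤ) * (L : ℤ) ^ n)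
        ⟨i, j, hc, by omega, by omega⟩
      have e2 := hM (fun i j => f (i * (L : ℤ) ^ n) (j * (L : ℤ) ^ n)) (√(4 * C) / √(sig L A n) * q)
        (by positivity) (by
          intro b hb
          have e3 := corner4 h hC n (sh ((b.1 : ℤ) * (L : ℤ) ^ n) ((b.2 : ℤ) * (L : ℤ) ^ n) f)
          have e4 := (QQ_sub_cell n f b hb).trans hf
          rw [mul_pow, div_pow, Real.sq_sqrt (by positivity), Real.sq_sqrt hs'.le]
          have e5 : (4 * C) / sig L A n * q ^ 2 = (4 * C * q ^ 2) / sig L A n := by ring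
          rw [e5, le_div_iff₀ hs']
          calc _ = _ := ?_
            _ ≤ _ := e3
            _ ≤ _ := by gcongr
          congr 2
          funext x y
          simp only [sh]
          congr 1 <;> ring) a ha
      simp only [sh, add_sub_cancel, add_zero, zero_mul] at e1 e2
      rw [hKs, hB]
      have e6 : M * √(4 * C) / √(sig L A n) * q = M * (√(4 * C) / √(sig L A n) * q) := by ring
      rw [add_mul, e6]
      rw [abs_le] at *
      constructor <;> linarith
  refine ⟨D ^ 2, by positivity, ?_⟩
  intro n f x y hv
  have hQ := QQ_nonneg (L := L) (A := A) n f
  have e1 := main n f (√(QQ L A n f)) (Real.sqrt_nonneg _) (by rw [Real.sq_sqrt hQ]) x y hv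
  have e2 : |f x y - f 0 0| * √(sig L A n) ≤ D * √(QQ L A n f) := by
    calc _ ≤ (K n * √(QQ L A n f)) * √(sig L A n) := by gcongr
      _ = (K n * √(sig L A n)) * √(QQ L A n f) := by ring
      _ ≤ _ := by have := hD n; gcongr
  have t3 := pow_le_pow_left₀ (by positivity) e2 2
  rwa [mul_pow, mul_pow, sq_abs, Real.sq_sqrt (sig_pos h n).le, Real.sq_sqrt hQ] at t3

/-- decomposition of cells -/
lemma isCell_decomp (m k : ℕ) : ∀ i j : ℤ, IsCell L A (m + k) i j → ∃ i1 j1 i2 j2,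
    IsCell L A m i1 j1 ∧ IsCell L A k i2 j2 ∧ i = i1 * (L : ℤ) ^ k + i2 ∧ j = j1 * (L : ℤ) ^ k + j2 := by
  induction m with
  | zero =>
    intro i j hc
    rw [zero_add] at hc
    exact ⟨0, 0, i, j, ⟨rfl, rfl⟩, hc, by ring, by ring⟩
  | succ m ih =>
    intro i j hc
    rw [show m + 1 + k = (m + k) + 1 by ring] at hc
    obtain ⟨a, ha, i', j', hc', rfl, rfl⟩ := hc
    obtain ⟨i1, j1, i2, j2, c1, c2, rfl, rfl⟩ := ih _ _ hc'
    exact ⟨_, _, i2, j2, ⟨a, ha, i1, j1, c1, rfl, rfl⟩, c2, by ring, by ring⟩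

lemma isCell_comp (m k : ℕ) : ∀ i1 j1 i2 j2 : ℤ, IsCell L A m i1 j1 → IsCell L A k i2 j2 →
    IsCell L A (m + k) (i1 * (L : ℤ) ^ k + i2) (j1 * (L : ℤ) ^ k + j2) := by
  induction m with
  | zero =>
    rintro i1 j1 i2 j2 ⟨rfl, rfl⟩ hc
    rw [zero_add]
    simpa using hc
  | succ m ih =>
    rintro _ _ i2 j2 ⟨a, ha, i', j', hc', rfl, rfl⟩ hc
    rw [show m + 1 + k = (m + k) + 1 by ring]
    exact ⟨a, ha, _, _, ih i' j' i2 j2 hc' hc, by ring, by ring⟩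

lemma QQ_cell_le (m k : ℕ) : ∀ (i j : ℤ) (f : ℤ → ℤ → ℝ), IsCell L A m i j →
    QQ L A k (sh (i * (L : ℤ) ^ k) (j * (L : ℤ) ^ k) f) ≤ QQ L A (m + k) f := by
  induction m with
  | zero => rintro i j f ⟨rfl, rfl⟩; simp [sh_zero]
  | succ m ih =>
    rintro _ _ f ⟨a, ha, i', j', hc', rfl, rfl⟩
    rw [show m + 1 + k = (m + k) + 1 by ring]
    refine le_trans ?_ (QQ_sub_cell _ f a ha)
    refine le_trans (le_of_eq ?_) (ih i' j' _ hc')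
    rw [sh_sh]
    congr 2 <;> ring

/-- corners of the big square are vertices -/
lemma isCell_zero (h : GoodCarpet L A) (n : ℕ) : IsCell L A n 0 0 := by
  have hL : 0 < L := by have := h.three_le; omega
  induction n with
  | zero => exact ⟨rfl, rfl⟩
  | succ n ih =>
    exact ⟨(0, 0), h.flat_border 0 0 hL hL (Or.inl rfl), 0, 0, ih, by simp, by simp⟩

lemma isCell_corners (h : GoodCarpet L A) (n : ℕ) : IsCell L A n ((L : ℤ) ^ n - 1) 0 ∧
    IsCell L A n 0 ((L : ℤ) ^ n - 1) ∧ IsCell L A n ((L : ℤ) ^ n - 1) ((L : ℤ) ^ n - 1) := by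
  have hL : 0 < L := by have := h.three_le; omega
  have hL1 : L - 1 < L := by omega
  have e : ((L - 1 : ℕ) : ℤ) = (L : ℤ) - 1 := by omega
  induction n with
  | zero => refine ⟨⟨?_, ?_⟩, ⟨?_, ?_⟩, ⟨?_, ?_⟩⟩ <;> simp
  | succ n ih =>
    refine ⟨⟨(L - 1, 0), h.flat_border _ _ hL1 hL (by simp), _, _, ih.1, ?_, ?_⟩,
      ⟨(0, L - 1), h.flat_border _ _ hL hL1 (by simp), _, _, ih.2.1, ?_, ?_⟩,
      ⟨(L - 1, L - 1), h.flat_border _ _ hL1 hL1 (by simp), _, _, ih.2.2, ?_, ?_⟩⟩ <;>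
    simp only [e, Nat.cast_zero] <;> ring

lemma isVert_corners (h : GoodCarpet L A) (n : ℕ) (x y : ℤ) (hx : x = 0 ∨ x = (L : ℤ) ^ n)
    (hy : y = 0 ∨ y = (L : ℤ) ^ n) : IsVert L A n x y := by
  obtain ⟨h1, h2, h3⟩ := isCell_corners h n
  have h0 := isCell_zero h n
  rcases hx with rfl | rfl <;> rcases hy with rfl | rfl
  · exact ⟨_, _, h0, by omega, by omega⟩
  · exact ⟨_, _, h2, by omega, by omega⟩
  · exact ⟨_, _, h1, by omega, by omega⟩
  · exact ⟨_, _, h3, by omega, by omega⟩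





/-- discretisation of a function at level `n` -/
noncomputable def disc (L n : ℕ) (f : ℝ × ℝ → ℝ) : ℤ → ℤ → ℝ :=
  fun i j => f ((i : ℝ) / (L : ℝ) ^ n, (j : ℝ) / (L : ℝ) ^ n)

lemma disc_Psi (hL : 0 < L) (n : ℕ) (f : ℝ × ℝ → ℝ) (a : ℕ × ℕ) :
    sh ((a.1 : ℤ) * (L : ℤ) ^ n) ((a.2 : ℤ) * (L : ℤ) ^ n) (disc L (n + 1) f) =
      disc L n (f ∘ Psi L a) := by
  have hLr : (L : ℝ) ≠ 0 := by exact_mod_cast hL.ne'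
  funext i j
  simp only [sh, disc, Function.comp, Psi]
  congr 2
  · push_cast; field_simp; ring
  · push_cast; field_simp; ring

lemma QQ_disc_succ (hL : 0 < L) (n : ℕ) (f : ℝ × ℝ → ℝ) :
    QQ L A (n + 1) (disc L (n + 1) f) = ∑ a ∈ A, QQ L A n (disc L n (f ∘ Psi L a)) := by
  rw [QQ_succ]
  simp only [disc_Psi hL]

lemma PsiW_cons {n : ℕ} (a : {p : ℕ × ℕ // p ∈ A}) (w : Word A n) :
    PsiW L (Fin.cons a w : Word A (n + 1)) = Psi L a.1 ∘ PsiW L w := by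
  unfold PsiW
  rw [List.ofFn_succ]
  simp

lemma PsiW_zero (w : Word A 0) : PsiW L w = id := by
  unfold PsiW
  simp

lemma sum_words (n : ℕ) (φ : Word A (n + 1) → ℝ) :
    ∑ w, φ w = ∑ a : {p : ℕ × ℕ // p ∈ A}, ∑ w : Word A n, φ (Fin.cons a w) := by
  rw [← Fintype.sum_prod_type']
  exact (Fintype.sum_equiv (Fin.consEquiv (fun _ => {p : ℕ × ℕ // p ∈ A})) _ _ (fun x => rfl)).symm

lemma QQ_words (hL : 0 < L) (n : ℕ) : ∀ f : ℝ × ℝ → ℝ,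
    QQ L A n (disc L n f) = ∑ w : Word A n, Q0 (disc L 0 (f ∘ PsiW L w)) := by
  induction n with
  | zero =>
    intro f
    rw [Fintype.sum_unique, PsiW_zero]; rfl
  | succ n ih =>
    intro f
    rw [QQ_disc_succ hL, sum_words, ← Finset.sum_coe_sort A]
    apply Finset.sum_congr rfl
    intro a _
    rw [ih]
    apply Finset.sum_congr rfl
    intro w _
    rw [PsiW_cons]
    rfl

lemma PsiW_cell (hL : 0 < L) (n : ℕ) : ∀ w : Word A n, ∃ i j : ℤ, IsCell L A n i j ∧
    ∀ p, PsiW L w p = (((i : ℝ) + p.1) / (L : ℝ) ^ n, ((j : ℝ) + p.2) / (L : ℝ) ^ n) := by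
  have hLr : (L : ℝ) ≠ 0 := by exact_mod_cast hL.ne'
  induction n with
  | zero => intro w; exact ⟨0, 0, ⟨rfl, rfl⟩, fun p => by simp [PsiW_zero]⟩
  | succ n ih =>
    intro w
    obtain ⟨i, j, hc, hp⟩ := ih (Fin.tail w)
    refine ⟨_, _, ⟨(w 0).1, (w 0).2, i, j, hc, rfl, rfl⟩, fun p => ?_⟩
    have := PsiW_cons (L := L) (w 0) (Fin.tail w)
    rw [Fin.cons_self_tail] at this
    rw [this, Function.comp, hp]
    simp only [Psi]
    ext
    · push_cast; field_simp; ring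
    · push_cast; field_simp; ring

lemma cell_PsiW (hL : 0 < L) (n : ℕ) : ∀ i j : ℤ, IsCell L A n i j → ∃ w : Word A n,
    ∀ p, PsiW L w p = (((i : ℝ) + p.1) / (L : ℝ) ^ n, ((j : ℝ) + p.2) / (L : ℝ) ^ n) := by
  have hLr : (L : ℝ) ≠ 0 := by exact_mod_cast hL.ne'
  induction n with
  | zero => rintro i j ⟨rfl, rfl⟩; exact ⟨fun k => k.elim0, fun p => by simp [PsiW_zero]⟩
  | succ n ih =>
    rintro _ _ ⟨a, ha, i, j, hc, rfl, rfl⟩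
    obtain ⟨w, hw⟩ := ih i j hc
    refine ⟨Fin.cons ⟨a, ha⟩ w, fun p => ?_⟩
    rw [PsiW_cons, Function.comp, hw]
    simp only [Psi]
    ext
    · push_cast; field_simp; ring
    · push_cast; field_simp; ring

lemma PsiW_inj0 (h : GoodCarpet L A) (n : ℕ) : ∀ w w' : Word A n,
    PsiW L w (0, 0) = PsiW L w' (0, 0) → w = w' := by
  have hL : 0 < L := by have := h.three_le; omega
  have hLr : (L : ℝ) ≠ 0 := by exact_mod_cast hL.ne'
  induction n with
  | zero => intro w w' _; exact Subsingleton.elim _ _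
  | succ n ih =>
    intro w w' hw
    obtain ⟨i, j, hc, hp⟩ := PsiW_cell hL n (Fin.tail w)
    obtain ⟨i', j', hc', hp'⟩ := PsiW_cell hL n (Fin.tail w')
    have e := PsiW_cons (L := L) (w 0) (Fin.tail w)
    have e' := PsiW_cons (L := L) (w' 0) (Fin.tail w')
    rw [Fin.cons_self_tail] at e e'
    rw [e, e', Function.comp, Function.comp, hp, hp'] at hw
    simp only [Psi, add_zero, Prod.mk.injEq] at hw
    have b := isCell_bounds h.mem_lt n i j hc
    have b' := isCell_bounds h.mem_lt n i' j' hc'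
    have key : ∀ (a a' : ℕ) (i i' : ℤ), ((i : ℝ) / (L : ℝ) ^ n + a) / L = ((i' : ℝ) / (L : ℝ) ^ n + a') / L →
        0 ≤ i → i + 1 ≤ (L : ℤ) ^ n → 0 ≤ i' → i' + 1 ≤ (L : ℤ) ^ n → a = a' ∧ i = i' := by
      intro a a' i i' hh h1 h2 h3 h4
      field_simp at hh
      have hh2 : (i : ℤ) + (L : ℤ) ^ n * a = i' + (L : ℤ) ^ n * a' := by exact_mod_cast hh
      have d1 := divmod_lt (N := (L : ℤ) ^ n) (a : ℤ) i h1 (by omega)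
      have d2 := divmod_lt (N := (L : ℤ) ^ n) (a' : ℤ) i' h3 (by omega)
      have e3 : (a : ℤ) * (L : ℤ) ^ n + i = a' * (L : ℤ) ^ n + i' := by linarith
      rw [e3] at d1
      constructor
      · exact_mod_cast d1.1.symm.trans d2.1
      · exact d1.2.symm.trans d2.2
    have k1 := key _ _ _ _ hw.1 b.1 b.2.1 b'.1 b'.2.1
    have k2 := key _ _ _ _ hw.2 b.2.2.1 b.2.2.2 b'.2.2.1 b'.2.2.2
    have ht : Fin.tail w = Fin.tail w' := ih _ _ (by rw [hp, hp', k1.2, k2.2])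
    have h0 : w 0 = w' 0 := Subtype.ext (Prod.ext k1.1 k2.1)
    rw [← Fin.cons_self_tail w, ← Fin.cons_self_tail w', ht, h0]

lemma PsiW_inj (h : GoodCarpet L A) (n : ℕ) (p : ℝ × ℝ) (w w' : Word A n)
    (hw : PsiW L w p = PsiW L w' p) : w = w' := by
  have hL : 0 < L := by have := h.three_le; omega
  have hLr : (L : ℝ) ^ n ≠ 0 := by positivity
  obtain ⟨i, j, hc, hp⟩ := PsiW_cell hL n w
  obtain ⟨i', j', hc', hp'⟩ := PsiW_cell hL n w'
  apply PsiW_inj0 h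
  rw [hp, hp', Prod.mk.injEq, div_left_inj' hLr, div_left_inj' hLr] at *
  constructor
  · linarith [hw.1]
  · linarith [hw.2]

/-- ordered pairs of neighbouring corners -/
noncomputable def OP : Finset ((ℝ × ℝ) × (ℝ × ℝ)) :=
  {((0, 0), (1, 0)), ((1, 0), (1, 1)), ((1, 1), (0, 1)), ((0, 1), (0, 0)),
   ((1, 0), (0, 0)), ((1, 1), (1, 0)), ((0, 1), (1, 1)), ((0, 0), (0, 1))}

lemma OP_sum (φ : (ℝ × ℝ) → ℝ) : ∑ z ∈ OP, (φ z.1 - φ z.2) ^ 2 = 2 * Q0 (disc L 0 φ) := by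
  unfold OP
  rw [Finset.sum_insert (by norm_num), Finset.sum_insert (by norm_num), Finset.sum_insert (by norm_num),
    Finset.sum_insert (by norm_num), Finset.sum_insert (by norm_num), Finset.sum_insert (by norm_num),
    Finset.sum_insert (by norm_num), Finset.sum_singleton]
  simp only [Q0, disc, Int.cast_zero, Int.cast_one, pow_zero, div_one]
  ring

lemma mem_OP (p q : ℝ × ℝ) (hp : p ∈ V0) (hq : q ∈ V0) (hpq : eudist p q = 1) : (p, q) ∈ OP := by
  simp only [V0, Finset.mem_insert, Finset.mem_singleton] at hp hq
  rcases hp with rfl | rfl | rfl | rfl <;> rcases hq with rfl | rfl | rfl | rfl <;>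
    first
    | (simp [OP]; done)
    | (exfalso; simp [eudist] at hpq; done)

lemma OP_mem (z : (ℝ × ℝ) × (ℝ × ℝ)) (hz : z ∈ OP) : z.1 ∈ V0 ∧ z.2 ∈ V0 ∧ eudist z.1 z.2 = 1 := by
  simp only [OP, Finset.mem_insert, Finset.mem_singleton] at hz
  rcases hz with rfl | rfl | rfl | rfl | rfl | rfl | rfl | rfl <;> simp [V0, eudist]

lemma Dform_eq (n : ℕ) (f : ℝ × ℝ → ℝ) : Dform L A n f =
    (1 / 2) * ∑ z ∈ (VN L A n ×ˢ VN L A n).filter (fun z => Adj L A n z.1 z.2), (f z.1 - f z.2) ^ 2 := by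
  unfold Dform
  rw [Finset.sum_filter, Finset.sum_product]

lemma Dform_le (hL : 0 < L) (n : ℕ) (f : ℝ × ℝ → ℝ) : Dform L A n f ≤ QQ L A n (disc L n f) := by
  rw [Dform_eq, QQ_words hL]
  have h1 : (VN L A n ×ˢ VN L A n).filter (fun z => Adj L A n z.1 z.2) ⊆
      ((Finset.univ : Finset (Word A n)) ×ˢ OP).image
        (fun y => (PsiW L y.1 y.2.1, PsiW L y.1 y.2.2)) := by
    rintro ⟨x, y⟩ hz
    rw [Finset.mem_filter] at hz
    obtain ⟨w, p, hp, q, hq, hpq, hx, hy⟩ := hz.2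
    rw [Finset.mem_image]
    exact ⟨(w, (p, q)), Finset.mem_product.2 ⟨Finset.mem_univ _, mem_OP p q hp hq hpq⟩, by
      simp only [Prod.mk.injEq]; exact ⟨hx.symm, hy.symm⟩⟩
  have h2 := Finset.sum_le_sum_of_subset_of_nonneg (f := fun z : (ℝ × ℝ) × (ℝ × ℝ) => (f z.1 - f z.2) ^ 2)
    h1 (fun z _ _ => sq_nonneg _)
  have h3 := Finset.sum_image_le_of_nonneg (s := (Finset.univ : Finset (Word A n)) ×ˢ OP)
    (g := (fun y => (PsiW L y.1 y.2.1, PsiW L y.1 y.2.2)))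
    (f := fun z : (ℝ × ℝ) × (ℝ × ℝ) => (f z.1 - f z.2) ^ 2) (fun z _ => sq_nonneg _)
  rw [Finset.sum_product] at h3
  have h4 : ∀ w : Word A n, ∑ y ∈ OP, (f (PsiW L w y.1) - f (PsiW L w y.2)) ^ 2 =
      2 * Q0 (disc L 0 (f ∘ PsiW L w)) := fun w => OP_sum (f ∘ PsiW L w)
  simp only [h4, ← Finset.mul_sum] at h3
  linarith

lemma le_Dform (h : GoodCarpet L A) (n : ℕ) (f : ℝ × ℝ → ℝ) :
    QQ L A n (disc L n f) ≤ 8 * Dform L A n f := by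
  have hL : 0 < L := by have := h.three_le; omega
  rw [Dform_eq, QQ_words hL]
  set T := (VN L A n ×ˢ VN L A n).filter (fun z => Adj L A n z.1 z.2) with hT
  have h4 : ∀ w : Word A n, ∑ y ∈ OP, (f (PsiW L w y.1) - f (PsiW L w y.2)) ^ 2 =
      2 * Q0 (disc L 0 (f ∘ PsiW L w)) := fun w => OP_sum (f ∘ PsiW L w)
  have h5 : ∀ y ∈ OP, ∑ w : Word A n, (f (PsiW L w y.1) - f (PsiW L w y.2)) ^ 2 ≤
      ∑ z ∈ T, (f z.1 - f z.2) ^ 2 := by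
    intro y hy
    obtain ⟨y1, y2, y3⟩ := OP_mem y hy
    rw [← Finset.sum_image (s := Finset.univ) (g := fun w : Word A n => (PsiW L w y.1, PsiW L w y.2))
      (f := fun z : (ℝ × ℝ) × (ℝ × ℝ) => (f z.1 - f z.2) ^ 2)]
    · apply Finset.sum_le_sum_of_subset_of_nonneg
      · intro z hz
        rw [Finset.mem_image] at hz
        obtain ⟨w, _, rfl⟩ := hz
        rw [hT, Finset.mem_filter, Finset.mem_product]
        refine ⟨⟨?_, ?_⟩, w, y.1, y1, y.2, y2, y3, rfl, rfl⟩
        · exact Finset.mem_biUnion.2 ⟨w, Finset.mem_univ _, Finset.mem_image_of_mem _ y1⟩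
        · exact Finset.mem_biUnion.2 ⟨w, Finset.mem_univ _, Finset.mem_image_of_mem _ y2⟩
      · intro z _ _; exact sq_nonneg _
    · intro w _ w' _ hw
      simp only [Prod.mk.injEq] at hw
      exact PsiW_inj h n _ _ _ hw.1
  have h6 := Finset.sum_le_sum h5
  rw [Finset.sum_comm] at h6
  simp only [h4, ← Finset.mul_sum, Finset.sum_const, nsmul_eq_mul] at h6
  have h7 : (#OP : ℝ) ≤ 8 := by
    have : #OP ≤ 8 :=
      (Finset.card_insert_le _ _).trans (Nat.succ_le_succ ((Finset.card_insert_le _ _).trans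
        (Nat.succ_le_succ Finset.card_le_six)))
    exact_mod_cast this
  have h8 : 0 ≤ ∑ z ∈ T, (f z.1 - f z.2) ^ 2 := Finset.sum_nonneg fun z _ => sq_nonneg _
  nlinarith

lemma RR_bounds (h : GoodCarpet L A) : ∃ C ≥ 1, ∀ n, 1 ≤ RR L A n * sig L A n ∧
    RR L A n * sig L A n ≤ C := by
  obtain ⟨C, hC0, hC⟩ := corner h
  have hL : 0 < L := by have := h.three_le; omega
  refine ⟨8 * C + 1, by linarith, fun n => ?_⟩
  have hs := sig_pos h n
  have hLr : (L : ℝ) ^ n ≠ 0 := by positivity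
  set S : Set ℝ := {e : ℝ | ∃ f : ℝ × ℝ → ℝ, (∀ x ∈ ({((0 : ℝ), (0 : ℝ))} : Set (ℝ × ℝ)), f x = 1) ∧
    (∀ x ∈ ({((1 : ℝ), (0 : ℝ))} : Set (ℝ × ℝ)), f x = 0) ∧ e = Dform L A n f} with hS
  have hRR : RR L A n = (sInf S)⁻¹ := rfl
  have lb : ∀ e ∈ S, sig L A n / (8 * C) ≤ e := by
    rintro e ⟨f, f0, f1, rfl⟩
    have f0 := f0 _ rfl
    have f1 := f1 _ rfl
    have h1 := hC n (disc L n f)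
    have h2 := le_Dform h n f
    have e1 : disc L n f 0 0 = 1 := by simp [disc, f0]
    have e2 : disc L n f ((L : ℤ) ^ n) 0 = 0 := by
      simp only [disc]; push_cast; rw [div_self hLr]; simp [f1]
    rw [e1, e2] at h1
    rw [div_le_iff₀ (by positivity)]
    nlinarith
  have ub : ∀ g, Adm ((L : ℤ) ^ n) g → ∃ e ∈ S, e ≤ QQ L A n g := by
    intro g hg
    refine ⟨_, ⟨fun x => 1 - g (round ((L : ℝ) ^ n * x.1)) (round ((L : ℝ) ^ n * x.2)), ?_, ?_, rfl⟩, ?_⟩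
    · rintro x rfl
      simp only [mul_zero, round_zero]
      rw [hg.1 0 le_rfl (Lpow_pos hL n).le]; ring
    · rintro x rfl
      simp only [mul_zero, round_zero, mul_one]
      have : round ((L : ℝ) ^ n) = (L : ℤ) ^ n := by
        rw [← Nat.cast_pow, round_natCast]; push_cast; rfl
      rw [this, hg.2 0 le_rfl (Lpow_pos hL n).le]; ring
    · refine (Dform_le hL n _).trans (le_of_eq ?_)
      have h3 := QQ_affine (L := L) (A := A) n (-1) 1 g
      rw [show (-1 : ℝ) ^ 2 = 1 by norm_num, one_mul] at h3
      rw [← h3]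
      congr 1
      funext i j
      simp only [disc]
      rw [mul_div_cancel₀ _ hLr, mul_div_cancel₀ _ hLr, round_intCast, round_intCast]
      ring
  have bdd : BddBelow S := ⟨_, lb⟩
  have hup : sInf S ≤ sig L A n := by
    apply le_sig hL
    intro g hg
    obtain ⟨e, he, he2⟩ := ub g hg
    exact (csInf_le bdd he).trans he2
  have hne : S.Nonempty := by
    obtain ⟨g, hg, _⟩ := exists_good h n
    obtain ⟨e, he, _⟩ := ub g hg.1
    exact ⟨e, he⟩
  have hlo : sig L A n / (8 * C) ≤ sInf S := le_csInf hne lb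
  have hpos : 0 < sInf S := lt_of_lt_of_le (by positivity) hlo
  rw [hRR, inv_mul_eq_div, le_div_iff₀ hpos, div_le_iff₀ hpos]
  rw [div_le_iff₀ (by positivity)] at hlo
  constructor
  · linarith
  · nlinarith

/-- the level-`n` approximation of the carpet -/
def InC (L : ℕ) (A : Finset (ℕ × ℕ)) (n : ℕ) (x : ℝ × ℝ) : Prop :=
  ∃ i j : ℤ, IsCell L A n i j ∧ ((i : ℝ) ≤ (L : ℝ) ^ n * x.1 ∧ (L : ℝ) ^ n * x.1 ≤ i + 1) ∧
    ((j : ℝ) ≤ (L : ℝ) ^ n * x.2 ∧ (L : ℝ) ^ n * x.2 ≤ j + 1)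

lemma mem_F_iff (hL : 0 < L) (x : ℝ × ℝ) : x ∈ carpetF L A ↔ ∀ n, InC L A n x := by
  unfold carpetF
  rw [Set.mem_iInter]
  apply forall_congr'
  intro n
  have hLr : (0 : ℝ) < (L : ℝ) ^ n := by positivity
  rw [Set.mem_iUnion]
  constructor
  · rintro ⟨w, p, hp, rfl⟩
    obtain ⟨i, j, hc, he⟩ := PsiW_cell hL n w
    refine ⟨i, j, hc, ?_⟩
    rw [he]
    simp only [Set.mem_Icc, Prod.le_def] at hp
    rw [mul_div_cancel₀ _ hLr.ne', mul_div_cancel₀ _ hLr.ne']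
    refine ⟨⟨?_, ?_⟩, ?_, ?_⟩ <;> linarith [hp.1.1, hp.1.2, hp.2.1, hp.2.2]
  · rintro ⟨i, j, hc, h1, h2⟩
    obtain ⟨w, hw⟩ := cell_PsiW hL n i j hc
    refine ⟨w, ((L : ℝ) ^ n * x.1 - i, (L : ℝ) ^ n * x.2 - j), ?_, ?_⟩
    · simp only [Set.mem_Icc, Prod.le_def]
      refine ⟨⟨?_, ?_⟩, ?_, ?_⟩ <;> linarith [h1.1, h1.2, h2.1, h2.2]
    · rw [hw]
      ext
      · simp only; field_simp; ring
      · simp only; field_simp; ring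

lemma InC_nested (h : GoodCarpet L A) (m k : ℕ) (x : ℝ × ℝ) (hx : InC L A (m + k) x) : InC L A m x := by
  have hL : 0 < L := by have := h.three_le; omega
  obtain ⟨i, j, hc, h1, h2⟩ := hx
  obtain ⟨i1, j1, i2, j2, c1, c2, rfl, rfl⟩ := isCell_decomp m k i j hc
  have b := isCell_bounds h.mem_lt k i2 j2 c2
  have hk : (0 : ℝ) < (L : ℝ) ^ k := by positivity
  have b1 : (0 : ℝ) ≤ i2 := by exact_mod_cast b.1
  have b2 : (i2 : ℝ) + 1 ≤ (L : ℝ) ^ k := by exact_mod_cast b.2.1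
  have b3 : (0 : ℝ) ≤ j2 := by exact_mod_cast b.2.2.1
  have b4 : (j2 : ℝ) + 1 ≤ (L : ℝ) ^ k := by exact_mod_cast b.2.2.2
  push_cast at h1 h2
  rw [pow_add] at h1 h2
  refine ⟨i1, j1, c1, ⟨?_, ?_⟩, ?_, ?_⟩ <;> refine le_of_mul_le_mul_right ?_ hk <;>
    nlinarith [h1.1, h1.2, h2.1, h2.2]

lemma mem_F_of_large (h : GoodCarpet L A) (n : ℕ) (x : ℝ × ℝ) (hx : ∀ k, InC L A (n + k) x) :
    x ∈ carpetF L A := by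
  have hL : 0 < L := by have := h.three_le; omega
  rw [mem_F_iff hL]
  intro m
  have := hx m
  rw [add_comm] at this
  exact InC_nested h m n x this

lemma vert_mem_F (h : GoodCarpet L A) (n : ℕ) (x y : ℤ) (hv : IsVert L A n x y) :
    ((x : ℝ) / (L : ℝ) ^ n, (y : ℝ) / (L : ℝ) ^ n) ∈ carpetF L A := by
  have hL : 0 < L := by have := h.three_le; omega
  have hLr : (0 : ℝ) < (L : ℝ) ^ n := by positivity
  apply mem_F_of_large h n
  intro k
  obtain ⟨i, j, hc, h1, h2⟩ := hv
  obtain ⟨i', j', hc', h1', h2'⟩ := isVert_corners h k ((x - i) * (L : ℤ) ^ k) ((y - j) * (L : ℤ) ^ k)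
    (by rcases (by omega : x - i = 0 ∨ x - i = 1) with e | e <;> simp [e])
    (by rcases (by omega : y - j = 0 ∨ y - j = 1) with e | e <;> simp [e])
  refine ⟨_, _, isCell_comp n k i j i' j' hc hc', ?_⟩
  have e : ∀ z : ℝ, (L : ℝ) ^ (n + k) * (z / (L : ℝ) ^ n) = z * (L : ℝ) ^ k := by
    intro z; rw [pow_add]; field_simp
  simp only [e]
  have g1 : i * (L : ℤ) ^ k + i' ≤ x * (L : ℤ) ^ k := by nlinarith
  have g2 : x * (L : ℤ) ^ k ≤ i * (L : ℤ) ^ k + i' + 1 := by nlinarith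
  have g3 : j * (L : ℤ) ^ k + j' ≤ y * (L : ℤ) ^ k := by nlinarith
  have g4 : y * (L : ℤ) ^ k ≤ j * (L : ℤ) ^ k + j' + 1 := by nlinarith
  exact_mod_cast And.intro (And.intro g1 g2) (And.intro g3 g4)

lemma Psi_mem_F (h : GoodCarpet L A) (a : ℕ × ℕ) (ha : a ∈ A) (x : ℝ × ℝ) (hx : x ∈ carpetF L A) :
    Psi L a x ∈ carpetF L A := by
  have hL : 0 < L := by have := h.three_le; omega
  have hLr : (L : ℝ) ≠ 0 := by exact_mod_cast hL.ne'
  rw [mem_F_iff hL] at hx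
  apply mem_F_of_large h 1
  intro k
  obtain ⟨i, j, hc, h1, h2⟩ := hx k
  rw [add_comm 1 k]
  refine ⟨_, _, ⟨a, ha, i, j, hc, rfl, rfl⟩, ?_⟩
  have e : ∀ z w : ℝ, (L : ℝ) ^ (k + 1) * ((z + w) / L) = w * (L : ℝ) ^ k + (L : ℝ) ^ k * z := by
    intro z w; rw [pow_succ]; field_simp; ring
  simp only [Psi, e]
  push_cast
  refine ⟨⟨?_, ?_⟩, ?_, ?_⟩ <;> linarith [h1.1, h1.2, h2.1, h2.2]

lemma isCompact_F (hL : 0 < L) : IsCompact (carpetF L A) := by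
  have hc : ∀ n, IsCompact (⋃ w : Word A n, PsiW L w '' Set.Icc (((0 : ℝ), (0 : ℝ)) : ℝ × ℝ) ((1 : ℝ), (1 : ℝ))) := by
    intro n
    apply isCompact_iUnion
    intro w
    apply isCompact_Icc.image
    obtain ⟨i, j, _, he⟩ := PsiW_cell hL n w
    rw [show PsiW L w = _ from funext he]
    fun_prop
  unfold carpetF
  exact IsCompact.of_isClosed_subset (hc 0) (isClosed_iInter fun n => (hc n).isClosed)
    (Set.iInter_subset _ 0)





/-! ### Banach limits -/

/-- bounded sequences -/
def Bdd (u : ℕ → ℝ) : Prop := ∃ B, ∀ n, |u n| ≤ B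

/-- ultrafilter limit -/
noncomputable def ulim (u : ℕ → ℝ) : ℝ := Filter.limUnder (Filter.hyperfilter ℕ : Filter ℕ) u

lemma ulim_tendsto {u : ℕ → ℝ} (hu : Bdd u) :
    Filter.Tendsto u (Filter.hyperfilter ℕ : Filter ℕ) (nhds (ulim u)) := by
  obtain ⟨B, hB⟩ := hu
  apply tendsto_nhds_limUnder
  have hc : IsCompact (Set.Icc (-B) B) := isCompact_Icc
  obtain ⟨x, _, hx⟩ := hc.ultrafilter_le_nhds ((Filter.hyperfilter ℕ).map u) (by
    rw [Filter.le_principal_iff]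
    apply Filter.mem_map.2
    apply Filter.univ_mem'
    intro n
    exact abs_le.1 (hB n))
  exact ⟨x, hx⟩

lemma ulim_eq {u : ℕ → ℝ} {x : ℝ}
    (hu : Filter.Tendsto u (Filter.hyperfilter ℕ : Filter ℕ) (nhds x)) : ulim u = x := hu.limUnder_eq

/-- Cesaro averages -/
noncomputable def ces (u : ℕ → ℝ) (n : ℕ) : ℝ := (∑ k ∈ Finset.range n, u k) / n

/-- Banach limit -/
noncomputable def blim (u : ℕ → ℝ) : ℝ := ulim (ces u)

lemma ces_bdd {u : ℕ → ℝ} (hu : Bdd u) : Bdd (ces u) := by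
  obtain ⟨B, hB⟩ := hu
  have hB0 : 0 ≤ B := (abs_nonneg _).trans (hB 0)
  refine ⟨B, fun n => ?_⟩
  unfold ces
  rcases Nat.eq_zero_or_pos n with rfl | hn
  · simpa using hB0
  · have hn' : (0 : ℝ) < n := by exact_mod_cast hn
    rw [abs_div, abs_of_pos hn', div_le_iff₀ hn']
    refine (Finset.abs_sum_le_sum_abs _ _).trans ?_
    refine (Finset.sum_le_sum (fun k _ => hB k)).trans ?_
    simp [mul_comm]

lemma blim_tendsto {u : ℕ → ℝ} (hu : Bdd u) :
    Filter.Tendsto (ces u) (Filter.hyperfilter ℕ : Filter ℕ) (nhds (blim u)) := ulim_tendsto (ces_bdd hu)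

lemma blim_add {u v : ℕ → ℝ} (hu : Bdd u) (hv : Bdd v) :
    blim (fun n => u n + v n) = blim u + blim v := by
  apply ulim_eq
  refine ((blim_tendsto hu).add (blim_tendsto hv)).congr (fun n => ?_)
  simp only [ces, Finset.sum_add_distrib, add_div]

lemma blim_smul (c : ℝ) {u : ℕ → ℝ} (hu : Bdd u) : blim (fun n => c * u n) = c * blim u := by
  apply ulim_eq
  refine ((blim_tendsto hu).const_mul c).congr (fun n => ?_)
  simp only [ces, ← Finset.mul_sum, mul_div_assoc]

lemma blim_mono {u v : ℕ → ℝ} (hu : Bdd u) (hv : Bdd v) (huv : ∀ n, u n ≤ v n) : blim u ≤ blim v := by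
  refine le_of_tendsto_of_tendsto' (blim_tendsto hu) (blim_tendsto hv) (fun n => ?_)
  unfold ces
  gcongr
  exact huv _

lemma blim_const (c : ℝ) : blim (fun _ => c) = c := by
  apply ulim_eq
  apply tendsto_const_nhds.congr'
  have : ∀ᶠ n : ℕ in (Filter.hyperfilter ℕ : Filter ℕ), 1 ≤ n :=
    Nat.hyperfilter_le_atTop (Filter.eventually_ge_atTop 1)
  filter_upwards [this] with n hn
  have hn' : (n : ℝ) ≠ 0 := by positivity
  simp [ces, hn']

lemma Bdd_const (c : ℝ) : Bdd (fun _ => c) := ⟨|c|, fun _ => le_rfl⟩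

lemma Bdd_shift {u : ℕ → ℝ} (hu : Bdd u) (N : ℕ) : Bdd (fun n => u (n + N)) := by
  obtain ⟨B, hB⟩ := hu
  exact ⟨B, fun n => hB _⟩

lemma blim_succ {u : ℕ → ℝ} (hu : Bdd u) : blim (fun n => u (n + 1)) = blim u := by
  apply ulim_eq
  obtain ⟨B, hB⟩ := hu
  have hu : Bdd u := ⟨B, hB⟩
  have h0 : Filter.Tendsto (fun n : ℕ => (u n - u 0) / n) Filter.atTop (nhds 0) := by
    refine squeeze_zero_norm (a := fun n : ℕ => (2 * B) / n) (fun n => ?_)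
      (tendsto_const_div_atTop_nhds_zero_nat _)
    rw [Real.norm_eq_abs, abs_div, Nat.abs_cast]
    gcongr
    have := abs_sub (u n) (u 0)
    linarith [hB n, hB 0]
  have h1 := (blim_tendsto hu).add (h0.mono_left Nat.hyperfilter_le_atTop)
  rw [add_zero] at h1
  refine h1.congr (fun n => ?_)
  simp only [ces]
  rw [← add_div]
  congr 1
  have e1 := Finset.sum_range_succ u n
  have e2 := Finset.sum_range_succ' u n
  linarith

lemma blim_shift {u : ℕ → ℝ} (hu : Bdd u) (N : ℕ) : blim (fun n => u (n + N)) = blim u := by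
  induction N with
  | zero => rfl
  | succ N ih =>
    rw [← ih, ← blim_succ (Bdd_shift hu N)]
    congr 1
    funext n
    congr 1
    ring

lemma blim_le {u : ℕ → ℝ} (hu : Bdd u) (c : ℝ) (hc : ∀ n, u n ≤ c) : blim u ≤ c := by
  have := blim_mono hu (Bdd_const c) hc
  rwa [blim_const] at this

lemma le_blim {u : ℕ → ℝ} (hu : Bdd u) (N : ℕ) (c : ℝ) (hc : ∀ n, N ≤ n → c ≤ u n) : c ≤ blim u := by
  rw [← blim_shift hu N]
  have := blim_mono (Bdd_const c) (Bdd_shift hu N) (fun n => hc _ (by omega))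
  rwa [blim_const] at this

lemma blim_congr {u v : ℕ → ℝ} (hu : Bdd u) (hv : Bdd v) (N : ℕ) (huv : ∀ n, N ≤ n → u n = v n) :
    blim u = blim v := by
  rw [← blim_shift hu N, ← blim_shift hv N]
  congr 1
  funext n
  exact huv _ (by omega)

lemma Bdd_sum {ι : Type*} (s : Finset ι) (u : ι → ℕ → ℝ) (hu : ∀ a ∈ s, Bdd (u a)) :
    Bdd (fun n => ∑ a ∈ s, u a n) := by
  choose! B hB using hu
  refine ⟨∑ a ∈ s, B a, fun n => ?_⟩
  exact (Finset.abs_sum_le_sum_abs _ _).trans (Finset.sum_le_sum fun a ha => hB a ha n)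

lemma blim_sum {ι : Type*} (s : Finset ι) (u : ι → ℕ → ℝ) (hu : ∀ a ∈ s, Bdd (u a)) :
    blim (fun n => ∑ a ∈ s, u a n) = ∑ a ∈ s, blim (u a) := by
  induction s using Finset.induction_on with
  | empty => simpa using blim_const 0
  | insert a s ha ih =>
    rw [Finset.sum_insert ha, ← ih (fun b hb => hu b (Finset.mem_insert_of_mem hb)),
      ← blim_add (hu a (Finset.mem_insert_self _ _))
        (Bdd_sum s u fun b hb => hu b (Finset.mem_insert_of_mem hb))]
    congr 1
    funext n
    rw [Finset.sum_insert ha]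

/-! ### constants -/

/-- renormalised energies -/
noncomputable def qq (L : ℕ) (A : Finset (ℕ × ℕ)) (r : ℝ) (f : ℝ × ℝ → ℝ) (n : ℕ) : ℝ :=
  r ^ n * QQ L A n (disc L n f)

lemma consts (h : GoodCarpet L A) : ∃ r c : ℝ, 1 < r ∧ 1 ≤ c ∧
    (∀ n, c⁻¹ ≤ sig L A n * r ^ n ∧ sig L A n * r ^ n ≤ c) ∧
    (∀ n, c⁻¹ * r ^ n ≤ RR L A n ∧ RR L A n ≤ c * r ^ n) ∧
    (∀ f n, qq L A r f n ≤ c * (RR L A n * Dform L A n f)) ∧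
    (∀ f n, RR L A n * Dform L A n f ≤ c * qq L A r f n) ∧
    (∀ m k (f : ℤ → ℤ → ℝ), r ^ m * QQ L A m (fun i j => f (i * (L : ℤ) ^ k) (j * (L : ℤ) ^ k)) ≤
      c * (r ^ (m + k) * QQ L A (m + k) f)) ∧
    (∀ n (f : ℤ → ℤ → ℝ) (x y : ℤ), IsVert L A n x y →
      (f x y - f 0 0) ^ 2 ≤ c * (r ^ n * QQ L A n f)) := by
  obtain ⟨r, hr, c1, hc1, hg⟩ := sig_growth h
  obtain ⟨C, hC1, hR⟩ := RR_bounds h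
  obtain ⟨D, hD0, hD⟩ := weak_mono h
  obtain ⟨O, hO0, hO⟩ := oscillation h
  have hL : 0 < L := by have := h.three_le; omega
  have hr0 : 0 < r := by linarith
  have hc0 : 0 < c1 := by linarith
  have hrp : ∀ n, 0 < r ^ n := fun n => by positivity
  have hs := sig_pos h
  set c : ℝ := 8 * c1 * C + c1 * D + c1 * O with hc
  have hC0 : 0 < C := by linarith
  have p1 : 0 < c1 * C := by positivity
  have p2 : 0 < c1 * D := by positivity
  have p3 : 0 < c1 * O := by positivity
  have q1 : c1 ≤ c1 * C := by nlinarith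
  have hcc1 : c1 ≤ c := by linarith
  have hcC : c1 * C ≤ c := by linarith
  have hc0' : 0 < c := by linarith
  -- basic comparisons
  have g1 : ∀ n, 1 ≤ c1 * (sig L A n * r ^ n) := by
    intro n
    have := (hg n).1
    rwa [inv_le_iff_one_le_mul₀' hc0] at this
  have R1 : ∀ n, r ^ n ≤ c1 * RR L A n := by
    intro n
    have h1 := (hR n).1
    have h2 := (hg n).2
    have h3 := hrp n
    have h4 := hs n
    have h5 : 0 < RR L A n := by
      by_contra! hn
      have := mul_nonpos_of_nonpos_of_nonneg hn h4.le
      linarith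
    calc r ^ n ≤ (RR L A n * sig L A n) * r ^ n := by nlinarith
      _ = RR L A n * (sig L A n * r ^ n) := by ring
      _ ≤ RR L A n * c1 := by gcongr
      _ = _ := by ring
  have R2 : ∀ n, RR L A n ≤ c1 * C * r ^ n := by
    intro n
    have h1 := (hR n).2
    have h2 := g1 n
    have h3 := hrp n
    have h4 := hs n
    have h5 : 0 < RR L A n := by
      have := R1 n
      by_contra! hn
      nlinarith
    calc RR L A n ≤ RR L A n * (c1 * (sig L A n * r ^ n)) := by nlinarith
      _ = c1 * (RR L A n * sig L A n) * r ^ n := by ring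
      _ ≤ c1 * C * r ^ n := by gcongr
  have R0 : ∀ n, 0 < RR L A n := by
    intro n
    have := R1 n
    have h3 := hrp n
    by_contra! hn
    nlinarith
  have inv_s : ∀ n, ∀ x y B : ℝ, 0 ≤ B → x * sig L A n ≤ B * y → 0 ≤ x → x ≤ c1 * B * (r ^ n * y) := by
    intro n x y B hB hxy hx
    have h1 := g1 n
    have h3 := hrp n
    calc x ≤ x * (c1 * (sig L A n * r ^ n)) := by nlinarith
      _ = c1 * r ^ n * (x * sig L A n) := by ring
      _ ≤ c1 * r ^ n * (B * y) := by gcongr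
      _ = _ := by ring
  refine ⟨r, c, hr, by linarith, fun n => ⟨?_, ?_⟩, fun n => ⟨?_, ?_⟩, ?_, ?_, ?_, ?_⟩
  · exact (inv_anti₀ hc0 hcc1).trans (hg n).1
  · exact (hg n).2.trans hcc1
  · rw [inv_mul_le_iff₀ hc0']
    have := R1 n
    have := R0 n
    nlinarith
  · refine (R2 n).trans ?_
    have := hrp n
    gcongr
  · intro f n
    have h1 := le_Dform h n f
    have h2 := R1 n
    have h3 := QQ_nonneg (L := L) (A := A) n (disc L n f)
    have h4 := R0 n
    have h5 : 0 ≤ Dform L A n f := by linarith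
    unfold qq
    calc _ ≤ (c1 * RR L A n) * (8 * Dform L A n f) := by
          have := hrp n
          gcongr
      _ = (8 * c1) * (RR L A n * Dform L A n f) := by ring
      _ ≤ _ := by
          gcongr
          nlinarith
  · intro f n
    have h1 := Dform_le (A := A) hL n f
    have h2 := R2 n
    have h3 := QQ_nonneg (L := L) (A := A) n (disc L n f)
    have h5 := le_Dform h n f
    have h4 : 0 ≤ Dform L A n f := by linarith
    have h6 := hrp n
    unfold qq
    calc _ ≤ (c1 * C * r ^ n) * QQ L A n (disc L n f) := by gcongr
      _ = c1 * C * (r ^ n * QQ L A n (disc L n f)) := by ring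
      _ ≤ _ := by gcongr
  · intro m k f
    have h1 := inv_s k _ _ D hD0.le (hD m k f) (QQ_nonneg _ _)
    have h2 := hrp m
    have h3 := QQ_nonneg (L := L) (A := A) (m + k) f
    have h4 := hrp (m + k)
    calc _ ≤ r ^ m * (c1 * D * (r ^ k * QQ L A (m + k) f)) := by gcongr
      _ = c1 * D * (r ^ (m + k) * QQ L A (m + k) f) := by rw [pow_add]; ring
      _ ≤ _ := by
        gcongr
        linarith
  · intro n f x y hv
    have h1 := inv_s n _ _ O hO0.le (hO n f x y hv) (sq_nonneg _)
    have h3 := QQ_nonneg (L := L) (A := A) n f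
    have h4 := hrp n
    refine h1.trans ?_
    gcongr
    linarith





/-! ### Density of the domain -/

lemma QQ_tendsto {ι : Type*} {l : Filter ι} (n : ℕ) :
    ∀ (u : ι → ℤ → ℤ → ℝ) (v : ℤ → ℤ → ℝ),
    (∀ x y, IsVert L A n x y → Filter.Tendsto (fun k => u k x y) l (nhds (v x y))) →
    Filter.Tendsto (fun k => QQ L A n (u k)) l (nhds (QQ L A n v)) := by
  induction n with
  | zero =>
    intro u v H
    have h00 := H 0 0 ⟨0, 0, ⟨rfl, rfl⟩, by norm_num, by norm_num⟩
    have h10 := H 1 0 ⟨0, 0, ⟨rfl, rfl⟩, by norm_num, by norm_num⟩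
    have h01 := H 0 1 ⟨0, 0, ⟨rfl, rfl⟩, by norm_num, by norm_num⟩
    have h11 := H 1 1 ⟨0, 0, ⟨rfl, rfl⟩, by norm_num, by norm_num⟩
    show Filter.Tendsto (fun k => Q0 (u k)) l (nhds (Q0 v))
    unfold Q0
    exact ((((h00.sub h10).pow 2).add ((h10.sub h11).pow 2)).add ((h11.sub h01).pow 2)).add
      ((h01.sub h00).pow 2)
  | succ n ih =>
    intro u v H
    simp only [QQ_succ]
    apply tendsto_finsetSum
    intro a ha
    apply ih
    rintro x y ⟨i, j, hc, hx, hy⟩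
    apply H
    exact ⟨_, _, ⟨a, ha, i, j, hc, rfl, rfl⟩, ⟨by linarith [hx.1], by linarith [hx.2]⟩,
      ⟨by linarith [hy.1], by linarith [hy.2]⟩⟩

/-- the floor point -/
noncomputable def fl (L n : ℕ) (x : ℝ) : ℤ := ⌊(L : ℝ) ^ n * x⌋

lemma fl_bounds (n : ℕ) (x : ℝ) (i : ℤ) (h1 : (i : ℝ) ≤ (L : ℝ) ^ n * x)
    (h2 : (L : ℝ) ^ n * x ≤ i + 1) : i ≤ fl L n x ∧ fl L n x ≤ i + 1 := by
  constructor
  · exact Int.le_floor.2 h1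
  · have := Int.floor_le ((L : ℝ) ^ n * x)
    have h3 : ((fl L n x : ℤ) : ℝ) ≤ ((i + 1 : ℤ) : ℝ) := by
      push_cast; exact this.trans h2
    exact_mod_cast h3

lemma fl_cell (p q : ℕ) (x : ℝ) (i : ℤ) (h1 : (i : ℝ) ≤ (L : ℝ) ^ p * x)
    (h2 : (L : ℝ) ^ p * x ≤ i + 1) : 0 ≤ fl L (p + q) x - i * (L : ℤ) ^ q ∧
      fl L (p + q) x - i * (L : ℤ) ^ q ≤ (L : ℤ) ^ q := by
  have hq : (0 : ℝ) ≤ (L : ℝ) ^ q := by positivity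
  constructor
  · have : i * (L : ℤ) ^ q ≤ fl L (p + q) x := by
      apply Int.le_floor.2
      push_cast
      rw [pow_add]
      nlinarith
    linarith
  · have := Int.floor_le ((L : ℝ) ^ (p + q) * x)
    have h3 : ((fl L (p + q) x : ℤ) : ℝ) ≤ (((i + 1) * (L : ℤ) ^ q : ℤ) : ℝ) := by
      push_cast; refine this.trans ?_
      rw [pow_add]
      nlinarith
    have h4 : fl L (p + q) x ≤ (i + 1) * (L : ℤ) ^ q := by exact_mod_cast h3
    linarith

lemma fl_vert (h : GoodCarpet L A) (p q : ℕ) (x : ℝ × ℝ) (hx : x ∈ carpetF L A) :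
    ∃ i j, IsCell L A p i j ∧ ((i : ℝ) ≤ (L : ℝ) ^ p * x.1 ∧ (L : ℝ) ^ p * x.1 ≤ i + 1) ∧
      ((j : ℝ) ≤ (L : ℝ) ^ p * x.2 ∧ (L : ℝ) ^ p * x.2 ≤ j + 1) ∧
      IsVert L A q (fl L (p + q) x.1 - i * (L : ℤ) ^ q) (fl L (p + q) x.2 - j * (L : ℤ) ^ q) := by
  have hL : 0 < L := by have := h.three_le; omega
  obtain ⟨i', j', hc, ⟨a1, a2⟩, b1, b2⟩ := (mem_F_iff hL x).1 hx (p + q)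
  obtain ⟨i1, j1, i2, j2, c1, c2, rfl, rfl⟩ := isCell_decomp p q i' j' hc
  obtain ⟨e1, e2, e3, e4⟩ := isCell_bounds h.mem_lt q i2 j2 c2
  have hq : (0 : ℝ) < (L : ℝ) ^ q := by positivity
  have f1 : (0 : ℝ) ≤ i2 := by exact_mod_cast e1
  have f2 : (i2 : ℝ) + 1 ≤ (L : ℝ) ^ q := by exact_mod_cast e2
  have f3 : (0 : ℝ) ≤ j2 := by exact_mod_cast e3
  have f4 : (j2 : ℝ) + 1 ≤ (L : ℝ) ^ q := by exact_mod_cast e4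
  have g1 := fl_bounds _ _ _ a1 a2
  have g2 := fl_bounds _ _ _ b1 b2
  push_cast at a1 a2 b1 b2
  rw [pow_add] at a1 a2 b1 b2
  refine ⟨i1, j1, c1, ⟨?_, ?_⟩, ⟨?_, ?_⟩, i2, j2, c2, ⟨by linarith [g1.1], by linarith [g1.2]⟩,
    ⟨by linarith [g2.1], by linarith [g2.2]⟩⟩
  · apply le_of_mul_le_mul_right _ hq; linarith
  · apply le_of_mul_le_mul_right _ hq; linarith
  · apply le_of_mul_le_mul_right _ hq; linarith
  · apply le_of_mul_le_mul_right _ hq; linarith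

/-- oscillation between two nearby points -/
lemma osc_near (h : GoodCarpet L A) (r c M : ℝ) (hr : 1 < r) (hc1 : 1 ≤ c)
    (hosc : ∀ (n : ℕ) (f : ℤ → ℤ → ℝ) (x y : ℤ),
      IsVert L A n x y → (f x y - f 0 0) ^ 2 ≤ c * (r ^ n * QQ L A n f))
    (p q : ℕ) (U : ℤ → ℤ → ℝ) (hM : r ^ (p + q) * QQ L A (p + q) U ≤ M)
    (x y : ℝ × ℝ) (hx : x ∈ carpetF L A) (hy : y ∈ carpetF L A)
    (h1 : |(L : ℝ) ^ p * x.1 - (L : ℝ) ^ p * y.1| < 1)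
    (h2 : |(L : ℝ) ^ p * x.2 - (L : ℝ) ^ p * y.2| < 1) :
    |U (fl L (p + q) x.1) (fl L (p + q) x.2) - U (fl L (p + q) y.1) (fl L (p + q) y.2)|
      ≤ 4 * Real.sqrt (c * M / r ^ p) := by
  set S := Real.sqrt (c * M / r ^ p) with hS
  have key : ∀ i j, IsCell L A p i j → ∀ X Y, IsVert L A q (X - i * (L : ℤ) ^ q)
      (Y - j * (L : ℤ) ^ q) → |U X Y - U (i * (L : ℤ) ^ q) (j * (L : ℤ) ^ q)| ≤ S := by
    intro i j hc X Y hv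
    apply Real.abs_le_sqrt
    have e1 := hosc q (sh (i * (L : ℤ) ^ q) (j * (L : ℤ) ^ q) U) _ _ hv
    simp only [sh, add_sub_cancel, add_zero] at e1
    have e2 := QQ_cell_le p q i j U hc
    have hrq : 0 < r ^ q := by positivity
    have hrp : 0 < r ^ p := by positivity
    rw [le_div_iff₀ hrp]
    have e3 : r ^ q * QQ L A q (sh (i * (L : ℤ) ^ q) (j * (L : ℤ) ^ q) U) * r ^ p ≤ M := by
      refine le_trans ?_ hM
      rw [pow_add]
      have := mul_le_mul_of_nonneg_left e2 (mul_pos hrp hrq).le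
      linarith
    have e4 := mul_le_mul_of_nonneg_right e1 hrp.le
    have e5 := mul_le_mul_of_nonneg_left e3 (by linarith : (0:ℝ) ≤ c)
    refine e4.trans (le_trans (le_of_eq ?_) e5)
    ring
  obtain ⟨i, j, hc, ⟨a1, a2⟩, ⟨a3, a4⟩, hv⟩ := fl_vert h p q x hx
  obtain ⟨i', j', hc', ⟨b1, b2⟩, ⟨b3, b4⟩, hv'⟩ := fl_vert h p q y hy
  rw [abs_lt] at h1 h2
  have d1 : i - i' ≤ 1 ∧ i' - i ≤ 1 := by
    constructor
    · have : ((i - i' : ℤ) : ℝ) < 2 := by push_cast; linarith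
      have : i - i' < 2 := by exact_mod_cast this
      omega
    · have : ((i' - i : ℤ) : ℝ) < 2 := by push_cast; linarith
      have : i' - i < 2 := by exact_mod_cast this
      omega
  have d2 : j - j' ≤ 1 ∧ j' - j ≤ 1 := by
    constructor
    · have : ((j - j' : ℤ) : ℝ) < 2 := by push_cast; linarith
      have : j - j' < 2 := by exact_mod_cast this
      omega
    · have : ((j' - j : ℤ) : ℝ) < 2 := by push_cast; linarith
      have : j' - j < 2 := by exact_mod_cast this
      omega
  have corner : ∀ a b : ℤ, a = b ∨ a = b + 1 →
      a * (L : ℤ) ^ q - b * (L : ℤ) ^ q = 0 ∨ a * (L : ℤ) ^ q - b * (L : ℤ) ^ q = (L : ℤ) ^ q := by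
    rintro a b (rfl | rfl)
    · left; ring
    · right; ring
  have k1 := key i j hc _ _ hv
  have k2 := key i' j' hc' _ _ hv'
  have k3 := key i j hc (max i i' * (L : ℤ) ^ q) (max j j' * (L : ℤ) ^ q)
    (isVert_corners h q _ _ (corner _ _ (by omega)) (corner _ _ (by omega)))
  have k4 := key i' j' hc' (max i i' * (L : ℤ) ^ q) (max j j' * (L : ℤ) ^ q)
    (isVert_corners h q _ _ (corner _ _ (by omega)) (corner _ _ (by omega)))
  rw [abs_le] at *
  constructor <;> linarith [k1.1, k1.2, k2.1, k2.2, k3.1, k3.2, k4.1, k4.2]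

lemma limit_fun (h : GoodCarpet L A) (r c M : ℝ) (hr : 1 < r) (hc1 : 1 ≤ c) (hM0 : 0 ≤ M)
    (hres : ∀ (m k : ℕ) (f : ℤ → ℤ → ℝ),
      (r ^ m * QQ L A m fun i j => f (i * (L : ℤ) ^ k) (j * (L : ℤ) ^ k)) ≤
        c * (r ^ (m + k) * QQ L A (m + k) f))
    (hosc : ∀ (n : ℕ) (f : ℤ → ℤ → ℝ) (x y : ℤ),
      IsVert L A n x y → (f x y - f 0 0) ^ 2 ≤ c * (r ^ n * QQ L A n f))
    (m : ℕ) (U : ℕ → ℤ → ℤ → ℝ) (hM : ∀ k, r ^ (m + k) * QQ L A (m + k) (U k) ≤ M)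
    (hb : ∀ x ∈ carpetF L A, Bdd (fun k => U k (fl L (m + k) x.1) (fl L (m + k) x.2))) :
    ContinuousOn (fun x : ℝ × ℝ => ulim (fun k => U k (fl L (m + k) x.1) (fl L (m + k) x.2)))
      (carpetF L A) ∧
    ∀ j, qq L A r (fun x : ℝ × ℝ => ulim (fun k => U k (fl L (m + k) x.1) (fl L (m + k) x.2))) j
      ≤ c * M := by
  have hL : 0 < L := by have := h.three_le; omega
  have hL1 : (1 : ℝ) < L := by have := h.three_le; exact_mod_cast (by omega : 1 < L)
  have hev : ∀ p, ∀ᶠ k in (Filter.hyperfilter ℕ : Filter ℕ), p ≤ k := fun p =>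
    Nat.hyperfilter_le_atTop (Filter.eventually_ge_atTop p)
  constructor
  · intro x hx
    rw [Metric.continuousWithinAt_iff]
    intro η hη
    have ht : Filter.Tendsto (fun p : ℕ => 4 * Real.sqrt (c * M / r ^ p)) Filter.atTop
        (nhds 0) := by
      have h1 : Filter.Tendsto (fun p : ℕ => c * M / r ^ p) Filter.atTop (nhds 0) :=
        Filter.Tendsto.div_atTop tendsto_const_nhds (tendsto_pow_atTop_atTop_of_one_lt hr)
      have h2 := ((Real.continuous_sqrt.tendsto 0).comp h1).const_mul 4
      simpa using h2
    obtain ⟨p, hp⟩ := (ht.eventually (gt_mem_nhds hη)).exists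
    have hLp : (0 : ℝ) < (L : ℝ) ^ p := by positivity
    refine ⟨1 / (L : ℝ) ^ p, by positivity, ?_⟩
    intro y hy hxy
    rw [Prod.dist_eq, max_lt_iff] at hxy
    have conv : ∀ s t : ℝ, dist s t < 1 / (L : ℝ) ^ p →
        |(L : ℝ) ^ p * s - (L : ℝ) ^ p * t| < 1 := by
      intro s t hst
      rw [← mul_sub, abs_mul, abs_of_pos hLp]
      rw [Real.dist_eq, lt_div_iff₀ hLp] at hst
      linarith
    rw [Real.dist_eq]
    refine lt_of_le_of_lt ?_ hp
    have t1 := ((ulim_tendsto (hb y hy)).sub (ulim_tendsto (hb x hx))).abs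
    refine le_of_tendsto t1 ?_
    filter_upwards [hev p] with k hk
    obtain ⟨q, hq⟩ : ∃ q, m + k = p + q := ⟨m + k - p, by omega⟩
    have hMk := hM k
    rw [hq] at hMk
    rw [hq]
    exact osc_near h r c M hr hc1 hosc p q (U k) hMk y x hy hx (conv _ _ hxy.1) (conv _ _ hxy.2)
  · intro j
    have hLj : (L : ℝ) ^ j ≠ 0 := by positivity
    have t1 : Filter.Tendsto (fun k => r ^ j * QQ L A j (disc L j
        (fun x : ℝ × ℝ => U k (fl L (m + k) x.1) (fl L (m + k) x.2))))
        (Filter.hyperfilter ℕ : Filter ℕ) (nhds (qq L A r (fun x : ℝ × ℝ =>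
          ulim (fun k => U k (fl L (m + k) x.1) (fl L (m + k) x.2))) j)) := by
      apply Filter.Tendsto.const_mul
      apply QQ_tendsto
      intro x y hv
      exact ulim_tendsto (hb _ (vert_mem_F h j x y hv))
    refine le_of_tendsto t1 ?_
    filter_upwards [hev j] with k hk
    obtain ⟨q, hq⟩ : ∃ q, m + k = j + q := ⟨m + k - j, by omega⟩
    have hMk := hM k
    rw [hq] at hMk
    rw [hq]
    have e : disc L j (fun x : ℝ × ℝ => U k (fl L (j + q) x.1) (fl L (j + q) x.2)) =
        fun a b => U k (a * (L : ℤ) ^ q) (b * (L : ℤ) ^ q) := by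
      funext a b
      have : ∀ a : ℤ, fl L (j + q) ((a : ℝ) / (L : ℝ) ^ j) = a * (L : ℤ) ^ q := by
        intro a
        unfold fl
        have : (L : ℝ) ^ (j + q) * ((a : ℝ) / (L : ℝ) ^ j) = ((a * (L : ℤ) ^ q : ℤ) : ℝ) := by
          push_cast
          rw [pow_add]; field_simp
        rw [this, Int.floor_intCast]
      simp only [disc, this]
    rw [e]
    exact (hres j q (U k)).trans (mul_le_mul_of_nonneg_left hMk (by linarith))

lemma bil_dist (f : ℤ → ℤ → ℝ) (a b : ℤ) (X Y v ε : ℝ) (hX : 0 ≤ X ∧ X ≤ 1) (hY : 0 ≤ Y ∧ Y ≤ 1)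
    (hf : ∀ s t, a ≤ s → s ≤ a + 1 → b ≤ t → t ≤ b + 1 → |v - f s t| ≤ ε) :
    |v - bil f a b X Y| ≤ ε := by
  have e1 := abs_le.1 (hf a b (by omega) (by omega) (by omega) (by omega))
  have e2 := abs_le.1 (hf (a + 1) b (by omega) (by omega) (by omega) (by omega))
  have e3 := abs_le.1 (hf a (b + 1) (by omega) (by omega) (by omega) (by omega))
  have e4 := abs_le.1 (hf (a + 1) (b + 1) (by omega) (by omega) (by omega) (by omega))
  have w1 : 0 ≤ (1 - X) * (1 - Y) := mul_nonneg (by linarith) (by linarith)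
  have w2 : 0 ≤ X * (1 - Y) := mul_nonneg (by linarith) (by linarith)
  have w3 : 0 ≤ (1 - X) * Y := mul_nonneg (by linarith) (by linarith)
  have w4 : 0 ≤ X * Y := mul_nonneg (by linarith) (by linarith)
  have e : v - bil f a b X Y = (1 - X) * (1 - Y) * (v - f a b) + X * (1 - Y) * (v - f (a + 1) b)
      + (1 - X) * Y * (v - f a (b + 1)) + X * Y * (v - f (a + 1) (b + 1)) := by
    unfold bil; ring
  rw [e, abs_le]
  constructor
  · nlinarith [mul_le_mul_of_nonneg_left e1.1 w1, mul_le_mul_of_nonneg_left e2.1 w2,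
      mul_le_mul_of_nonneg_left e3.1 w3, mul_le_mul_of_nonneg_left e4.1 w4]
  · nlinarith [mul_le_mul_of_nonneg_left e1.2 w1, mul_le_mul_of_nonneg_left e2.2 w2,
      mul_le_mul_of_nonneg_left e3.2 w3, mul_le_mul_of_nonneg_left e4.2 w4]

lemma density (h : GoodCarpet L A) (r c : ℝ) (hr : 1 < r) (hc1 : 1 ≤ c)
    (hsig : ∀ n, sig L A n * r ^ n ≤ c)
    (hres : ∀ (m k : ℕ) (f : ℤ → ℤ → ℝ),
      (r ^ m * QQ L A m fun i j => f (i * (L : ℤ) ^ k) (j * (L : ℤ) ^ k)) ≤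
        c * (r ^ (m + k) * QQ L A (m + k) f))
    (hosc : ∀ (n : ℕ) (f : ℤ → ℤ → ℝ) (x y : ℤ),
      IsVert L A n x y → (f x y - f 0 0) ^ 2 ≤ c * (r ^ n * QQ L A n f))
    (f : ℝ × ℝ → ℝ) (hf : ContinuousOn f (carpetF L A)) (ε : ℝ) (hε : 0 < ε) :
    ∃ g : ℝ × ℝ → ℝ, ContinuousOn g (carpetF L A) ∧ (∃ B, ∀ n, qq L A r g n ≤ B) ∧
      ∀ x ∈ carpetF L A, |f x - g x| ≤ ε := by
  have hL : 0 < L := by have := h.three_le; omega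
  have hL1 : (1 : ℝ) < L := by have := h.three_le; exact_mod_cast (by omega : 1 < L)
  have huc := (isCompact_F hL).uniformContinuousOn_of_continuous hf
  rw [Metric.uniformContinuousOn_iff] at huc
  obtain ⟨δ, hδ, hd⟩ := huc ε hε
  obtain ⟨m, hm⟩ : ∃ m : ℕ, 1 / (L : ℝ) ^ m < δ := by
    obtain ⟨m, hm⟩ := exists_pow_lt_of_lt_one hδ (inv_lt_one_of_one_lt₀ hL1)
    exact ⟨m, by rwa [inv_pow, ← one_div] at hm⟩
  have hLm : (0 : ℝ) < (L : ℝ) ^ m := by positivity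
  choose hk hkg hks using exists_good h
  set U : ℕ → ℤ → ℤ → ℝ := fun k => Ext ((L : ℤ) ^ k) (hk k) (disc L m f) with hU
  have hval : ∀ x ∈ carpetF L A, ∀ k,
      |f x - U k (fl L (m + k) x.1) (fl L (m + k) x.2)| ≤ ε := by
    intro x hx k
    obtain ⟨i, j, hc, ⟨a1, a2⟩, a3, a4⟩ := (mem_F_iff hL x).1 hx m
    have s1 := fl_cell m k x.1 i a1 a2
    have s2 := fl_cell m k x.2 j a3 a4
    have e := Ext_cell (Lpow_pos hL k) (hkg k) (disc L m f) i j _ _ s1.1 s1.2 s2.1 s2.2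
    rw [add_sub_cancel, add_sub_cancel] at e
    simp only [hU]
    rw [e]
    apply bil_dist
    · exact (hkg k).2.2 _ _
    · exact (hkg k).2.2 _ _
    intro s t h1 h2 h3 h4
    have hv : IsVert L A m s t := ⟨i, j, hc, ⟨h1, h2⟩, h3, h4⟩
    have := hd x hx _ (vert_mem_F h m s t hv) (by
      refine lt_of_le_of_lt ?_ hm
      have near : ∀ (z : ℝ) (i s : ℤ), (i : ℝ) ≤ (L : ℝ) ^ m * z → (L : ℝ) ^ m * z ≤ i + 1 →
          i ≤ s → s ≤ i + 1 → dist z ((s : ℝ) / (L : ℝ) ^ m) ≤ 1 / (L : ℝ) ^ m := by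
        intro z i s u1 u2 u3 u4
        have u3' : (i : ℝ) ≤ s := by exact_mod_cast u3
        have u4' : (s : ℝ) ≤ i + 1 := by exact_mod_cast u4
        rw [Real.dist_eq, le_div_iff₀ hLm, ← abs_of_pos hLm, ← abs_mul, abs_of_pos hLm, sub_mul,
          div_mul_cancel₀ _ hLm.ne', abs_le]
        constructor <;> linarith
      rw [Prod.dist_eq]
      exact max_le (near _ _ _ a1 a2 h1 h2) (near _ _ _ a3 a4 h3 h4))
    rw [Real.dist_eq] at this
    exact this.le
  have hb : ∀ x ∈ carpetF L A, Bdd (fun k => U k (fl L (m + k) x.1) (fl L (m + k) x.2)) := by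
    intro x hx
    refine ⟨|f x| + ε, fun k => ?_⟩
    have := abs_le.1 (hval x hx k)
    rw [abs_le]
    constructor <;> linarith [le_abs_self (f x), neg_abs_le (f x)]
  set Qf := QQ L A m (disc L m f) with hQf
  have hQ0 : 0 ≤ Qf := QQ_nonneg _ _
  have hM : ∀ k, r ^ (m + k) * QQ L A (m + k) (U k) ≤ 8 * c * r ^ m * Qf := by
    intro k
    have e1 := Ext_energy h k (hkg k) m (disc L m f)
    have e2 := hks k
    have e3 := hsig k
    have rm : 0 < r ^ m := by positivity
    have rk : 0 < r ^ k := by positivity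
    have e4 : QQ L A (m + k) (U k) ≤ 8 * sig L A k * Qf := by
      refine e1.trans ?_
      have := mul_le_mul_of_nonneg_right e2 hQ0
      linarith
    calc r ^ (m + k) * QQ L A (m + k) (U k) ≤ r ^ (m + k) * (8 * sig L A k * Qf) :=
          mul_le_mul_of_nonneg_left e4 (by positivity)
      _ = 8 * (sig L A k * r ^ k) * (r ^ m * Qf) := by rw [pow_add]; ring
      _ ≤ 8 * c * (r ^ m * Qf) := by
          apply mul_le_mul_of_nonneg_right _ (by positivity)
          linarith
      _ = _ := by ring
  obtain ⟨g1, g2⟩ := limit_fun h r c (8 * c * r ^ m * Qf) hr hc1 (by positivity) hres hosc m U hM hb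
  refine ⟨_, g1, ⟨_, g2⟩, ?_⟩
  intro x hx
  refine le_of_tendsto ((tendsto_const_nhds.sub (ulim_tendsto (hb x hx))).abs) ?_
  exact Filter.Eventually.of_forall fun k => hval x hx k





/-! ### The energy -/

/-- finite-energy functions -/
def FinEn (L : ℕ) (A : Finset (ℕ × ℕ)) (r : ℝ) (f : ℝ × ℝ → ℝ) : Prop :=
  ∃ B, ∀ n, qq L A r f n ≤ B

/-- the energy -/
noncomputable def EE (L : ℕ) (A : Finset (ℕ × ℕ)) (r : ℝ) (f : ℝ × ℝ → ℝ) : ENNReal :=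
  if FinEn L A r f then ENNReal.ofReal (blim (qq L A r f)) else ⊤

lemma qq_nonneg {r : ℝ} (hr : 1 < r) (f : ℝ × ℝ → ℝ) (n : ℕ) : 0 ≤ qq L A r f n :=
  mul_nonneg (by positivity) (QQ_nonneg _ _)

lemma FinEn.bdd {r : ℝ} (hr : 1 < r) {f : ℝ × ℝ → ℝ} (hf : FinEn L A r f) : Bdd (qq L A r f) := by
  obtain ⟨B, hB⟩ := hf
  exact ⟨B, fun n => by rw [abs_of_nonneg (qq_nonneg hr f n)]; exact hB n⟩

lemma EE_of {r : ℝ} {f : ℝ × ℝ → ℝ} (hf : FinEn L A r f) :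
    EE L A r f = ENNReal.ofReal (blim (qq L A r f)) := if_pos hf

lemma EE_not {r : ℝ} {f : ℝ × ℝ → ℝ} (hf : ¬ FinEn L A r f) : EE L A r f = ⊤ := if_neg hf

lemma EE_lt {r : ℝ} {f : ℝ × ℝ → ℝ} : EE L A r f < ⊤ ↔ FinEn L A r f := by
  by_cases hf : FinEn L A r f
  · rw [EE_of hf]; simp [hf]
  · rw [EE_not hf]; simp [hf]

lemma blim_nonneg {r : ℝ} (hr : 1 < r) {f : ℝ × ℝ → ℝ} (hf : FinEn L A r f) :
    0 ≤ blim (qq L A r f) :=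
  le_blim (hf.bdd hr) 0 0 fun n _ => qq_nonneg hr f n

lemma EE_comp {r c : ℝ} (hr : 1 < r) (hc1 : 1 ≤ c) (hL : 0 < L)
    (h1 : ∀ (f : ℝ × ℝ → ℝ) (n : ℕ), qq L A r f n ≤ c * (RR L A n * Dform L A n f))
    (h2 : ∀ (f : ℝ × ℝ → ℝ) (n : ℕ), RR L A n * Dform L A n f ≤ c * qq L A r f n)
    (hres : ∀ (m k : ℕ) (f : ℤ → ℤ → ℝ),
      (r ^ m * QQ L A m fun i j => f (i * (L : ℤ) ^ k) (j * (L : ℤ) ^ k)) ≤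
        c * (r ^ (m + k) * QQ L A (m + k) f)) (f : ℝ × ℝ → ℝ) :
    ENNReal.ofReal (c ^ 2)⁻¹ * (⨆ n : ℕ, ENNReal.ofReal (RR L A n * Dform L A n f)) ≤ EE L A r f ∧
    EE L A r f ≤ ENNReal.ofReal (c ^ 2) *
      (⨆ n : ℕ, ENNReal.ofReal (RR L A n * Dform L A n f)) := by
  have hc0 : 0 < c := by linarith
  have hc2 : c ≤ c ^ 2 := by nlinarith
  constructor
  · by_cases hf : FinEn L A r f
    · rw [EE_of hf, ENNReal.mul_iSup]
      apply iSup_le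
      intro m
      rw [← ENNReal.ofReal_mul (by positivity)]
      apply ENNReal.ofReal_le_ofReal
      apply le_blim (hf.bdd hr) m
      intro n hn
      obtain ⟨k, rfl⟩ := Nat.exists_eq_add_of_le hn
      have e := hres m k (disc L (m + k) f)
      have e' : (fun i j : ℤ => disc L (m + k) f (i * (L : ℤ) ^ k) (j * (L : ℤ) ^ k)) =
          disc L m f := by
        funext i j
        have : ∀ i : ℤ, ((i * (L : ℤ) ^ k : ℤ) : ℝ) / (L : ℝ) ^ (m + k) = i / (L : ℝ) ^ m := by
          intro i
          push_cast
          rw [pow_add]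
          have : (L : ℝ) ^ m ≠ 0 := by positivity
          have : (L : ℝ) ^ k ≠ 0 := by positivity
          field_simp
        simp only [disc, this]
      rw [e'] at e
      have e2 := h2 f m
      rw [inv_mul_le_iff₀ (by positivity)]
      refine e2.trans ?_
      have := mul_le_mul_of_nonneg_left e hc0.le
      unfold qq
      linarith
    · rw [EE_not hf]; exact le_top
  · by_cases hS : (⨆ n : ℕ, ENNReal.ofReal (RR L A n * Dform L A n f)) = ⊤
    · rw [hS, ENNReal.mul_top]
      · exact le_top
      · simp; positivity
    · set S := (⨆ n : ℕ, ENNReal.ofReal (RR L A n * Dform L A n f)) with hSd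
      have hp : ∀ n, RR L A n * Dform L A n f ≤ S.toReal := by
        intro n
        rw [← ENNReal.ofReal_le_iff_le_toReal hS]
        exact le_iSup (fun n : ℕ => ENNReal.ofReal (RR L A n * Dform L A n f)) n
      have hq : ∀ n, qq L A r f n ≤ c ^ 2 * S.toReal := by
        intro n
        refine (h1 f n).trans ?_
        have s0 : 0 ≤ S.toReal := ENNReal.toReal_nonneg
        have := mul_le_mul_of_nonneg_left (hp n) hc0.le
        nlinarith
      have hf : FinEn L A r f := ⟨_, hq⟩
      rw [EE_of hf]
      refine (ENNReal.ofReal_le_ofReal (blim_le (hf.bdd hr) _ hq)).trans ?_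
      rw [ENNReal.ofReal_mul (by positivity), ENNReal.ofReal_toReal hS]

lemma qq_succ {r : ℝ} (hL : 0 < L) (f : ℝ × ℝ → ℝ) (n : ℕ) :
    qq L A r f (n + 1) = r * ∑ a ∈ A, qq L A r (f ∘ Psi L a) n := by
  unfold qq
  rw [QQ_disc_succ hL, ← Finset.mul_sum, pow_succ]
  ring

lemma EE_selfsim {r : ℝ} (hr : 1 < r) (hL : 0 < L) (f : ℝ × ℝ → ℝ) :
    EE L A r f = ENNReal.ofReal r * ∑ p ∈ A, EE L A r (f ∘ Psi L p) := by
  have hr0 : 0 < r := by linarith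
  by_cases hf : FinEn L A r f
  · have hfa : ∀ a ∈ A, FinEn L A r (f ∘ Psi L a) := by
      intro a ha
      obtain ⟨B, hB⟩ := hf
      refine ⟨B / r, fun n => ?_⟩
      rw [le_div_iff₀ hr0]
      refine le_trans ?_ (hB (n + 1))
      rw [qq_succ hL, mul_comm]
      apply mul_le_mul_of_nonneg_left _ hr0.le
      exact Finset.single_le_sum (f := fun a => qq L A r (f ∘ Psi L a) n)
        (fun b _ => qq_nonneg hr _ n) ha
    rw [EE_of hf, Finset.sum_congr rfl (fun a ha => EE_of (hfa a ha)),
      ← ENNReal.ofReal_sum_of_nonneg (fun a ha => blim_nonneg hr (hfa a ha)),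
      ← ENNReal.ofReal_mul hr0.le]
    congr 1
    rw [← blim_succ (hf.bdd hr), ← blim_sum A (fun a => qq L A r (f ∘ Psi L a))
      (fun a ha => (hfa a ha).bdd hr), ← blim_smul r (Bdd_sum A _ (fun a ha => (hfa a ha).bdd hr))]
    congr 1
    funext n
    exact qq_succ hL f n
  · rw [EE_not hf]
    have : ∃ a ∈ A, ¬ FinEn L A r (f ∘ Psi L a) := by
      by_contra hcon
      push Not at hcon
      apply hf
      have hB := Bdd_sum A (fun a => qq L A r (f ∘ Psi L a)) (fun a ha => (hcon a ha).bdd hr)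
      obtain ⟨B, hB⟩ := hB
      refine ⟨max (qq L A r f 0) (r * B), fun n => ?_⟩
      cases n with
      | zero => exact le_max_left _ _
      | succ n =>
        refine le_trans ?_ (le_max_right _ _)
        rw [qq_succ hL]
        exact mul_le_mul_of_nonneg_left ((le_abs_self _).trans (hB n)) hr0.le
    obtain ⟨a, ha, hna⟩ := this
    have e : ∑ p ∈ A, EE L A r (f ∘ Psi L p) = ⊤ :=
      ENNReal.sum_eq_top.2 ⟨a, ha, EE_not hna⟩
    rw [e, ENNReal.mul_top]
    simpa using hr0

lemma EE_markov {r : ℝ} (hr : 1 < r) (f : ℝ × ℝ → ℝ) :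
    EE L A r (fun x => min (max (f x) 0) 1) ≤ EE L A r f := by
  have hle : ∀ n, qq L A r (fun x => min (max (f x) 0) 1) n ≤ qq L A r f n := by
    intro n
    apply mul_le_mul_of_nonneg_left _ (by positivity)
    exact QQ_contract n (fun s => min (max s 0) 1) clamp_contract (disc L n f)
  by_cases hf : FinEn L A r f
  · have hg : FinEn L A r (fun x => min (max (f x) 0) 1) := by
      obtain ⟨B, hB⟩ := hf
      exact ⟨B, fun n => (hle n).trans (hB n)⟩
    rw [EE_of hf, EE_of hg]
    exact ENNReal.ofReal_le_ofReal (blim_mono (hg.bdd hr) (hf.bdd hr) hle)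
  · rw [EE_not hf]; exact le_top

lemma qq_add_le {r : ℝ} (hr : 1 < r) (f g : ℝ × ℝ → ℝ) (n : ℕ) :
    qq L A r (f + g) n ≤ 2 * qq L A r f n + 2 * qq L A r g n := by
  have := mul_le_mul_of_nonneg_left (QQ_add_le (L := L) (A := A) n (disc L n f) (disc L n g))
    (by positivity : 0 ≤ r ^ n)
  unfold qq
  refine le_trans this (le_of_eq ?_)
  ring

lemma qq_smul {r : ℝ} (a : ℝ) (f : ℝ × ℝ → ℝ) (n : ℕ) :
    qq L A r (a • f) n = a ^ 2 * qq L A r f n := by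
  have := QQ_affine (L := L) (A := A) n a 0 (disc L n f)
  simp only [add_zero] at this
  have e : disc L n (a • f) = fun x y => a * disc L n f x y := by
    funext x y; simp [disc]
  unfold qq
  rw [e, this]; ring

lemma qq_par {r : ℝ} (f g : ℝ × ℝ → ℝ) (n : ℕ) :
    qq L A r (f + g) n + qq L A r (f - g) n = 2 * qq L A r f n + 2 * qq L A r g n := by
  have := QQ_parallelogram (L := L) (A := A) n (disc L n f) (disc L n g)
  have e1 : disc L n (f + g) = fun x y => disc L n f x y + disc L n g x y := rfl
  have e2 : disc L n (f - g) = fun x y => disc L n f x y - disc L n g x y := rfl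
  unfold qq
  rw [e1, e2, ← mul_add, this]; ring

lemma FinEn.add {r : ℝ} (hr : 1 < r) {f g : ℝ × ℝ → ℝ} (hf : FinEn L A r f) (hg : FinEn L A r g) :
    FinEn L A r (f + g) := by
  obtain ⟨B, hB⟩ := hf
  obtain ⟨C, hC⟩ := hg
  exact ⟨2 * B + 2 * C, fun n => (qq_add_le hr f g n).trans (by linarith [hB n, hC n])⟩

lemma FinEn.smul {r : ℝ} {f : ℝ × ℝ → ℝ} (hf : FinEn L A r f) (a : ℝ) :
    FinEn L A r (a • f) := by
  obtain ⟨B, hB⟩ := hf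
  refine ⟨a ^ 2 * B, fun n => ?_⟩
  rw [qq_smul]
  exact mul_le_mul_of_nonneg_left (hB n) (sq_nonneg a)

lemma EE_par {r : ℝ} (hr : 1 < r) {f g : ℝ × ℝ → ℝ} (hf : FinEn L A r f) (hg : FinEn L A r g) :
    EE L A r (f + g) + EE L A r (f - g) = 2 * EE L A r f + 2 * EE L A r g := by
  have ha := hf.add hr hg
  have hs : FinEn L A r (f - g) := by
    have := hf.add hr (hg.smul (-1))
    rwa [neg_one_smul, ← sub_eq_add_neg] at this
  have two : (2 : ENNReal) = ENNReal.ofReal 2 := by simp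
  rw [EE_of ha, EE_of hs, EE_of hf, EE_of hg, ← ENNReal.ofReal_add (blim_nonneg hr ha)
    (blim_nonneg hr hs), two, ← ENNReal.ofReal_mul (by norm_num), ← ENNReal.ofReal_mul (by norm_num),
    ← ENNReal.ofReal_add (mul_nonneg (by norm_num) (blim_nonneg hr hf))
      (mul_nonneg (by norm_num) (blim_nonneg hr hg))]
  congr 1
  rw [← blim_add (ha.bdd hr) (hs.bdd hr)]
  have b2 : ∀ {u : ℕ → ℝ}, Bdd u → Bdd (fun n => 2 * u n) := by
    rintro u ⟨B, hB⟩
    refine ⟨2 * B, fun n => ?_⟩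
    rw [abs_mul, abs_of_pos (by norm_num : (0:ℝ) < 2)]
    linarith [hB n]
  rw [← blim_smul 2 (hf.bdd hr), ← blim_smul 2 (hg.bdd hr),
    ← blim_add (b2 (hf.bdd hr)) (b2 (hg.bdd hr))]
  congr 1
  funext n
  exact qq_par f g n

lemma qq_local (h : GoodCarpet L A) {r : ℝ} (f g : ℝ × ℝ → ℝ)
    (n : ℕ) (k : ℝ)
    (hloc : ∀ i j, IsCell L A n i j →
      (∀ x y, i ≤ x → x ≤ i + 1 → j ≤ y → y ≤ j + 1 → disc L n g x y = 0) ∨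
      (∀ x y, i ≤ x → x ≤ i + 1 → j ≤ y → y ≤ j + 1 → disc L n f x y = k)) :
    qq L A r (f + g) n = qq L A r f n + qq L A r g n := by
  have cell : ∀ i j, IsCell L A n i j → Q0 (sh i j (disc L n (f + g))) =
      Q0 (sh i j (disc L n f)) + Q0 (sh i j (disc L n g)) := by
    intro i j hc
    have e1 : disc L n (f + g) = fun x y => disc L n f x y + disc L n g x y := rfl
    rw [e1]
    rcases hloc i j hc with H | H
    all_goals
      have h1 := H (i + 0) (j + 0) (by omega) (by omega) (by omega) (by omega)
      have h2 := H (i + 1) (j + 0) (by omega) (by omega) (by omega) (by omega)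
      have h3 := H (i + 0) (j + 1) (by omega) (by omega) (by omega) (by omega)
      have h4 := H (i + 1) (j + 1) (by omega) (by omega) (by omega) (by omega)
      simp only [Q0, sh, h1, h2, h3, h4]
      ring
  have u1 := QQ_mono_two n 1 1 (disc L n (f + g)) (disc L n f) (disc L n g) (fun i j hc => by
    rw [cell i j hc]; linarith)
  have u2 := QQ_mono_two n 1 (-1) (disc L n f) (disc L n (f + g)) (disc L n g) (fun i j hc => by
    rw [cell i j hc]; linarith)
  unfold qq
  rw [← mul_add]
  congr 1
  linarith

lemma EE_local (h : GoodCarpet L A) {r : ℝ} (hr : 1 < r) {f g : ℝ × ℝ → ℝ} (hf : FinEn L A r f)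
    (hg : FinEn L A r g) (hU : ∃ U : Set (ℝ × ℝ), IsOpen U ∧
          closure {x | x ∈ carpetF L A ∧ g x ≠ 0} ∩ carpetF L A ⊆ U ∧
          ∃ k : ℝ, ∀ x ∈ U ∩ carpetF L A, f x = k) :
    EE L A r (f + g) = EE L A r f + EE L A r g := by
  have hL : 0 < L := by have := h.three_le; omega
  have hL1 : (1 : ℝ) < L := by have := h.three_le; exact_mod_cast (by omega : 1 < L)
  obtain ⟨U, hUo, hUs, k, hk⟩ := hU
  have hcomp : IsCompact (closure {x | x ∈ carpetF L A ∧ g x ≠ 0} ∩ carpetF L A) :=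
    (isCompact_F hL).inter_left isClosed_closure
  obtain ⟨δ, hδ, hth⟩ := hcomp.exists_thickening_subset_open hUo hUs
  obtain ⟨N, hN⟩ : ∃ m : ℕ, 1 / (L : ℝ) ^ m < δ := by
    obtain ⟨m, hm⟩ := exists_pow_lt_of_lt_one hδ (inv_lt_one_of_one_lt₀ hL1)
    exact ⟨m, by rwa [inv_pow, ← one_div] at hm⟩
  have key : ∀ n, N ≤ n → qq L A r (f + g) n = qq L A r f n + qq L A r g n := by
    intro n hn
    apply qq_local h f g n k
    intro i j hc
    have hLn : (0 : ℝ) < (L : ℝ) ^ n := by positivity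
    have hsmall : 1 / (L : ℝ) ^ n < δ := by
      refine lt_of_le_of_lt ?_ hN
      apply one_div_le_one_div_of_le (by positivity)
      exact pow_le_pow_right₀ hL1.le hn
    by_cases H : ∀ x y, i ≤ x → x ≤ i + 1 → j ≤ y → y ≤ j + 1 → disc L n g x y = 0
    · exact Or.inl H
    right
    push Not at H
    obtain ⟨x0, y0, a1, a2, a3, a4, hne⟩ := H
    intro x y b1 b2 b3 b4
    have m0 := vert_mem_F h n x0 y0 ⟨i, j, hc, ⟨a1, a2⟩, a3, a4⟩
    have m1 := vert_mem_F h n x y ⟨i, j, hc, ⟨b1, b2⟩, b3, b4⟩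
    apply hk
    refine ⟨hth ?_, m1⟩
    rw [Metric.mem_thickening_iff]
    refine ⟨_, ⟨subset_closure ⟨m0, hne⟩, m0⟩, ?_⟩
    refine lt_of_le_of_lt ?_ hsmall
    have near : ∀ i s t : ℤ, i ≤ s → s ≤ i + 1 → i ≤ t → t ≤ i + 1 →
        dist ((s : ℝ) / (L : ℝ) ^ n) ((t : ℝ) / (L : ℝ) ^ n) ≤ 1 / (L : ℝ) ^ n := by
      intro i s t u1 u2 u3 u4
      have v1 : (s : ℝ) - t ≤ 1 := by exact_mod_cast (by omega : s - t ≤ 1)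
      have v2 : (t : ℝ) - s ≤ 1 := by exact_mod_cast (by omega : t - s ≤ 1)
      rw [Real.dist_eq, ← sub_div, abs_div, abs_of_pos hLn]
      apply div_le_div_of_nonneg_right _ hLn.le
      rw [abs_le]
      constructor <;> linarith
    rw [Prod.dist_eq]
    exact max_le (near _ _ _ b1 b2 a1 a2) (near _ _ _ b3 b4 a3 a4)
  have ha := hf.add hr hg
  rw [EE_of ha, EE_of hf, EE_of hg, ← ENNReal.ofReal_add (blim_nonneg hr hf) (blim_nonneg hr hg)]
  congr 1
  rw [← blim_add (hf.bdd hr) (hg.bdd hr)]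
  refine blim_congr (ha.bdd hr) ?_ N key
  obtain ⟨B, hB⟩ := hf.bdd hr
  obtain ⟨C, hC⟩ := hg.bdd hr
  exact ⟨B + C, fun n => (abs_add_le _ _).trans (add_le_add (hB n) (hC n))⟩

end Proof

open scoped ENNReal

/-- Theorem 4.3, planar case: existence of a self-similar, strongly
local, Markovian energy functional `E` on `C(F)`. -/
theorem self_similar_energy (L : ℕ) (A : Finset (ℕ × ℕ)) (h : GoodCarpet L A) :
    ∃ (r c : ℝ) (E : (ℝ × ℝ → ℝ) → ℝ≥0∞), 1 < r ∧ 1 ≤ c ∧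
      -- (1) comparability with `sup_{n} 𝓡_n · D_n(f|_{V_n})`
      (∀ f : ℝ × ℝ → ℝ, ContinuousOn f (carpetF L A) →
        ENNReal.ofReal c⁻¹ * (⨆ n : ℕ, ENNReal.ofReal (RR L A n * Dform L A n f)) ≤ E f ∧
        E f ≤ ENNReal.ofReal c * (⨆ n : ℕ, ENNReal.ofReal (RR L A n * Dform L A n f))) ∧
      -- (2) self-similarity
      (∀ f : ℝ × ℝ → ℝ, ContinuousOn f (carpetF L A) →
        E f = ENNReal.ofReal r * ∑ p ∈ A, E (f ∘ Psi L p)) ∧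
      -- (3) Markov property
      (∀ f : ℝ × ℝ → ℝ, ContinuousOn f (carpetF L A) →
        E (fun x => min (max (f x) 0) 1) ≤ E f) ∧
      -- (4) the finite-energy domain is a linear subspace …
      (∀ f g : ℝ × ℝ → ℝ, ContinuousOn f (carpetF L A) → ContinuousOn g (carpetF L A) →
        E f < ⊤ → E g < ⊤ → E (f + g) < ⊤ ∧ ∀ a : ℝ, E (a • f) < ⊤) ∧
      -- … which is dense in `C(F)` for the sup norm …
      (∀ f : ℝ × ℝ → ℝ, ContinuousOn f (carpetF L A) → ∀ ε : ℝ, 0 < ε →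
        ∃ g : ℝ × ℝ → ℝ, ContinuousOn g (carpetF L A) ∧ E g < ⊤ ∧
          ∀ x ∈ carpetF L A, |f x - g x| ≤ ε) ∧
      -- … and on it `E` satisfies the parallelogram law
      (∀ f g : ℝ × ℝ → ℝ, ContinuousOn f (carpetF L A) → ContinuousOn g (carpetF L A) →
        E f < ⊤ → E g < ⊤ → E (f + g) + E (f - g) = 2 * E f + 2 * E g) ∧
      -- (5) strong locality
      (∀ f g : ℝ × ℝ → ℝ, ContinuousOn f (carpetF L A) → ContinuousOn g (carpetF L A) →
        E f < ⊤ → E g < ⊤ →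
        (∃ U : Set (ℝ × ℝ), IsOpen U ∧
          closure {x | x ∈ carpetF L A ∧ g x ≠ 0} ∩ carpetF L A ⊆ U ∧
          ∃ k : ℝ, ∀ x ∈ U ∩ carpetF L A, f x = k) →
        E (f + g) = E f + E g) ∧
      -- (6) geometric growth of the resistance sequence
      (∀ n : ℕ, c⁻¹ * r ^ n ≤ RR L A n ∧ RR L A n ≤ c * r ^ n) := by



  have hL : 0 < L := by have := h.three_le; omega
  obtain ⟨r, c, hr, hc, h1, h2, h3, h4, h5, h6⟩ := consts h
  have hc0 : 0 < c := by linarith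
  have hc2 : c ≤ c ^ 2 := by nlinarith
  refine ⟨r, c ^ 2, EE L A r, hr, by linarith, fun f _ => EE_comp hr hc hL h3 h4 h5 f,
    fun f _ => EE_selfsim hr hL f, fun f _ => EE_markov hr f, ?_, ?_, ?_, ?_, ?_⟩
  · intro f g _ _ hf hg
    rw [EE_lt] at hf hg
    exact ⟨EE_lt.2 (hf.add hr hg), fun a => EE_lt.2 (hf.smul a)⟩
  · intro f hf ε hε
    obtain ⟨g, g1, g2, g3⟩ := density h r c hr hc (fun n => (h1 n).2) h5 h6 f hf ε hε
    exact ⟨g, g1, EE_lt.2 g2, g3⟩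
  · intro f g _ _ hf hg
    exact EE_par hr (EE_lt.1 hf) (EE_lt.1 hg)
  · intro f g _ _ hf hg hU
    exact EE_local h hr (EE_lt.1 hf) (EE_lt.1 hg) hU
  · intro n
    have hrn : 0 < r ^ n := by positivity
    refine ⟨le_trans ?_ (h2 n).1, (h2 n).2.trans ?_⟩
    · exact mul_le_mul_of_nonneg_right (inv_anti₀ hc0 hc2) hrn.le
    · exact mul_le_mul_of_nonneg_right hc2 hrn.le

end Carpet
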